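/- arXiv:1912.12509 — 2 statements merged into one kernel-verified Lean document; each statement's English description precedes it below -/
import Mathlib

section
/- The minimizer of the Pekar functional is unique up to translations and multiplication by a phase: if ψ₁ and ψ₂ are Schwartz functions on ℝ³ with ∫|ψ₁|² = ∫|ψ₂|² = 1 that both minimize 𝓔^Pek among all normalized Schwartz functions (i.e., 𝓔^Pek(ψᵢ) ≤ 𝓔^Pek(ψ) for all Schwartz ψ with ∫|ψ|² = 1, for i = 1,2), then there exist θ ∈ [0, 2π) and y ∈ ℝ³ such that ψ₂(x) = e^{iθ} ψ₁(x − y) for all x ∈ ℝ³. -/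
open MeasureTheory Real

noncomputable section

/-- `ℝ³` as a Euclidean space. -/
abbrev E3 := EuclideanSpace ℝ (Fin 3)

/-- The Pekar functional
`𝓔^Pek(ψ) = ∫ |∇ψ|² − ∫∫ |ψ(x)|²|ψ(y)|²/|x−y| dx dy`. -/
def pekarF (ψ : SchwartzMap E3 ℂ) : ℝ :=
  (∫ x : E3, ‖fderiv ℝ ψ x‖ ^ 2) -
    ∫ x : E3, ∫ y : E3, ‖ψ x‖ ^ 2 * ‖ψ y‖ ^ 2 / ‖x - y‖

open scoped ContDiff ENNReal Convolution

/-- A smooth odd function vanishing on `[-1, 1]` with derivative in `[0, 1]`. -/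
def softCut (t : ℝ) : ℝ := ∫ s in (0 : ℝ)..t, smoothTransition (s ^ 2 - 1)

theorem continuous_softCut_integrand : Continuous fun s : ℝ => smoothTransition (s ^ 2 - 1) :=
  smoothTransition.continuous.comp (by fun_prop)

theorem hasDerivAt_softCut (t : ℝ) : HasDerivAt softCut (smoothTransition (t ^ 2 - 1)) t :=
  intervalIntegral.integral_hasDerivAt_right
    (continuous_softCut_integrand.intervalIntegrable _ _)
    (continuous_softCut_integrand.stronglyMeasurableAtFilter _ _)
    continuous_softCut_integrand.continuousAt

theorem contDiff_softCut : ContDiff ℝ ∞ softCut := by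
  rw [contDiff_infty_iff_deriv]
  refine ⟨fun t => (hasDerivAt_softCut t).differentiableAt, ?_⟩
  have : deriv softCut = fun t => smoothTransition (t ^ 2 - 1) :=
    funext fun t => (hasDerivAt_softCut t).deriv
  rw [this]
  exact smoothTransition.contDiff.comp (by fun_prop)

theorem softCut_eq_zero {t : ℝ} (h0 : 0 ≤ t) (h1 : t ≤ 1) : softCut t = 0 := by
  unfold softCut
  rw [intervalIntegral.integral_congr (g := fun _ => 0)]
  · simp
  · intro s hs
    rw [Set.uIcc_of_le h0] at hs
    exact smoothTransition.zero_of_nonpos (by nlinarith [hs.1, hs.2])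

theorem monotone_softCut : Monotone softCut :=
  monotone_of_deriv_nonneg (fun t => (hasDerivAt_softCut t).differentiableAt) fun t => by
    rw [(hasDerivAt_softCut t).deriv]; exact smoothTransition.nonneg _

theorem softCut_nonneg {t : ℝ} (h0 : 0 ≤ t) : 0 ≤ softCut t := by
  have := monotone_softCut h0
  rwa [softCut_eq_zero le_rfl zero_le_one] at this

theorem monotone_sub_softCut : Monotone fun t => t - softCut t :=
  monotone_of_deriv_nonneg
    (fun t => ((hasDerivAt_id t).sub (hasDerivAt_softCut t)).differentiableAt)
    fun t => by
      rw [((hasDerivAt_id' t).fun_sub (hasDerivAt_softCut t)).deriv]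
      linarith [smoothTransition.le_one (t ^ 2 - 1)]

theorem softCut_le {t : ℝ} (h0 : 0 ≤ t) : softCut t ≤ t := by
  have := monotone_sub_softCut h0
  simp only [softCut_eq_zero le_rfl zero_le_one] at this
  linarith

theorem sub_two_le_softCut (t : ℝ) : t - 2 ≤ softCut t := by
  rcases le_total t 2 with h | h
  · rcases le_total 0 t with h0 | h0
    · linarith [softCut_nonneg h0]
    · have := monotone_sub_softCut h0
      simp only [softCut_eq_zero le_rfl zero_le_one] at this
      linarith
  · have key : MonotoneOn (fun t => softCut t - t) (Set.Ici 2) := by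
      refine monotoneOn_of_deriv_nonneg (convex_Ici 2)
        (fun t _ => ((hasDerivAt_softCut t).sub (hasDerivAt_id t)).continuousAt.continuousWithinAt)
        (fun t _ =>
          ((hasDerivAt_softCut t).sub (hasDerivAt_id t)).differentiableAt.differentiableWithinAt)
        fun t ht => ?_
      rw [((hasDerivAt_softCut t).fun_sub (hasDerivAt_id' t)).deriv, smoothTransition.one_of_one_le]
      · simp
      · simp only [interior_Ici, Set.mem_Ioi] at ht
        nlinarith
    have := key (Set.self_mem_Ici) h h
    simp only at this
    linarith [softCut_nonneg (zero_le_two (α := ℝ))]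

/-- Smooth truncation of the modulus of a function: close to `‖b x‖`, vanishing for `‖b x‖ ≤ ε`. -/
def truncNorm {X F : Type*} [Norm F] (ε : ℝ) (b : X → F) (x : X) : ℝ :=
  ε * softCut (‖b x‖ / ε)

section truncNorm

variable {X F : Type*} [NormedAddCommGroup F] {ε : ℝ} {b : X → F}

theorem truncNorm_nonneg (hε : 0 < ε) (x : X) : 0 ≤ truncNorm ε b x :=
  mul_nonneg hε.le (softCut_nonneg (by positivity))

theorem truncNorm_le (hε : 0 < ε) (x : X) : truncNorm ε b x ≤ ‖b x‖ := by
  have := mul_le_mul_of_nonneg_left (softCut_le (t := ‖b x‖ / ε) (by positivity)) hε.le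
  rwa [mul_div_cancel₀ _ hε.ne'] at this

theorem le_truncNorm (hε : 0 < ε) (x : X) : ‖b x‖ - 2 * ε ≤ truncNorm ε b x := by
  have := mul_le_mul_of_nonneg_left (sub_two_le_softCut (‖b x‖ / ε)) hε.le
  rw [mul_sub, mul_div_cancel₀ _ hε.ne'] at this
  unfold truncNorm
  linarith

theorem truncNorm_eq_zero (hε : 0 < ε) {x : X} (hx : ‖b x‖ ≤ ε) : truncNorm ε b x = 0 := by
  unfold truncNorm
  rw [softCut_eq_zero (by positivity) ((div_le_one hε).2 hx), mul_zero]

theorem abs_truncNorm_sub_le (hε : 0 < ε) (x : X) : |truncNorm ε b x - ‖b x‖| ≤ 2 * ε := by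
  rw [abs_le]
  constructor
  · linarith [le_truncNorm (b := b) hε x]
  · linarith [truncNorm_le (b := b) hε x]

variable [TopologicalSpace X]

theorem truncNorm_eventuallyEq_zero (hε : 0 < ε) (hb : Continuous b) {x : X} (hx : b x = 0) :
    truncNorm ε b =ᶠ[nhds x] fun _ => 0 := by
  have : ∀ᶠ y in nhds x, ‖b y‖ < ε :=
    hb.norm.continuousAt.eventually_lt continuousAt_const (by simpa [hx] using hε)
  filter_upwards [this] with y hy using truncNorm_eq_zero hε hy.le

theorem hasCompactSupport_truncNorm [R1Space X] (hε : 0 < ε)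
    (hb0 : Filter.Tendsto b (Filter.cocompact X) (nhds 0)) :
    HasCompactSupport (truncNorm ε b) := by
  have h1 : ∀ᶠ x in Filter.cocompact X, ‖b x‖ < ε := by
    have := hb0.norm
    rw [norm_zero] at this
    exact this.eventually_lt_const hε
  rw [Filter.Eventually, Filter.mem_cocompact'] at h1
  obtain ⟨K, hK, hKs⟩ := h1
  refine HasCompactSupport.of_support_subset_isCompact hK fun x hx => hKs ?_
  intro h
  exact hx (truncNorm_eq_zero hε (le_of_lt h))

end truncNorm

section smooth

variable {X F : Type*} [NormedAddCommGroup X] [NormedSpace ℝ X] [NormedAddCommGroup F]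
  [InnerProductSpace ℝ F] {ε : ℝ} {b : X → F}

theorem contDiff_truncNorm (hε : 0 < ε) (hb : ContDiff ℝ ∞ b) : ContDiff ℝ ∞ (truncNorm ε b) := by
  rw [contDiff_iff_contDiffAt]
  intro x
  by_cases hx : b x = 0
  · exact contDiffAt_const.congr_of_eventuallyEq (truncNorm_eventuallyEq_zero hε hb.continuous hx)
  · unfold truncNorm
    exact contDiffAt_const.mul (contDiff_softCut.contDiffAt.comp x
      (((hb.contDiffAt).norm ℝ hx).div_const _))

theorem norm_fderiv_truncNorm_le (hε : 0 < ε) (hb : ContDiff ℝ ∞ b) (x : X) :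
    ‖fderiv ℝ (truncNorm ε b) x‖ ≤ ‖fderiv ℝ b x‖ := by
  by_cases hx : b x = 0
  · rw [(truncNorm_eventuallyEq_zero hε hb.continuous hx).fderiv_eq]
    simp
  · have hbd : DifferentiableAt ℝ b x := hb.contDiffAt.differentiableAt (by simp)
    have hn : DifferentiableAt ℝ (fun y : F => ‖y‖) (b x) :=
      (contDiffAt_norm ℝ hx (n := 1)).differentiableAt (by simp)
    have h1 := hn.hasFDerivAt.comp x hbd.hasFDerivAt
    have h2 := ((hasDerivAt_softCut (‖b x‖ / ε)).comp_hasFDerivAt x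
      (h1.mul_const ε⁻¹)).const_mul ε
    have h3 : HasFDerivAt (truncNorm ε b) _ x := h2
    rw [h3.fderiv, norm_smul, norm_smul, norm_smul, norm_inv, Real.norm_of_nonneg hε.le,
      Real.norm_of_nonneg (smoothTransition.nonneg _)]
    have h4 : ‖fderiv ℝ (fun y : F => ‖y‖) (b x)‖ ≤ 1 := by
      have := norm_fderiv_le_of_lipschitz ℝ (x₀ := b x) (lipschitzWith_one_norm (E := F))
      simpa using this
    have h5 : ‖(fderiv ℝ (fun y : F => ‖y‖) (b x)).comp (fderiv ℝ b x)‖ ≤ ‖fderiv ℝ b x‖ :=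
      (ContinuousLinearMap.opNorm_comp_le _ _).trans
        (mul_le_of_le_one_left (norm_nonneg _) h4)
    have h6 := smoothTransition.le_one ((‖b x‖ / ε) ^ 2 - 1)
    have h7 := smoothTransition.nonneg ((‖b x‖ / ε) ^ 2 - 1)
    calc _ = smoothTransition ((‖b x‖ / ε) ^ 2 - 1) *
        ‖(fderiv ℝ (fun y : F => ‖y‖) (b x)).comp (fderiv ℝ b x)‖ := by
          field_simp
      _ ≤ 1 * ‖fderiv ℝ b x‖ := by gcongr
      _ = _ := one_mul _

end smooth

/-- Bounded integrable densities, for which the Coulomb energy is absolutely convergent. -/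
structure CoulombAdmissible (p : E3 → ℝ) : Prop where
  integrable : Integrable p
  bounded : ∃ C, ∀ x, |p x| ≤ C

/-- The Coulomb energy form. -/
def coulomb (p q : E3 → ℝ) : ℝ := ∫ z : E3 × E3, p z.1 * q z.2 / ‖z.1 - z.2‖

namespace CoulombAdmissible

variable {p q : E3 → ℝ}

theorem of_abs_le (hq : CoulombAdmissible q) (hp : AEStronglyMeasurable p)
    (h : ∀ x, |p x| ≤ q x) : CoulombAdmissible p := by
  obtain ⟨C, hC⟩ := hq.bounded
  exact ⟨hq.integrable.mono' hp (Filter.Eventually.of_forall h),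
    C, fun x => (h x).trans ((le_abs_self _).trans (hC x))⟩

theorem add (hp : CoulombAdmissible p) (hq : CoulombAdmissible q) :
    CoulombAdmissible fun x => p x + q x := by
  obtain ⟨C, hC⟩ := hp.bounded
  obtain ⟨D, hD⟩ := hq.bounded
  exact ⟨hp.integrable.add hq.integrable, C + D, fun x => (abs_add_le _ _).trans
    (add_le_add (hC x) (hD x))⟩

theorem mul (hp : CoulombAdmissible p) (hq : CoulombAdmissible q) :
    CoulombAdmissible fun x => p x * q x := by
  obtain ⟨C, hC⟩ := hp.bounded
  obtain ⟨D, hD⟩ := hq.bounded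
  refine ⟨hp.integrable.mul_bdd (c := D) hq.integrable.aestronglyMeasurable
    (Filter.Eventually.of_forall hD), C * D, fun x => ?_⟩
  rw [abs_mul]
  exact mul_le_mul (hC x) (hD x) (abs_nonneg _) ((abs_nonneg _).trans (hC x))

theorem const_mul (hp : CoulombAdmissible p) (c : ℝ) : CoulombAdmissible fun x => c * p x := by
  obtain ⟨C, hC⟩ := hp.bounded
  refine ⟨hp.integrable.const_mul c, |c| * C, fun x => ?_⟩
  rw [abs_mul]
  exact mul_le_mul_of_nonneg_left (hC x) (abs_nonneg _)

theorem abs (hp : CoulombAdmissible p) : CoulombAdmissible fun x => |p x| := by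
  obtain ⟨C, hC⟩ := hp.bounded
  exact ⟨hp.integrable.abs, C, fun x => by rw [abs_abs]; exact hC x⟩

theorem comp (hp : CoulombAdmissible p) {R : E3 → E3} (hR : MeasurePreserving R) :
    CoulombAdmissible fun x => p (R x) := by
  obtain ⟨C, hC⟩ := hp.bounded
  exact ⟨hR.integrable_comp_of_integrable hp.integrable, C, fun x => hC _⟩

end CoulombAdmissible

theorem integrable_coulomb_core :
    Integrable fun x : E3 => (Metric.ball (0 : E3) 1).indicator (fun z => ‖z‖⁻¹) x := by
  rw [integrable_indicator_iff measurableSet_ball,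
    integrableOn_fun_norm_addHaar (E := E3) volume (f := fun r : ℝ => r⁻¹) (r := 1)]
  have h : IntegrableOn (fun y : ℝ => y) (Set.Ioo 0 1) :=
    (continuous_id.integrableOn_Icc (a := 0) (b := 1)).mono_set Set.Ioo_subset_Icc_self
  refine h.congr_fun (fun y hy => ?_) measurableSet_Ioo
  have : y ≠ 0 := hy.1.ne'
  simp only [finrank_euclideanSpace_fin, smul_eq_mul]
  field_simp

theorem CoulombAdmissible.integrable_kernel {p q : E3 → ℝ} (hp : CoulombAdmissible p)
    (hq : CoulombAdmissible q) :
    Integrable fun z : E3 × E3 => p z.1 * q z.2 / ‖z.1 - z.2‖ := by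
  obtain ⟨C, hC⟩ := hq.bounded
  have h1 := (hp.integrable.abs.convolution_integrand (ContinuousLinearMap.mul ℝ ℝ)
    integrable_coulomb_core).swap.const_mul C
  have h2 := hp.integrable.abs.mul_prod hq.integrable.abs
  refine (h1.add h2).mono' ?_ (Filter.Eventually.of_forall fun z => ?_)
  · have h3 := hp.integrable.aestronglyMeasurable.comp_fst (β := E3) (ν := volume)
    have h4 := hq.integrable.aestronglyMeasurable.comp_snd (α := E3) (μ := volume)
    have h5 : Measurable fun z : E3 × E3 => ‖z.1 - z.2‖ := by fun_prop
    exact ((h3.mul h4).aemeasurable.div h5.aemeasurable).aestronglyMeasurable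
  · have hC0 : 0 ≤ C := (abs_nonneg _).trans (hC 0)
    simp only [Pi.add_apply, Function.comp_apply, Prod.fst_swap, Prod.snd_swap,
      ContinuousLinearMap.mul_apply', norm_div, norm_mul, Real.norm_eq_abs, abs_norm]
    rw [norm_sub_rev]
    by_cases h : ‖z.2 - z.1‖ < 1
    · rw [Set.indicator_of_mem (by simpa using h), div_eq_mul_inv]
      have : |p z.1| * |q z.2| * ‖z.2 - z.1‖⁻¹ ≤ |p z.1| * C * ‖z.2 - z.1‖⁻¹ := by
        gcongr; exact hC _
      nlinarith [mul_nonneg (abs_nonneg (p z.1)) (abs_nonneg (q z.2))]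
    · rw [Set.indicator_of_notMem (by simpa using h)]
      simp only [mul_zero, zero_add]
      exact div_le_self (by positivity) (not_lt.1 h)

section coulomb

variable {p q r : E3 → ℝ}

theorem coulomb_eq_integral (hp : CoulombAdmissible p) (hq : CoulombAdmissible q) :
    coulomb p q = ∫ x, p x * ∫ y, q y / ‖x - y‖ := by
  unfold coulomb
  rw [Measure.volume_eq_prod, integral_prod _ (hp.integrable_kernel hq)]
  simp_rw [mul_div_assoc, integral_const_mul]

theorem coulomb_eq_iterated (hp : CoulombAdmissible p) (hq : CoulombAdmissible q) :
    coulomb p q = ∫ x, ∫ y, p x * q y / ‖x - y‖ := by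
  unfold coulomb
  rw [Measure.volume_eq_prod, integral_prod _ (hp.integrable_kernel hq)]

theorem coulomb_comm : coulomb p q = coulomb q p := by
  unfold coulomb
  rw [Measure.volume_eq_prod, ← integral_prod_swap]
  refine integral_congr_ae (Filter.Eventually.of_forall fun z => ?_)
  simp only [Prod.fst_swap, Prod.snd_swap]
  rw [norm_sub_rev, mul_comm]

theorem coulomb_add_left (hp : CoulombAdmissible p) (hq : CoulombAdmissible q)
    (hr : CoulombAdmissible r) :
    coulomb (fun x => p x + q x) r = coulomb p r + coulomb q r := by
  unfold coulomb
  rw [← integral_add (hp.integrable_kernel hr) (hq.integrable_kernel hr)]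
  refine integral_congr_ae (Filter.Eventually.of_forall fun z => ?_)
  simp only
  ring

theorem coulomb_add_right (hp : CoulombAdmissible p) (hq : CoulombAdmissible q)
    (hr : CoulombAdmissible r) :
    coulomb r (fun x => p x + q x) = coulomb r p + coulomb r q := by
  rw [coulomb_comm, coulomb_add_left hp hq hr, coulomb_comm, coulomb_comm (p := q)]

theorem coulomb_const_mul_left (c : ℝ) : coulomb (fun x => c * p x) r = c * coulomb p r := by
  unfold coulomb
  rw [← integral_const_mul]
  refine integral_congr_ae (Filter.Eventually.of_forall fun z => ?_)
  simp only
  ring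

theorem coulomb_const_mul_right (c : ℝ) : coulomb r (fun x => c * p x) = c * coulomb r p := by
  rw [coulomb_comm, coulomb_const_mul_left, coulomb_comm]

theorem coulomb_comp {R : E3 → E3} (hR : MeasurePreserving R) (hRe : MeasurableEmbedding R)
    (hiso : Isometry R) :
    coulomb (fun x => p (R x)) (fun x => q (R x)) = coulomb p q := by
  unfold coulomb
  have h := (hR.prod hR).integral_comp (hRe.prodMap hRe)
    (fun z : E3 × E3 => p z.1 * q z.2 / ‖z.1 - z.2‖)
  rw [Measure.volume_eq_prod, ← h]
  refine integral_congr_ae (Filter.Eventually.of_forall fun z => ?_)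
  simp only [Prod.map]
  rw [← dist_eq_norm, ← dist_eq_norm, hiso.dist_eq]

theorem tendsto_coulomb {P : ℕ → E3 → ℝ} {G : E3 → ℝ} (hG : CoulombAdmissible G)
    (hP : ∀ n, AEStronglyMeasurable (P n)) (hle : ∀ n x, |P n x| ≤ G x)
    (hlim : ∀ x, Filter.Tendsto (fun n => P n x) Filter.atTop (nhds (p x))) :
    Filter.Tendsto (fun n => coulomb (P n) (P n)) Filter.atTop (nhds (coulomb p p)) := by
  unfold coulomb
  refine tendsto_integral_of_dominated_convergence _
    (fun n => ((hG.of_abs_le (hP n) (hle n)).integrable_kernel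
      (hG.of_abs_le (hP n) (hle n))).aestronglyMeasurable) (hG.integrable_kernel hG)
    (fun n => Filter.Eventually.of_forall fun z => ?_)
    (Filter.Eventually.of_forall fun z => ((hlim _).mul (hlim _)).div_const _)
  rw [norm_div, norm_mul, norm_norm]
  gcongr
  · exact (abs_nonneg _).trans (hle n z.1)
  · exact hle n _
  · exact hle n _

end coulomb

/-- A normalized minimizer of the Pekar functional among Schwartz functions. -/
structure IsPekarMinimizer (ψ : SchwartzMap E3 ℂ) : Prop where
  norm_eq : (∫ x : E3, ‖ψ x‖ ^ 2) = 1
  le : ∀ φ : SchwartzMap E3 ℂ, (∫ x : E3, ‖φ x‖ ^ 2) = 1 → pekarF ψ ≤ pekarF φ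

theorem coulombAdmissible_norm (ψ : SchwartzMap E3 ℂ) : CoulombAdmissible fun x => ‖ψ x‖ := by
  obtain ⟨C, -, hC⟩ := ψ.decay 0 0
  refine ⟨ψ.integrable.norm, C, fun x => ?_⟩
  have := hC x
  simpa using this

theorem coulombAdmissible_norm_sq (ψ : SchwartzMap E3 ℂ) :
    CoulombAdmissible fun x => ‖ψ x‖ ^ 2 := by
  simpa only [sq] using (coulombAdmissible_norm ψ).mul (coulombAdmissible_norm ψ)

theorem coulombAdmissible_of_hasCompactSupport {u : E3 → ℝ} (hu : Continuous u)
    (hc : HasCompactSupport u) : CoulombAdmissible u := by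
  obtain ⟨C, hC⟩ := hu.bounded_above_of_compact_support hc
  exact ⟨hu.integrable_of_hasCompactSupport hc, C, hC⟩

theorem pekarF_eq_sub_coulomb (ψ : SchwartzMap E3 ℂ) :
    pekarF ψ = (∫ x : E3, ‖fderiv ℝ ψ x‖ ^ 2) -
      coulomb (fun x => ‖ψ x‖ ^ 2) (fun x => ‖ψ x‖ ^ 2) := by
  rw [coulomb_eq_iterated (coulombAdmissible_norm_sq ψ) (coulombAdmissible_norm_sq ψ)]
  rfl

namespace IsPekarMinimizer

variable {ψ : SchwartzMap E3 ℂ}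

theorem le_of_contDiff (hψ : IsPekarMinimizer ψ) {u : E3 → ℝ} (hu : ContDiff ℝ ∞ u)
    (hc : HasCompactSupport u) :
    pekarF ψ * (∫ x, u x ^ 2) ^ 2 ≤ (∫ x, u x ^ 2) * (∫ x, ‖fderiv ℝ u x‖ ^ 2) -
      coulomb (fun x => u x ^ 2) (fun x => u x ^ 2) := by
  set m := ∫ x, u x ^ 2 with hm
  have hm0 : 0 ≤ m := integral_nonneg fun x => sq_nonneg _
  rcases hm0.eq_or_lt with h0 | hpos
  · have h_int : Integrable fun x => u x ^ 2 := by
      have := coulombAdmissible_of_hasCompactSupport hu.continuous hc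
      simpa only [sq] using (this.mul this).integrable
    have hz : (fun x => u x ^ 2) = 0 := by
      have h1 := (integral_eq_zero_iff_of_nonneg (fun x => sq_nonneg (u x)) h_int).1
        (hm.symm.trans h0.symm)
      exact (Continuous.ae_eq_iff_eq _ (by have := hu.continuous; fun_prop)
        continuous_zero).1 h1
    have : coulomb (fun x => u x ^ 2) (fun x => u x ^ 2) = 0 := by
      rw [hz]; simp [coulomb]
    rw [this, ← h0]; simp
  · set c : ℝ := (√m)⁻¹ with hcdef
    have hc2 : c ^ 2 = m⁻¹ := by rw [hcdef, inv_pow, Real.sq_sqrt hm0]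
    let f : E3 → ℂ := fun x => Complex.ofRealLI.toContinuousLinearMap (c * u x)
    have hf : ContDiff ℝ ∞ f :=
      Complex.ofRealLI.toContinuousLinearMap.contDiff.comp (contDiff_const.mul hu)
    have hfc : HasCompactSupport f := by
      refine hc.mono' ?_
      intro x hx
      apply subset_tsupport
      intro h
      apply hx
      simp [f, h]
    let φ : SchwartzMap E3 ℂ := hfc.toSchwartzMap hf
    have hφ : ∀ x, φ x = f x := fun x => rfl
    have hn : ∀ x, ‖φ x‖ ^ 2 = m⁻¹ * u x ^ 2 := fun x => by
      rw [hφ, ← hc2, ← mul_pow]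
      simp [f, mul_pow]
    have hd : ∀ x, ‖fderiv ℝ φ x‖ ^ 2 = m⁻¹ * ‖fderiv ℝ u x‖ ^ 2 := fun x => by
      have h1 : HasFDerivAt u (fderiv ℝ u x) x :=
        (hu.differentiable (by simp)).differentiableAt.hasFDerivAt
      have h2 : HasFDerivAt φ _ x :=
        Complex.ofRealLI.toContinuousLinearMap.hasFDerivAt.comp x (h1.const_mul c)
      rw [h2.fderiv, LinearIsometry.norm_toContinuousLinearMap_comp, norm_smul, mul_pow, ← hc2]
      simp
    have h1 : (∫ x : E3, ‖φ x‖ ^ 2) = 1 := by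
      simp_rw [hn]
      rw [integral_const_mul, ← hm, inv_mul_cancel₀ hpos.ne']
    have h2 := hψ.le φ h1
    have h3 : pekarF φ = m⁻¹ * (∫ x, ‖fderiv ℝ u x‖ ^ 2) -
        m⁻¹ * (m⁻¹ * coulomb (fun x => u x ^ 2) (fun x => u x ^ 2)) := by
      rw [pekarF_eq_sub_coulomb]
      simp_rw [hn, hd]
      rw [integral_const_mul, coulomb_const_mul_left, coulomb_const_mul_right]
    rw [h3] at h2
    have h4 := mul_le_mul_of_nonneg_right h2 (sq_nonneg m)
    refine h4.trans (le_of_eq ?_)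
    field_simp

theorem le_of_tendsto (hψ : IsPekarMinimizer ψ) {u : ℕ → E3 → ℝ} {h G : E3 → ℝ}
    {τ : ℕ → ℝ} {t : ℝ} (hu : ∀ n, ContDiff ℝ ∞ (u n)) (hc : ∀ n, HasCompactSupport (u n))
    (hG : CoulombAdmissible G) (hle : ∀ n x, |u n x| ≤ G x)
    (hlim : ∀ x, Filter.Tendsto (fun n => u n x) Filter.atTop (nhds (h x)))
    (hT : ∀ n, (∫ x, ‖fderiv ℝ (u n) x‖ ^ 2) ≤ τ n)
    (hτ : Filter.Tendsto τ Filter.atTop (nhds t)) :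
    pekarF ψ * (∫ x, h x ^ 2) ^ 2 ≤ (∫ x, h x ^ 2) * t -
      coulomb (fun x => h x ^ 2) (fun x => h x ^ 2) := by
  have hm : ∀ n, AEStronglyMeasurable (fun x => u n x ^ 2) := fun n => by
    have := (hu n).continuous
    exact (by fun_prop : Continuous fun x => u n x ^ 2).aestronglyMeasurable
  have hb : ∀ n x, |u n x ^ 2| ≤ G x * G x := fun n x => by
    rw [abs_pow, ← sq]
    exact pow_le_pow_left₀ (abs_nonneg _) (hle n x) 2
  have hl2 : ∀ x, Filter.Tendsto (fun n => u n x ^ 2) Filter.atTop (nhds (h x ^ 2)) :=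
    fun x => (hlim x).pow 2
  have h1 : Filter.Tendsto (fun n => ∫ x, u n x ^ 2) Filter.atTop (nhds (∫ x, h x ^ 2)) :=
    tendsto_integral_of_dominated_convergence _ hm (hG.mul hG).integrable
      (fun n => Filter.Eventually.of_forall (hb n)) (Filter.Eventually.of_forall hl2)
  have h2 := tendsto_coulomb (hG.mul hG) hm hb hl2
  refine le_of_tendsto_of_tendsto' ((h1.pow 2).const_mul _) ((h1.mul hτ).sub h2) fun n => ?_
  refine (hψ.le_of_contDiff (hu n) (hc n)).trans ?_
  exact sub_le_sub_right (mul_le_mul_of_nonneg_left (hT n)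
    (integral_nonneg fun x => sq_nonneg (u n x))) _

end IsPekarMinimizer

theorem integrable_norm_fderiv_sq (ψ : SchwartzMap E3 ℂ) :
    Integrable fun x => ‖fderiv ℝ ψ x‖ ^ 2 := by
  have h1 : Integrable fun x => ‖fderiv ℝ ψ x‖ :=
    (SchwartzMap.fderivCLM ℝ E3 ℂ ψ).integrable.norm
  obtain ⟨C, -, hC⟩ := (SchwartzMap.fderivCLM ℝ E3 ℂ ψ).decay 0 0
  have := h1.mul_bdd (c := C) h1.aestronglyMeasurable
    (Filter.Eventually.of_forall fun x => by simpa using hC x)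
  simpa only [sq] using this

theorem integrable_norm_fderiv_sq_of_hasCompactSupport {u : E3 → ℝ} (hu : ContDiff ℝ ∞ u)
    (hc : HasCompactSupport u) : Integrable fun x => ‖fderiv ℝ u x‖ ^ 2 := by
  have h1 : Continuous (fderiv ℝ u) := hu.continuous_fderiv (by simp)
  refine Continuous.integrable_of_hasCompactSupport (by fun_prop) ?_
  exact (hc.fderiv ℝ).norm.comp_left (g := fun t : ℝ => t ^ 2) (by simp)

theorem integral_norm_fderiv_truncNorm_le (ψ : SchwartzMap E3 ℂ) {ε : ℝ} (hε : 0 < ε) :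
    (∫ x, ‖fderiv ℝ (truncNorm ε ψ) x‖ ^ 2) ≤ ∫ x, ‖fderiv ℝ ψ x‖ ^ 2 := by
  refine integral_mono_of_nonneg (Filter.Eventually.of_forall fun x => by positivity)
    (integrable_norm_fderiv_sq ψ) (Filter.Eventually.of_forall fun x => ?_)
  exact pow_le_pow_left₀ (norm_nonneg _)
    (norm_fderiv_truncNorm_le hε (ψ.smooth _) x) 2

theorem SchwartzMap.hasCompactSupport_truncNorm (ψ : SchwartzMap E3 ℂ) {ε : ℝ} (hε : 0 < ε) :
    HasCompactSupport (truncNorm ε ψ) :=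
  _root_.hasCompactSupport_truncNorm hε (zero_at_infty ψ)

theorem dual_parallelogram (p q : E3 →L[ℝ] ℝ) :
    ‖p + q‖ ^ 2 + ‖p - q‖ ^ 2 = 2 * (‖p‖ ^ 2 + ‖q‖ ^ 2) := by
  obtain ⟨P, rfl⟩ := (InnerProductSpace.toDual ℝ E3).surjective p
  obtain ⟨Q, rfl⟩ := (InnerProductSpace.toDual ℝ E3).surjective q
  rw [← map_add, ← map_sub]
  simp only [LinearIsometryEquiv.norm_map]
  have := parallelogram_law_with_norm ℝ P Q
  simpa only [sq] using this

theorem integral_norm_fderiv_comp_isometry {u : E3 → ℝ} (hu : ContDiff ℝ ∞ u)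
    (R : E3 ≃ₗᵢ[ℝ] E3) :
    (∫ x, ‖fderiv ℝ (fun y => u (R y)) x‖ ^ 2) = ∫ x, ‖fderiv ℝ u x‖ ^ 2 := by
  have h : ∀ x, ‖fderiv ℝ (fun y => u (R y)) x‖ = ‖fderiv ℝ u (R x)‖ := fun x => by
    have h1 : HasFDerivAt u (fderiv ℝ u (R x)) (R x) :=
      (hu.differentiable (by simp)).differentiableAt.hasFDerivAt
    have h2 : HasFDerivAt (fun y => u (R y)) _ x := h1.comp x R.toContinuousLinearEquiv.hasFDerivAt
    rw [h2.fderiv]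
    exact ContinuousLinearMap.opNorm_comp_linearIsometryEquiv _ R
  simp_rw [h]
  exact R.measurePreserving.integral_comp R.toMeasurableEquiv.measurableEmbedding
    (fun x => ‖fderiv ℝ u x‖ ^ 2)

/-- The gradient energy splits over even and odd parts with respect to an isometry. -/
theorem integral_norm_fderiv_add_of_odd {a c : E3 → ℝ} (ha : ContDiff ℝ ∞ a)
    (hc : ContDiff ℝ ∞ c) (hac : HasCompactSupport a) (hcc : HasCompactSupport c)
    {R : E3 ≃ₗᵢ[ℝ] E3} (haR : ∀ x, a (R x) = a x) (hcR : ∀ x, c (R x) = -c x) :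
    (∫ x, ‖fderiv ℝ (fun y => a y + c y) x‖ ^ 2) =
      (∫ x, ‖fderiv ℝ a x‖ ^ 2) + ∫ x, ‖fderiv ℝ c x‖ ^ 2 := by
  have hs := integral_norm_fderiv_comp_isometry (ha.add hc) R
  have had := ha.differentiable (by simp)
  have hcd := hc.differentiable (by simp)
  simp only [haR, hcR, ← sub_eq_add_neg] at hs
  have e1 : ∀ x, fderiv ℝ (fun y => a y + c y) x = fderiv ℝ a x + fderiv ℝ c x :=
    fun x => fderiv_add had.differentiableAt hcd.differentiableAt
  have e2 : ∀ x, fderiv ℝ (fun y => a y - c y) x = fderiv ℝ a x - fderiv ℝ c x :=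
    fun x => fderiv_sub had.differentiableAt hcd.differentiableAt
  have hi1 := integrable_norm_fderiv_sq_of_hasCompactSupport (ha.add hc) (hac.add hcc)
  have hi2 := integrable_norm_fderiv_sq_of_hasCompactSupport (ha.sub hc) (hac.sub hcc)
  have hia := integrable_norm_fderiv_sq_of_hasCompactSupport ha hac
  have hic := integrable_norm_fderiv_sq_of_hasCompactSupport hc hcc
  have h1 : (∫ x, ‖fderiv ℝ (fun y => a y + c y) x‖ ^ 2) +
      (∫ x, ‖fderiv ℝ (fun y => a y - c y) x‖ ^ 2) =
      2 * ((∫ x, ‖fderiv ℝ a x‖ ^ 2) + ∫ x, ‖fderiv ℝ c x‖ ^ 2) := by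
    rw [← integral_add hia hic, ← integral_const_mul, ← integral_add hi1 hi2]
    refine integral_congr_ae (Filter.Eventually.of_forall fun x => ?_)
    simp only [e1, e2, dual_parallelogram]
  have hs' : (∫ x, ‖fderiv ℝ (fun y => a y - c y) x‖ ^ 2) =
      ∫ x, ‖fderiv ℝ (fun y => a y + c y) x‖ ^ 2 := hs
  linarith

theorem integral_eq_zero_of_odd {g : E3 → ℝ} {R : E3 ≃ₗᵢ[ℝ] E3} (hg : ∀ x, g (R x) = -g x) :
    ∫ x, g x = 0 := by
  have := R.measurePreserving.integral_comp R.toMeasurableEquiv.measurableEmbedding g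
  have h2 : ∫ x, g (R x) = -∫ x, g x := by simp_rw [hg]; exact integral_neg _
  have h3 : ∫ x, g (R x) = ∫ x, g x := this
  linarith

theorem coulomb_comp_isometry {p q : E3 → ℝ} (R : E3 ≃ₗᵢ[ℝ] E3) :
    coulomb (fun x => p (R x)) (fun x => q (R x)) = coulomb p q :=
  coulomb_comp R.measurePreserving R.toMeasurableEquiv.measurableEmbedding R.isometry

theorem coulomb_eq_zero_of_even_odd {p q : E3 → ℝ} {R : E3 ≃ₗᵢ[ℝ] E3}
    (hp : ∀ x, p (R x) = p x) (hq : ∀ x, q (R x) = -q x) : coulomb p q = 0 := by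
  have h := coulomb_comp_isometry (p := p) (q := q) R
  simp_rw [hp, hq] at h
  have h2 : coulomb p (fun x => -q x) = -coulomb p q := by
    have := coulomb_const_mul_right (p := q) (r := p) (-1)
    simpa using this
  have h3 : coulomb (fun x => p x) (fun x => -q x) = coulomb p q := h
  linarith

/-- Reflection through the hyperplane orthogonal to `e`. -/
abbrev mirror (e : E3) : E3 ≃ₗᵢ[ℝ] E3 := (Submodule.span ℝ {e})ᗮ.reflection

section mirror

variable {e : E3}

theorem mirror_apply (he : ‖e‖ = 1) (x : E3) : mirror e x = x - (2 * inner ℝ e x) • e := by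
  rw [Submodule.reflection_orthogonal_apply, Submodule.reflection_singleton_apply, he]
  simp only [RCLike.ofReal_real_eq_id, id, one_pow, div_one, neg_sub, two_smul, two_mul, add_smul]

theorem mirror_mirror (x : E3) : mirror e (mirror e x) = x := Submodule.reflection_reflection _ _

theorem inner_mirror (he : ‖e‖ = 1) (x : E3) : inner ℝ e (mirror e x) = -inner ℝ e x := by
  rw [mirror_apply he, inner_sub_right, inner_smul_right, real_inner_self_eq_norm_sq, he]
  ring

theorem norm_sub_mirror_sq (he : ‖e‖ = 1) (x y : E3) :
    ‖x - mirror e y‖ ^ 2 = ‖x - y‖ ^ 2 + 4 * (inner ℝ e x * inner ℝ e y) := by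
  have : x - mirror e y = (x - y) + (2 * inner ℝ e y) • e := by rw [mirror_apply he]; abel
  rw [this, norm_add_sq_real, inner_smul_right, norm_smul, he, real_inner_comm e, inner_sub_right,
    mul_one, Real.norm_eq_abs, sq_abs]
  ring

theorem mirror_eq_self (he : ‖e‖ = 1) {x : E3} (hx : inner ℝ e x = 0) : mirror e x = x := by
  rw [mirror_apply he, hx]; simp

end mirror

section signed

variable {e : E3} {b : E3 → ℝ} {ε : ℝ}

/-- The sign of the coordinate in direction `e`. -/
def sideSign (e x : E3) : ℝ := Real.sign (inner ℝ e x)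

theorem sideSign_mirror (he : ‖e‖ = 1) (x : E3) : sideSign e (mirror e x) = -sideSign e x := by
  rw [sideSign, inner_mirror he, Real.sign_neg, sideSign]

theorem sideSign_of_pos {x : E3} (h : 0 < inner ℝ e x) : sideSign e x = 1 := Real.sign_of_pos h

theorem sideSign_of_neg {x : E3} (h : inner ℝ e x < 0) : sideSign e x = -1 := Real.sign_of_neg h

theorem sideSign_of_eq {x : E3} (h : inner ℝ e x = 0) : sideSign e x = 0 := by
  rw [sideSign, h, Real.sign_zero]

theorem abs_sideSign_le (x : E3) : |sideSign e x| ≤ 1 := by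
  rcases lt_trichotomy (inner ℝ e x) 0 with h | h | h
  · simp [sideSign_of_neg h]
  · simp [sideSign_of_eq h]
  · simp [sideSign_of_pos h]

theorem measurable_sideSign : Measurable (sideSign e) := by
  have : sideSign e =
      fun x => if 0 < inner ℝ e x then 1 else if inner ℝ e x < 0 then -1 else 0 := by
    funext x
    rcases lt_trichotomy (inner ℝ e x) 0 with h | h | h
    · simp [sideSign_of_neg h, h, h.not_gt]
    · simp [sideSign_of_eq h, h]
    · simp [sideSign_of_pos h, h]
  rw [this]
  refine Measurable.ite (measurableSet_lt measurable_const (by fun_prop)) measurable_const ?_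
  exact Measurable.ite (measurableSet_lt (by fun_prop) measurable_const) measurable_const
    measurable_const

/-- The smoothed odd extension `sign ⟪e, x⟫ * |b x|`. -/
def signedTrunc (e : E3) (ε : ℝ) (b : E3 → ℝ) (x : E3) : ℝ := sideSign e x * truncNorm ε b x

theorem signedTrunc_cases (he : ‖e‖ = 1) (hε : 0 < ε) (hb : ContDiff ℝ ∞ b)
    (hodd : ∀ x, b (mirror e x) = -b x) (x : E3) :
    ∃ c : ℝ, |c| ≤ 1 ∧ signedTrunc e ε b =ᶠ[nhds x] fun y => c * truncNorm ε b y := by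
  have hc : Continuous fun y : E3 => (inner ℝ e y : ℝ) := by fun_prop
  rcases lt_trichotomy (inner ℝ e x) 0 with h | h | h
  · refine ⟨-1, by simp, ?_⟩
    filter_upwards [(isOpen_lt hc continuous_const).mem_nhds h] with y hy
    rw [signedTrunc, sideSign_of_neg hy]
  · refine ⟨0, by simp, ?_⟩
    have hx : b x = 0 := by
      have := hodd x
      rw [mirror_eq_self he h] at this
      linarith
    filter_upwards [truncNorm_eventuallyEq_zero hε hb.continuous hx] with y hy
    rw [signedTrunc, hy]
    simp
  · refine ⟨1, by simp, ?_⟩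
    filter_upwards [(isOpen_lt continuous_const hc).mem_nhds h] with y hy
    rw [signedTrunc, sideSign_of_pos hy]

theorem contDiff_signedTrunc (he : ‖e‖ = 1) (hε : 0 < ε) (hb : ContDiff ℝ ∞ b)
    (hodd : ∀ x, b (mirror e x) = -b x) : ContDiff ℝ ∞ (signedTrunc e ε b) := by
  rw [contDiff_iff_contDiffAt]
  intro x
  obtain ⟨c, -, hc⟩ := signedTrunc_cases he hε hb hodd x
  exact (contDiffAt_const.mul (contDiff_truncNorm hε hb).contDiffAt).congr_of_eventuallyEq hc

theorem norm_fderiv_signedTrunc_le (he : ‖e‖ = 1) (hε : 0 < ε) (hb : ContDiff ℝ ∞ b)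
    (hodd : ∀ x, b (mirror e x) = -b x) (x : E3) :
    ‖fderiv ℝ (signedTrunc e ε b) x‖ ≤ ‖fderiv ℝ b x‖ := by
  obtain ⟨c, hc1, hc⟩ := signedTrunc_cases he hε hb hodd x
  rw [hc.fderiv_eq, fderiv_const_mul
    ((contDiff_truncNorm hε hb).differentiable (by simp)).differentiableAt, norm_smul]
  exact (mul_le_of_le_one_left (norm_nonneg _) hc1).trans (norm_fderiv_truncNorm_le hε hb x)

theorem hasCompactSupport_signedTrunc (hε : 0 < ε) (hbc : HasCompactSupport b) :
    HasCompactSupport (signedTrunc e ε b) := by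
  refine hbc.mono ?_
  intro x hx h
  apply hx
  rw [signedTrunc, truncNorm_eq_zero hε (by rw [h, norm_zero]; exact hε.le), mul_zero]

theorem signedTrunc_mirror (he : ‖e‖ = 1) (hodd : ∀ x, b (mirror e x) = -b x) (x : E3) :
    signedTrunc e ε b (mirror e x) = -signedTrunc e ε b x := by
  simp only [signedTrunc, truncNorm, sideSign_mirror he, hodd, norm_neg, neg_mul]

theorem abs_signedTrunc_le (hε : 0 < ε) (x : E3) : |signedTrunc e ε b x| ≤ |b x| := by
  rw [signedTrunc, abs_mul, abs_of_nonneg (truncNorm_nonneg hε x)]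
  exact (mul_le_of_le_one_left (truncNorm_nonneg hε x) (abs_sideSign_le x)).trans
    (truncNorm_le hε x)

end signed

/-- The odd part of `f` under the reflection `mirror e`. -/
def oddPart (e : E3) (f : E3 → ℝ) (x : E3) : ℝ := (f x - f (mirror e x)) / 2

/-- The even part of `f` under the reflection `mirror e`. -/
def evenPart (e : E3) (f : E3 → ℝ) (x : E3) : ℝ := (f x + f (mirror e x)) / 2

section parts

variable {e : E3} {f : E3 → ℝ}

theorem oddPart_mirror (x : E3) : oddPart e f (mirror e x) = -oddPart e f x := by
  simp only [oddPart, mirror_mirror]; ring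

theorem evenPart_mirror (x : E3) : evenPart e f (mirror e x) = evenPart e f x := by
  simp only [evenPart, mirror_mirror]; ring

theorem evenPart_add_oddPart (x : E3) : evenPart e f x + oddPart e f x = f x := by
  simp only [evenPart, oddPart]; ring

theorem contDiff_oddPart (hf : ContDiff ℝ ∞ f) : ContDiff ℝ ∞ (oddPart e f) :=
  (hf.sub (hf.comp (mirror e).contDiff)).div_const _

theorem contDiff_evenPart (hf : ContDiff ℝ ∞ f) : ContDiff ℝ ∞ (evenPart e f) :=
  (hf.add (hf.comp (mirror e).contDiff)).div_const _

theorem HasCompactSupport.comp_mirror (hf : HasCompactSupport f) :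
    HasCompactSupport fun x => f (mirror e x) :=
  hf.comp_homeomorph (mirror e).toHomeomorph

theorem hasCompactSupport_oddPart (hf : HasCompactSupport f) :
    HasCompactSupport (oddPart e f) :=
  (hf.sub hf.comp_mirror).comp_left (g := fun t : ℝ => t / 2) (by simp)

theorem hasCompactSupport_evenPart (hf : HasCompactSupport f) :
    HasCompactSupport (evenPart e f) :=
  (hf.add hf.comp_mirror).comp_left (g := fun t : ℝ => t / 2) (by simp)

end parts

namespace IsPekarMinimizer

variable {ψ : SchwartzMap E3 ℂ} {e : E3}

/-- Polarization of the modulus is an admissible competitor. -/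
theorem polarization_le (hψ : IsPekarMinimizer ψ) (he : ‖e‖ = 1) {f h : E3 → ℝ}
    (hf : ∀ x, f x = ‖ψ x‖)
    (hh : ∀ x, h x = evenPart e f x + sideSign e x * |oddPart e f x|) :
    pekarF ψ * (∫ x, h x ^ 2) ^ 2 ≤ (∫ x, h x ^ 2) * (∫ x, ‖fderiv ℝ ψ x‖ ^ 2) -
      coulomb (fun x => h x ^ 2) (fun x => h x ^ 2) := by
  let δ : ℕ → ℝ := fun n => 1 / ((n : ℝ) + 1)
  have hδ : ∀ n, 0 < δ n := fun n => by positivity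
  have hδ0 : Filter.Tendsto δ Filter.atTop (nhds 0) := tendsto_one_div_add_atTop_nhds_zero_nat
  let F : ℕ → E3 → ℝ := fun n => truncNorm (δ n) ψ
  have hFs : ∀ n, ContDiff ℝ ∞ (F n) := fun n => contDiff_truncNorm (hδ n) (ψ.smooth _)
  have hFc : ∀ n, HasCompactSupport (F n) := fun n => ψ.hasCompactSupport_truncNorm (hδ n)
  have hFnn : ∀ n x, 0 ≤ F n x := fun n x => truncNorm_nonneg (hδ n) x
  have hFle : ∀ n x, F n x ≤ f x := fun n x => by rw [hf]; exact truncNorm_le (hδ n) x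
  have hFlim : ∀ x, Filter.Tendsto (fun n => F n x) Filter.atTop (nhds (f x)) := fun x => by
    rw [hf, tendsto_iff_dist_tendsto_zero]
    refine squeeze_zero (fun n => dist_nonneg) (fun n => abs_truncNorm_sub_le (hδ n) x) ?_
    simpa using hδ0.const_mul 2
  let a : ℕ → E3 → ℝ := fun n => evenPart e (F n)
  let b : ℕ → E3 → ℝ := fun n => oddPart e (F n)
  let c : ℕ → E3 → ℝ := fun n => signedTrunc e (δ n) (b n)
  have ha : ∀ n, ContDiff ℝ ∞ (a n) := fun n => contDiff_evenPart (hFs n)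
  have hb : ∀ n, ContDiff ℝ ∞ (b n) := fun n => contDiff_oddPart (hFs n)
  have hbR : ∀ n x, b n (mirror e x) = -b n x := fun n x => oddPart_mirror x
  have hc : ∀ n, ContDiff ℝ ∞ (c n) := fun n => contDiff_signedTrunc he (hδ n) (hb n) (hbR n)
  have hac : ∀ n, HasCompactSupport (a n) := fun n => hasCompactSupport_evenPart (hFc n)
  have hbc : ∀ n, HasCompactSupport (b n) := fun n => hasCompactSupport_oddPart (hFc n)
  have hcc : ∀ n, HasCompactSupport (c n) := fun n => hasCompactSupport_signedTrunc (hδ n) (hbc n)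
  have haR : ∀ n x, a n (mirror e x) = a n x := fun n x => evenPart_mirror x
  have hcR : ∀ n x, c n (mirror e x) = -c n x := fun n x => signedTrunc_mirror he (hbR n) x
  have hfadm : CoulombAdmissible f := by
    rw [funext hf]; exact coulombAdmissible_norm ψ
  have hblim : ∀ x, Filter.Tendsto (fun n => b n x) Filter.atTop (nhds (oddPart e f x)) :=
    fun x => ((hFlim x).sub (hFlim _)).div_const 2
  refine hψ.le_of_tendsto (u := fun n x => a n x + c n x)
    (G := fun x => f x + f (mirror e x)) (τ := fun _ => ∫ x, ‖fderiv ℝ ψ x‖ ^ 2)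
    (fun n => (ha n).add (hc n)) (fun n => (hac n).add (hcc n))
    (hfadm.add (hfadm.comp (mirror e).measurePreserving)) (fun n x => ?_) (fun x => ?_)
    (fun n => ?_) tendsto_const_nhds
  · refine (abs_add_le _ _).trans ?_
    have h1 : |a n x| ≤ (f x + f (mirror e x)) / 2 := by
      simp only [a, evenPart]
      rw [abs_of_nonneg (by linarith [hFnn n x, hFnn n (mirror e x)])]
      linarith [hFle n x, hFle n (mirror e x)]
    have h2 : |c n x| ≤ (f x + f (mirror e x)) / 2 := by
      refine (abs_signedTrunc_le (hδ n) x).trans ?_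
      simp only [b, oddPart]
      rw [abs_le]
      constructor <;>
        linarith [hFnn n x, hFnn n (mirror e x), hFle n x, hFle n (mirror e x)]
    linarith
  · rw [hh]
    refine (((hFlim x).add (hFlim _)).div_const 2).add (Filter.Tendsto.const_mul _ ?_)
    have h1 : Filter.Tendsto (fun n => truncNorm (δ n) (b n) x - ‖b n x‖) Filter.atTop
        (nhds 0) := by
      refine squeeze_zero_norm (fun n => abs_truncNorm_sub_le (hδ n) x) ?_
      simpa using hδ0.const_mul 2
    have h2 := h1.add (hblim x).abs
    simpa using h2
  · have hF : F n = fun x => a n x + b n x := funext fun x => (evenPart_add_oddPart x).symm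
    rw [integral_norm_fderiv_add_of_odd (ha n) (hc n) (hac n) (hcc n) (haR n) (hcR n)]
    refine le_trans ?_ (integral_norm_fderiv_truncNorm_le ψ (hδ n))
    change _ ≤ ∫ x, ‖fderiv ℝ (F n) x‖ ^ 2
    rw [hF, integral_norm_fderiv_add_of_odd (ha n) (hb n) (hac n) (hbc n) (haR n) (hbR n)]
    refine add_le_add_right (integral_mono_of_nonneg
      (Filter.Eventually.of_forall fun x => by positivity)
      (integrable_norm_fderiv_sq_of_hasCompactSupport (hb n) (hbc n))
      (Filter.Eventually.of_forall fun x => ?_)) _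
    exact pow_le_pow_left₀ (norm_nonneg _)
      (norm_fderiv_signedTrunc_le he (hδ n) (hb n) (hbR n) x) 2

theorem coulomb_polarization_le (hψ : IsPekarMinimizer ψ) (he : ‖e‖ = 1) {o : E3 → ℝ}
    (ho : ∀ x, o x = oddPart e (fun y => ‖ψ y‖ ^ 2) x) :
    coulomb (fun x => sideSign e x * |o x|) (fun x => sideSign e x * |o x|) ≤ coulomb o o := by
  set f : E3 → ℝ := fun x => ‖ψ x‖ with hf
  set h : E3 → ℝ := fun x => evenPart e f x + sideSign e x * |oddPart e f x| with hh
  have key := hψ.polarization_le he (f := f) (h := h) (fun _ => rfl) (fun _ => rfl)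
  set p : E3 → ℝ := evenPart e (fun y => ‖ψ y‖ ^ 2) with hp
  set s : E3 → ℝ := fun x => sideSign e x * |o x| with hs
  have hoR : ∀ x, o (mirror e x) = -o x := fun x => by rw [ho, ho, oddPart_mirror]
  have hpR : ∀ x, p (mirror e x) = p x := fun x => evenPart_mirror x
  have hsR : ∀ x, s (mirror e x) = -s x := fun x => by
    simp only [hs, sideSign_mirror he, hoR, abs_neg, neg_mul]
  have hρ : ∀ x, ‖ψ x‖ ^ 2 = p x + o x := fun x => by
    rw [ho]
    exact (evenPart_add_oddPart (e := e) (f := fun y => ‖ψ y‖ ^ 2) x).symm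
  have hA : ∀ x, 0 ≤ evenPart e f x := fun x => by
    simp only [evenPart, hf]; positivity
  have hh2 : ∀ x, h x ^ 2 = p x + s x := fun x => by
    have h1 : |o x| = 2 * evenPart e f x * |oddPart e f x| := by
      rw [← abs_of_nonneg (hA x), ← abs_two, ← abs_mul, ← abs_mul, ho]
      congr 1
      simp only [oddPart]
      simp only [evenPart, hf]
      ring
    have h2 : (sideSign e x * |oddPart e f x|) ^ 2 = oddPart e f x ^ 2 := by
      rw [mul_pow, sq_abs]
      rcases lt_trichotomy (inner ℝ e x) 0 with h | h | h
      · simp [sideSign_of_neg h]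
      · simp [oddPart, mirror_eq_self he h]
      · simp [sideSign_of_pos h]
    have h3 : p x = evenPart e f x ^ 2 + oddPart e f x ^ 2 := by
      simp only [hp, evenPart, oddPart, hf]; ring
    simp only [hs, hh, h1]
    rw [add_sq, h2, h3]
    ring
  have hρadm := coulombAdmissible_norm_sq ψ
  have hρR := hρadm.comp (mirror e).measurePreserving
  have hoadm : CoulombAdmissible o := by
    have := (hρadm.add (hρR.const_mul (-1))).const_mul (1 / 2)
    convert this using 2 with x
    rw [ho, oddPart]; ring
  have hpadm : CoulombAdmissible p := by
    have := (hρadm.add hρR).const_mul (1 / 2)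
    convert this using 2 with x
    rw [hp, evenPart]; ring
  have hsadm : CoulombAdmissible s := by
    refine hoadm.abs.of_abs_le ?_ fun x => ?_
    · exact measurable_sideSign.aestronglyMeasurable.mul hoadm.abs.integrable.aestronglyMeasurable
    · rw [abs_mul, abs_abs]
      exact mul_le_of_le_one_left (abs_nonneg _) (abs_sideSign_le x)
  have hip : ∫ x, p x = 1 := by
    have := hψ.norm_eq
    simp_rw [hρ] at this
    rwa [integral_add hpadm.integrable hoadm.integrable, integral_eq_zero_of_odd hoR,
      add_zero] at this
  have hih : ∫ x, h x ^ 2 = 1 := by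
    simp_rw [hh2]
    rw [integral_add hpadm.integrable hsadm.integrable, integral_eq_zero_of_odd hsR, hip, add_zero]
  have expand : ∀ {q : E3 → ℝ}, CoulombAdmissible q → (∀ x, q (mirror e x) = -q x) →
      coulomb (fun x => p x + q x) (fun x => p x + q x) = coulomb p p + coulomb q q := by
    intro q hq hqR
    rw [coulomb_add_left hpadm hq (hpadm.add hq), coulomb_add_right hpadm hq hpadm,
      coulomb_add_right hpadm hq hq, coulomb_comm (p := q) (q := p),
      coulomb_eq_zero_of_even_odd hpR hqR]
    ring
  rw [hih, pekarF_eq_sub_coulomb] at key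
  simp_rw [hρ, hh2] at key
  rw [expand hsadm hsR, expand hoadm hoR] at key
  linarith

end IsPekarMinimizer

section reflection

variable {e : E3} {o : E3 → ℝ}

theorem abs_mul_sub_mul_polarization_nonneg (he : ‖e‖ = 1) (ho : ∀ x, o (mirror e x) = -o x)
    (x y : E3) :
    0 ≤ ((sideSign e x * |o x|) * (sideSign e y * |o y|) - o x * o y) *
      (1 / ‖x - y‖ - 1 / ‖x - mirror e y‖) := by
  have hn := norm_sub_mirror_sq he x y
  rcases lt_trichotomy (inner ℝ e x * inner ℝ e y) 0 with h | h | h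
  · have hs : sideSign e x * sideSign e y = -1 := by
      rcases mul_neg_iff.1 h with ⟨h1, h2⟩ | ⟨h1, h2⟩
      · rw [sideSign_of_pos h1, sideSign_of_neg h2]; norm_num
      · rw [sideSign_of_neg h1, sideSign_of_pos h2]; norm_num
    have hD : (sideSign e x * |o x|) * (sideSign e y * |o y|) - o x * o y =
        -(|o x * o y| + o x * o y) := by
      rw [mul_mul_mul_comm, hs, abs_mul]; ring
    rw [hD]
    have h1 : 0 ≤ |o x * o y| + o x * o y := by linarith [neg_abs_le (o x * o y)]
    rcases (norm_nonneg (x - mirror e y)).eq_or_lt with h0 | h0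
    · have hx : x = mirror e y := sub_eq_zero.1 (norm_eq_zero.1 h0.symm)
      have : |o x * o y| + o x * o y = 0 := by
        rw [hx, ho, abs_of_nonpos (by nlinarith [sq_nonneg (o y)])]; ring
      rw [this]; simp
    · have : ‖x - mirror e y‖ ≤ ‖x - y‖ :=
        le_of_sq_le_sq (by linarith) (norm_nonneg _)
      have := one_div_le_one_div_of_le h0 this
      exact mul_nonneg_of_nonpos_of_nonpos (by linarith) (by linarith)
  · have : ‖x - mirror e y‖ = ‖x - y‖ := by
      rw [h] at hn
      exact (sq_eq_sq₀ (norm_nonneg _) (norm_nonneg _)).1 (by linarith)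
    rw [this]; simp
  · have hs : sideSign e x * sideSign e y = 1 := by
      rcases mul_pos_iff.1 h with ⟨h1, h2⟩ | ⟨h1, h2⟩
      · rw [sideSign_of_pos h1, sideSign_of_pos h2]; norm_num
      · rw [sideSign_of_neg h1, sideSign_of_neg h2]; norm_num
    have hD : (sideSign e x * |o x|) * (sideSign e y * |o y|) - o x * o y =
        |o x * o y| - o x * o y := by
      rw [mul_mul_mul_comm, hs, abs_mul]; ring
    rw [hD]
    have h1 : 0 ≤ |o x * o y| - o x * o y := by linarith [le_abs_self (o x * o y)]
    rcases (norm_nonneg (x - y)).eq_or_lt with h0 | h0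
    · have hx : x = y := sub_eq_zero.1 (norm_eq_zero.1 h0.symm)
      rw [hx, abs_mul_self]; simp
    · have : ‖x - y‖ ≤ ‖x - mirror e y‖ :=
        le_of_sq_le_sq (by linarith) (norm_nonneg _)
      have := one_div_le_one_div_of_le h0 this
      exact mul_nonneg h1 (by linarith)

/-- If polarizing an odd charge does not raise its Coulomb energy, the charge has a constant sign on
each side of the mirror. -/
theorem mul_nonneg_of_coulomb_polarization_le (he : ‖e‖ = 1) (ho : ∀ x, o (mirror e x) = -o x)
    (hoc : Continuous o) (hoa : CoulombAdmissible o)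
    (h : coulomb (fun x => sideSign e x * |o x|) (fun x => sideSign e x * |o x|) ≤ coulomb o o)
    {x y : E3} (hx : 0 < inner ℝ e x) (hy : 0 < inner ℝ e y) : 0 ≤ o x * o y := by
  set s : E3 → ℝ := fun x => sideSign e x * |o x| with hs
  have hsR : ∀ x, s (mirror e x) = -s x := fun x => by
    simp only [hs, sideSign_mirror he, ho, abs_neg, neg_mul]
  have hsa : CoulombAdmissible s := by
    refine hoa.abs.of_abs_le
      (measurable_sideSign.mul hoc.abs.measurable).aestronglyMeasurable fun x => ?_
    simp only [hs, abs_mul, abs_abs]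
    exact mul_le_of_le_one_left (abs_nonneg _) (abs_sideSign_le x)
  set K : E3 × E3 → ℝ := fun z => s z.1 * s z.2 / ‖z.1 - z.2‖ - o z.1 * o z.2 / ‖z.1 - z.2‖ with hK
  have hKi : Integrable K := (hsa.integrable_kernel hsa).sub (hoa.integrable_kernel hoa)
  have hKle : ∫ z, K z ≤ 0 := by
    rw [hK, integral_sub (hsa.integrable_kernel hsa) (hoa.integrable_kernel hoa)]
    exact sub_nonpos.2 h
  have hmp : MeasurePreserving (Prod.map (id : E3 → E3) (mirror e)) :=
    (MeasurePreserving.id volume).prod (mirror e).measurePreserving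
  have hme : MeasurableEmbedding (Prod.map (id : E3 → E3) (mirror e)) :=
    MeasurableEmbedding.id.prodMap (mirror e).toMeasurableEquiv.measurableEmbedding
  have hK2 := hmp.integral_comp hme K
  have hK2i : Integrable fun z => K (Prod.map id (mirror e) z) :=
    hmp.integrable_comp_of_integrable hKi
  set N : E3 × E3 → ℝ := fun z => (s z.1 * s z.2 - o z.1 * o z.2) *
    (1 / ‖z.1 - z.2‖ - 1 / ‖z.1 - mirror e z.2‖) with hN
  have hNK : N = fun z => K z + K (Prod.map id (mirror e) z) := by
    funext z
    simp only [hN, hK, Prod.map_fst, Prod.map_snd, id, hsR, ho]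
    ring
  have hN0 : 0 ≤ N := fun z => abs_mul_sub_mul_polarization_nonneg he ho z.1 z.2
  have hNi : Integrable N := by rw [hNK]; exact hKi.add hK2i
  have hNz : ∫ z, N z = 0 := by
    refine le_antisymm ?_ (integral_nonneg hN0)
    rw [hNK, integral_add hKi hK2i]
    linarith
  have hae := (integral_eq_zero_iff_of_nonneg hN0 hNi).1 hNz
  set U : Set (E3 × E3) := {z | 0 < inner ℝ e z.1 ∧ 0 < inner ℝ e z.2 ∧ o z.1 * o z.2 < 0} with hU
  have hUo : IsOpen U := by
    refine IsOpen.and ?_ (IsOpen.and ?_ ?_)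
    · exact isOpen_lt continuous_const (by fun_prop)
    · exact isOpen_lt continuous_const (by fun_prop)
    · exact isOpen_lt (by fun_prop) continuous_const
  have hU0 : volume U = 0 := by
    refine measure_mono_null ?_ hae
    rintro z ⟨h1, h2, h3⟩ h4
    have hne : z.1 ≠ z.2 := fun h => by
      rw [h] at h3; nlinarith [mul_self_nonneg (o z.2)]
    have hn := norm_sub_mirror_sq he z.1 z.2
    have hlt : ‖z.1 - z.2‖ < ‖z.1 - mirror e z.2‖ :=
      lt_of_pow_lt_pow_left₀ 2 (norm_nonneg _) (by nlinarith [mul_pos h1 h2])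
    have hk := one_div_lt_one_div_of_lt (norm_pos_iff.2 (sub_ne_zero.2 hne)) hlt
    have hd : 0 < s z.1 * s z.2 - o z.1 * o z.2 := by
      simp only [hs, sideSign_of_pos h1, sideSign_of_pos h2, one_mul]
      nlinarith [mul_nonneg (abs_nonneg (o z.1)) (abs_nonneg (o z.2))]
    have := mul_pos hd (sub_pos.2 hk)
    exact this.ne' h4
  have hUe := hUo.measure_eq_zero_iff volume |>.1 hU0
  by_contra! hlt
  exact (Set.eq_empty_iff_forall_notMem.1 hUe (x, y)) ⟨hx, hy, hlt⟩

theorem contDiff_norm_sq_schwartz (ψ : SchwartzMap E3 ℂ) : ContDiff ℝ ∞ fun x => ‖ψ x‖ ^ 2 :=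
  (ψ.smooth _).norm_sq ℝ

/-- A mirror which halves the mass of a minimizer leaves its modulus invariant. -/
theorem IsPekarMinimizer.norm_mirror {ψ : SchwartzMap E3 ℂ} (hψ : IsPekarMinimizer ψ)
    (he : ‖e‖ = 1) (hbal : ∫ x, sideSign e x * ‖ψ x‖ ^ 2 = 0) (x : E3) :
    ‖ψ (mirror e x)‖ = ‖ψ x‖ := by
  set ρ : E3 → ℝ := fun y => ‖ψ y‖ ^ 2 with hρ
  have hρa : CoulombAdmissible ρ := coulombAdmissible_norm_sq ψ
  have hρc : Continuous ρ := (contDiff_norm_sq_schwartz ψ).continuous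
  have hρRi : Integrable fun x => ρ (mirror e x) :=
    (mirror e).measurePreserving.integrable_comp_of_integrable hρa.integrable
  have hoc : Continuous (oddPart e ρ) :=
    (contDiff_oddPart (contDiff_norm_sq_schwartz ψ)).continuous
  have hoa : CoulombAdmissible (oddPart e ρ) := by
    have := (hρa.add ((hρa.comp (mirror e).measurePreserving).const_mul (-1))).const_mul (1 / 2)
    convert this using 2
    rw [oddPart]; ring
  have hsign : ∀ {x y : E3}, 0 < inner ℝ e x → 0 < inner ℝ e y →
      0 ≤ oddPart e ρ x * oddPart e ρ y := fun hx hy =>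
    mul_nonneg_of_coulomb_polarization_le he oddPart_mirror hoc hoa
      (hψ.coulomb_polarization_le he fun _ => rfl) hx hy
  have hsi : ∀ {f : E3 → ℝ}, Integrable f → Integrable fun x => sideSign e x * f x := fun hf =>
    hf.bdd_mul (c := 1) measurable_sideSign.aestronglyMeasurable
      (Filter.Eventually.of_forall abs_sideSign_le)
  have hzero : ∫ x, sideSign e x * oddPart e ρ x = 0 := by
    have h1 : ∫ x, sideSign e x * evenPart e ρ x = 0 :=
      integral_eq_zero_of_odd (R := mirror e) fun x => by
        rw [sideSign_mirror he, evenPart_mirror, neg_mul]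
    have h2 : ∀ x, sideSign e x * oddPart e ρ x =
        sideSign e x * ρ x - sideSign e x * evenPart e ρ x := fun x => by
      rw [← evenPart_add_oddPart (e := e) (f := ρ) x]; ring
    have h3 : Integrable (evenPart e ρ) := (hρa.integrable.add hρRi).div_const 2
    simp_rw [h2]
    rw [integral_sub (hsi hρa.integrable) (hsi h3), hbal, h1, sub_zero]
  have hcont : Continuous fun x => sideSign e x * oddPart e ρ x := by
    rw [continuous_iff_continuousAt]
    intro x
    have hc : Continuous fun y : E3 => (inner ℝ e y : ℝ) := by fun_prop
    rcases lt_trichotomy (inner ℝ e x) 0 with h | h | h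
    · refine (hoc.neg.continuousAt (x := x)).congr ?_
      filter_upwards [(isOpen_lt hc continuous_const).mem_nhds h] with y hy
      rw [sideSign_of_neg hy, Pi.neg_apply]; ring
    · have h0 : oddPart e ρ x = 0 := by simp [oddPart, mirror_eq_self he h]
      have h1 : Filter.Tendsto (fun y => |oddPart e ρ y|) (nhds x) (nhds 0) := by
        have := (hoc.abs.tendsto x)
        rwa [h0, abs_zero] at this
      rw [ContinuousAt, h0, mul_zero]
      refine squeeze_zero_norm (fun y => ?_) h1
      rw [norm_mul]
      exact mul_le_of_le_one_left (abs_nonneg _) (abs_sideSign_le y)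
    · refine (hoc.continuousAt (x := x)).congr ?_
      filter_upwards [(isOpen_lt continuous_const hc).mem_nhds h] with y hy
      rw [sideSign_of_pos hy]; ring
  have hall : ∀ x, sideSign e x * oddPart e ρ x = 0 := by
    have hprod : ∀ x y, 0 ≤ (sideSign e x * oddPart e ρ x) * (sideSign e y * oddPart e ρ y) := by
      have hneg : ∀ x, inner ℝ e x < 0 → ∃ x', 0 < inner ℝ e x' ∧
          sideSign e x * oddPart e ρ x = oddPart e ρ x' := fun x hx =>
        ⟨mirror e x, by rw [inner_mirror he]; linarith, by
          rw [sideSign_of_neg hx, oddPart_mirror]; ring⟩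
      have hgen : ∀ x, sideSign e x * oddPart e ρ x = 0 ∨ ∃ x', 0 < inner ℝ e x' ∧
          sideSign e x * oddPart e ρ x = oddPart e ρ x' := fun x => by
        rcases lt_trichotomy (inner ℝ e x) 0 with h | h | h
        · exact Or.inr (hneg x h)
        · left; rw [sideSign_of_eq h, zero_mul]
        · exact Or.inr ⟨x, h, by rw [sideSign_of_pos h, one_mul]⟩
      intro x y
      rcases hgen x with hx | ⟨x', hx', hx⟩
      · rw [hx, zero_mul]
      rcases hgen y with hy | ⟨y', hy', hy⟩
      · rw [hy, mul_zero]
      rw [hx, hy]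
      exact hsign hx' hy'
    have hoi : Integrable fun x => sideSign e x * oddPart e ρ x := hsi hoa.integrable
    by_contra! hx
    obtain ⟨x0, hx0⟩ := hx
    set c := sideSign e x0 * oddPart e ρ x0 with hc
    have h1 : ∫ x, c * (sideSign e x * oddPart e ρ x) = 0 := by
      rw [integral_const_mul, hzero, mul_zero]
    have h2 : 0 < ∫ x, c * (sideSign e x * oddPart e ρ x) :=
      integral_pos_of_integrable_nonneg_nonzero (hcont.const_mul c |>.congr fun _ => rfl)
        (hoi.const_mul c) (fun x => hprod x0 x) (x := x0) (by positivity)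
    linarith
  have hodd : oddPart e ρ x = 0 := by
    rcases lt_trichotomy (inner ℝ e x) 0 with h | h | h
    · have := hall x
      rw [sideSign_of_neg h] at this
      linarith
    · simp [oddPart, mirror_eq_self he h]
    · have := hall x
      rw [sideSign_of_pos h] at this
      linarith
  have : ‖ψ (mirror e x)‖ ^ 2 = ‖ψ x‖ ^ 2 := by
    simp only [oddPart, hρ] at hodd
    linarith
  exact (sq_eq_sq₀ (norm_nonneg _) (norm_nonneg _)).1 this

end reflection

theorem IsPekarMinimizer.comp_sub {ψ : SchwartzMap E3 ℂ} (hψ : IsPekarMinimizer ψ) (a : E3) :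
    IsPekarMinimizer (ψ.compSubConstCLM ℂ a) := by
  have hF : pekarF (ψ.compSubConstCLM ℂ a) = pekarF ψ := by
    unfold pekarF
    congr 1
    · have h : ∀ x, ‖fderiv ℝ (ψ.compSubConstCLM ℂ a) x‖ ^ 2 = ‖fderiv ℝ ψ (x - a)‖ ^ 2 :=
        fun x => by
          rw [← fderiv_comp_sub]; rfl
      simp_rw [h]
      exact integral_sub_right_eq_self (fun x => ‖fderiv ℝ ψ x‖ ^ 2) a
    · have h : ∀ x, (∫ y, ‖(ψ.compSubConstCLM ℂ a) x‖ ^ 2 * ‖(ψ.compSubConstCLM ℂ a) y‖ ^ 2 /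
          ‖x - y‖) = ∫ y, ‖ψ (x - a)‖ ^ 2 * ‖ψ y‖ ^ 2 / ‖(x - a) - y‖ := fun x => by
        rw [← integral_sub_right_eq_self
          (fun y => ‖ψ (x - a)‖ ^ 2 * ‖ψ y‖ ^ 2 / ‖(x - a) - y‖) a]
        simp only [SchwartzMap.compSubConstCLM_apply, sub_sub_sub_cancel_right]
      simp_rw [h]
      exact integral_sub_right_eq_self (fun x => ∫ y, ‖ψ x‖ ^ 2 * ‖ψ y‖ ^ 2 / ‖x - y‖) a
  refine ⟨?_, fun φ hφ => by rw [hF]; exact hψ.le φ hφ⟩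
  rw [← hψ.norm_eq]
  exact integral_sub_right_eq_self (fun x => ‖ψ x‖ ^ 2) a

theorem volume_hyperplane {e : E3} (he : ‖e‖ = 1) (t : ℝ) :
    volume {x : E3 | inner ℝ e x = t} = 0 := by
  have h1 : {x : E3 | inner ℝ e x = t} =
      (fun x => x - t • e) ⁻¹' ((Submodule.span ℝ {e})ᗮ : Submodule ℝ E3) := by
    ext x
    simp only [Set.mem_ofPred_eq, Set.mem_preimage, SetLike.mem_coe,
      Submodule.mem_orthogonal_singleton_iff_inner_right, inner_sub_right, inner_smul_right,
      real_inner_self_eq_norm_sq, he]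
    constructor <;> intro h <;> linarith
  rw [h1]
  simp_rw [sub_eq_add_neg]
  rw [measure_preimage_add_right]
  refine Measure.addHaar_submodule _ _ fun h => ?_
  have : e ∈ (Submodule.span ℝ {e})ᗮ := by rw [h]; trivial
  rw [Submodule.mem_orthogonal_singleton_iff_inner_right, real_inner_self_eq_norm_sq, he] at this
  norm_num at this

/-- Some hyperplane orthogonal to `e` halves the mass of `ρ`. -/
theorem exists_halving {e : E3} (he : ‖e‖ = 1) {ρ : E3 → ℝ} (hρ : Integrable ρ)
    (h0 : ∀ x, 0 ≤ ρ x) : ∃ t : ℝ, ∫ x, Real.sign (inner ℝ e x - t) * ρ x = 0 := by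
  set m : ℝ → ℝ := fun t => ∫ x, Real.sign (inner ℝ e x - t) * ρ x with hm
  have hsgn : Measurable Real.sign := by
    unfold Real.sign
    exact Measurable.ite measurableSet_Iio measurable_const
      (Measurable.ite measurableSet_Ioi measurable_const measurable_const)
  have hmeas : ∀ t, AEStronglyMeasurable fun x => Real.sign (inner ℝ e x - t) * ρ x := fun t =>
    (hsgn.comp
      (by fun_prop : Measurable fun x : E3 => (inner ℝ e x : ℝ) - t)).aestronglyMeasurable.mul
      hρ.aestronglyMeasurable
  have hbd : ∀ t x, ‖Real.sign (inner ℝ e x - t) * ρ x‖ ≤ ρ x := fun t x => by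
    rw [norm_mul, Real.norm_eq_abs, Real.norm_eq_abs, abs_of_nonneg (h0 x)]
    refine mul_le_of_le_one_left (h0 x) ?_
    rcases Real.sign_apply_eq (inner ℝ e x - t) with h | h | h <;> simp [h]
  have hcont : Continuous m := by
    rw [continuous_iff_continuousAt]
    intro t
    refine continuousAt_of_dominated (bound := ρ) (Filter.Eventually.of_forall hmeas)
      (Filter.Eventually.of_forall fun s => Filter.Eventually.of_forall (hbd s)) hρ ?_
    have : ∀ᵐ x : E3, (inner ℝ e x : ℝ) ≠ t := by
      rw [ae_iff]; simpa using volume_hyperplane he t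
    filter_upwards [this] with x hx
    have hc : ContinuousAt (fun s : ℝ => (inner ℝ e x : ℝ) - s) t := by fun_prop
    refine ContinuousAt.mul ?_ continuousAt_const
    rcases lt_or_gt_of_ne hx with h | h
    · refine (continuousAt_const (y := (-1 : ℝ))).congr ?_
      filter_upwards [hc.eventually_lt continuousAt_const (sub_neg.2 h)] with s hs
      rw [Real.sign_of_neg hs]
    · refine (continuousAt_const (y := (1 : ℝ))).congr ?_
      filter_upwards [(continuousAt_const).eventually_lt hc (sub_pos.2 h)] with s hs
      rw [Real.sign_of_pos hs]
  have htop : Filter.Tendsto m Filter.atTop (nhds (∫ x, -1 * ρ x)) := by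
    refine tendsto_integral_filter_of_dominated_convergence ρ (Filter.Eventually.of_forall hmeas)
      (Filter.Eventually.of_forall fun s => Filter.Eventually.of_forall (hbd s)) hρ
      (Filter.Eventually.of_forall fun x => ?_)
    refine tendsto_const_nhds.congr' ?_
    filter_upwards [Filter.eventually_gt_atTop (inner ℝ e x : ℝ)] with s hs
    rw [Real.sign_of_neg (sub_neg.2 hs)]
  have hbot : Filter.Tendsto m Filter.atBot (nhds (∫ x, 1 * ρ x)) := by
    refine tendsto_integral_filter_of_dominated_convergence ρ (Filter.Eventually.of_forall hmeas)
      (Filter.Eventually.of_forall fun s => Filter.Eventually.of_forall (hbd s)) hρ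
      (Filter.Eventually.of_forall fun x => ?_)
    refine tendsto_const_nhds.congr' ?_
    filter_upwards [Filter.eventually_lt_atBot (inner ℝ e x : ℝ)] with s hs
    rw [Real.sign_of_pos (sub_pos.2 hs)]
  rw [integral_const_mul] at htop hbot
  rcases (integral_nonneg h0 : 0 ≤ ∫ x, ρ x).eq_or_lt with h | h
  · have hz := (integral_eq_zero_iff_of_nonneg h0 hρ).1 h.symm
    refine ⟨0, integral_eq_zero_of_ae ?_⟩
    filter_upwards [hz] with x hx
    simp only [hx, Pi.zero_apply, mul_zero]
  · obtain ⟨a, ha⟩ := (htop.eventually (gt_mem_nhds (show -1 * ∫ x, ρ x < 0 by linarith))).exists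
    obtain ⟨b, hb⟩ := (hbot.eventually (lt_mem_nhds (show 0 < 1 * ∫ x, ρ x by linarith))).exists
    exact mem_range_of_exists_le_of_exists_ge hcont ⟨a, ha.le⟩ ⟨b, hb.le⟩

theorem mirror_eq_of_norm_eq {x y : E3} (h : ‖x‖ = ‖y‖) (hne : x ≠ y) :
    ∃ e : E3, ‖e‖ = 1 ∧ mirror e x = y := by
  have hn : ‖x - y‖ ≠ 0 := norm_ne_zero_iff.2 (sub_ne_zero.2 hne)
  refine ⟨‖x - y‖⁻¹ • (x - y), by rw [norm_smul, norm_inv, norm_norm, inv_mul_cancel₀ hn], ?_⟩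
  have h2 : ∀ S : Submodule ℝ E3, S = Submodule.span ℝ {x - y} → Sᗮ.reflection x = y := by
    rintro _ rfl
    exact Submodule.reflection_sub h
  exact h2 _ (Submodule.span_singleton_smul_eq (IsUnit.mk0 _ (inv_ne_zero hn)) _)

theorem mirror_single (i : Fin 3) (x : E3) :
    mirror (EuclideanSpace.single i (1 : ℝ)) x = x - EuclideanSpace.single i (2 * x i) := by
  rw [mirror_apply (by simp)]
  congr 1
  ext j
  simp [EuclideanSpace.inner_single_left]

/-- Up to a translation, the modulus of a minimizer is radial. -/
theorem IsPekarMinimizer.exists_radial {ψ : SchwartzMap E3 ℂ} (hψ : IsPekarMinimizer ψ) :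
    ∃ a : E3, ∀ x y : E3, ‖x‖ = ‖y‖ →
      ‖ψ.compSubConstCLM ℂ a x‖ = ‖ψ.compSubConstCLM ℂ a y‖ := by
  have hρ := (coulombAdmissible_norm_sq ψ).integrable
  have hex := fun i : Fin 3 => exists_halving (e := EuclideanSpace.single i (1 : ℝ)) (by simp) hρ
    fun x => by positivity
  choose t ht using hex
  set c : E3 := WithLp.toLp 2 t with hc
  refine ⟨-c, ?_⟩
  have hφ := hψ.comp_sub (-c)
  set φ := ψ.compSubConstCLM ℂ (-c) with hφdef
  have hφx : ∀ x, φ x = ψ (x + c) := fun x => by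
    rw [hφdef, SchwartzMap.compSubConstCLM_apply, sub_neg_eq_add]
  have hcoord : ∀ (i : Fin 3) (x : E3),
      ‖φ (mirror (EuclideanSpace.single i (1 : ℝ)) x)‖ = ‖φ x‖ := by
    intro i
    refine hφ.norm_mirror (by simp) ?_
    rw [← ht i, ← integral_add_right_eq_self
      (fun x => Real.sign (inner ℝ (EuclideanSpace.single i (1 : ℝ)) x - t i) * ‖ψ x‖ ^ 2) c]
    refine integral_congr_ae (Filter.Eventually.of_forall fun x => ?_)
    simp [hφx, sideSign, hc, EuclideanSpace.inner_single_left]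
  have heven : ∀ x, ‖φ (-x)‖ = ‖φ x‖ := fun x => by
    rw [← hcoord 0 x, ← hcoord 1, ← hcoord 2]
    congr 2
    simp only [mirror_single]
    ext j
    fin_cases j <;> simp <;> ring
  have hall : ∀ e : E3, ‖e‖ = 1 → ∀ x, ‖φ (mirror e x)‖ = ‖φ x‖ := fun e he => by
    refine hφ.norm_mirror he ?_
    refine integral_eq_zero_of_odd (R := LinearIsometryEquiv.neg ℝ) fun x => ?_
    simp only [LinearIsometryEquiv.coe_neg, heven, sideSign, inner_neg_right, Real.sign_neg,
      neg_mul]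
  intro x y hxy
  by_cases hne : x = y
  · rw [hne]
  · obtain ⟨e, he, hm⟩ := mirror_eq_of_norm_eq hxy hne
    rw [← hm, hall e he]

open scoped ENNReal

theorem lintegral_plane_radial {G : ℝ → ℝ≥0∞} (hG : Measurable G) :
    ∫⁻ p : ℝ × ℝ, G (√(p.1 ^ 2 + p.2 ^ 2)) =
      ENNReal.ofReal (2 * π) * ∫⁻ r in Set.Ioi (0 : ℝ), ENNReal.ofReal r * G r := by
  rw [← lintegral_comp_polarCoord_symm]
  have h : ∀ p ∈ polarCoord.target, ENNReal.ofReal p.1 •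
      G (√((polarCoord.symm p).1 ^ 2 + (polarCoord.symm p).2 ^ 2)) =
      ENNReal.ofReal p.1 * G p.1 := by
    rintro ⟨r, θ⟩ hp
    have hr : 0 < r := hp.1
    have : (r * cos θ) ^ 2 + (r * sin θ) ^ 2 = r ^ 2 := by
      rw [mul_pow, mul_pow, ← mul_add, cos_sq_add_sin_sq, mul_one]
    simp only [polarCoord_symm_apply, this, sqrt_sq hr.le, smul_eq_mul]
  rw [setLIntegral_congr_fun polarCoord.open_target.measurableSet h, polarCoord_target,
    Measure.volume_eq_prod, ← Measure.prod_restrict, lintegral_prod _ (by fun_prop)]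
  simp only [lintegral_const, Measure.restrict_apply_univ, Real.volume_Ioo]
  rw [lintegral_mul_const _ (by fun_prop), mul_comm]
  congr 2
  ring

theorem lintegral_sqrt_substitution {G : ℝ → ℝ≥0∞} (z : ℝ) :
    ∫⁻ s in Set.Ioi (0 : ℝ), ENNReal.ofReal s * G (√(z ^ 2 + s ^ 2)) =
      ∫⁻ t in Set.Ioi |z|, ENNReal.ofReal t * G t := by
  have himg : (fun s : ℝ => √(z ^ 2 + s ^ 2)) '' Set.Ioi 0 = Set.Ioi |z| := by
    ext t
    constructor
    · rintro ⟨s, hs, rfl⟩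
      have hs : 0 < s := hs
      rw [Set.mem_Ioi, ← sqrt_sq_eq_abs]
      exact sqrt_lt_sqrt (sq_nonneg _) (by nlinarith)
    · intro ht
      have ht : |z| < t := ht
      have h2 : z ^ 2 < t ^ 2 := sq_lt_sq.2 (ht.trans_le (le_abs_self _))
      refine ⟨√(t ^ 2 - z ^ 2), sqrt_pos.2 (by linarith), ?_⟩
      simp only
      rw [sq_sqrt (by linarith), add_sub_cancel, sqrt_sq ((abs_nonneg z).trans ht.le)]
  have hpos : ∀ s ∈ Set.Ioi (0 : ℝ), 0 < z ^ 2 + s ^ 2 := fun s hs => by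
    have : 0 < s := hs
    positivity
  rw [← himg, lintegral_image_eq_lintegral_abs_deriv_mul measurableSet_Ioi
    (f' := fun s => s / √(z ^ 2 + s ^ 2))]
  · refine setLIntegral_congr_fun measurableSet_Ioi fun s hs => ?_
    have h1 := sqrt_pos.2 (hpos s hs)
    have hs' : 0 < s := hs
    rw [← mul_assoc, ← ENNReal.ofReal_mul (abs_nonneg _), abs_of_pos (by positivity),
      div_mul_cancel₀ _ h1.ne']
  · intro s hs
    have h := (((hasDerivAt_id' s).pow 2).const_add (z ^ 2)).sqrt (hpos s hs).ne'
    refine (h.congr_deriv ?_).hasDerivWithinAt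
    have h1 := sqrt_pos.2 (hpos s hs)
    norm_num
    field_simp
  · intro a ha b hb hab
    have ha' : 0 < a := ha
    have hb' : 0 < b := hb
    have h := (sqrt_inj (hpos a ha).le (hpos b hb).le).1 hab
    exact (sq_eq_sq₀ ha'.le hb'.le).1 (by linarith)

theorem norm_sq_eq_coords (x : E3) : ‖x‖ ^ 2 = x 0 ^ 2 + (x 1 ^ 2 + x 2 ^ 2) := by
  rw [EuclideanSpace.norm_sq_eq, Fin.sum_univ_three]
  simp only [Real.norm_eq_abs, sq_abs]
  ring

/-- The joint law of a coordinate and the norm on `ℝ³`. -/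
theorem lintegral_axial {G : ℝ × ℝ → ℝ≥0∞} (hG : Measurable G) :
    ∫⁻ x : E3, G (x 0, ‖x‖) =
      ENNReal.ofReal (2 * π) * ∫⁻ z, ∫⁻ t in Set.Ioi |z|, ENNReal.ofReal t * G (z, t) := by
  have hmp : MeasurePreserving (fun x : E3 => (x 0, (x 1, x 2))) := by
    have h1 := (volume_preserving_piFinSuccAbove (fun _ : Fin 3 => ℝ) 0).comp
      (PiLp.volume_preserving_ofLp (Fin 3))
    exact ((MeasurePreserving.id volume).prod (volume_preserving_finTwoArrow ℝ)).comp h1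
  have hH : Measurable fun w : ℝ × (ℝ × ℝ) => G (w.1, √(w.1 ^ 2 + √(w.2.1 ^ 2 + w.2.2 ^ 2) ^ 2)) :=
    hG.comp (by fun_prop)
  have h2 := hmp.lintegral_comp hH
  have h3 : ∀ x : E3, √(x 0 ^ 2 + √(x 1 ^ 2 + x 2 ^ 2) ^ 2) = ‖x‖ := fun x => by
    rw [sq_sqrt (by positivity), ← norm_sq_eq_coords, sqrt_sq (norm_nonneg _)]
  simp only [h3] at h2
  rw [h2, Measure.volume_eq_prod, lintegral_prod _ hH.aemeasurable]
  rw [← lintegral_const_mul']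
  · refine lintegral_congr fun z => ?_
    rw [lintegral_plane_radial (G := fun s => G (z, √(z ^ 2 + s ^ 2))) (hG.comp (by fun_prop)),
      lintegral_sqrt_substitution (G := fun t => G (z, t))]
  · exact ENNReal.ofReal_ne_top

open scoped ENNReal

theorem lintegral_shell_kernel {d t : ℝ} (hd : 0 < d) (ht : 0 < t) (hne : t ≠ d) :
    ∫⁻ z in Set.Ioc (-t) t, ENNReal.ofReal (1 / √(d ^ 2 - 2 * d * z + t ^ 2)) =
      ENNReal.ofReal (2 * t / max d t) := by
  have hpos : ∀ z ∈ Set.uIcc (-t) t, 0 < d ^ 2 - 2 * d * z + t ^ 2 := fun z hz => by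
    rw [Set.uIcc_of_le (by linarith)] at hz
    have : 0 < (t - d) ^ 2 := by
      have := sub_ne_zero.2 hne
      positivity
    nlinarith [hz.2]
  have hcont : ContinuousOn (fun z => 1 / √(d ^ 2 - 2 * d * z + t ^ 2)) (Set.uIcc (-t) t) :=
    continuousOn_const.div (by fun_prop) fun z hz => (sqrt_pos.2 (hpos z hz)).ne'
  have h_int := hcont.intervalIntegrable (μ := volume)
  have hftc : ∫ z in (-t)..t, 1 / √(d ^ 2 - 2 * d * z + t ^ 2) =
      -√(d ^ 2 - 2 * d * t + t ^ 2) / d - -√(d ^ 2 - 2 * d * (-t) + t ^ 2) / d := by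
    refine intervalIntegral.integral_eq_sub_of_hasDerivAt
      (f := fun z => -√(d ^ 2 - 2 * d * z + t ^ 2) / d) (fun z hz => ?_) h_int
    have h := ((((((hasDerivAt_id' z).const_mul (2 * d)).const_sub (d ^ 2)).add_const
      (t ^ 2))).sqrt (hpos z hz).ne').neg.div_const d
    refine h.congr_deriv ?_
    have := sqrt_pos.2 (hpos z hz)
    field_simp
  have hval : ∫ z in (-t)..t, 1 / √(d ^ 2 - 2 * d * z + t ^ 2) = 2 * t / max d t := by
    rw [hftc]
    have h1 : d ^ 2 - 2 * d * t + t ^ 2 = (d - t) ^ 2 := by ring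
    have h2 : d ^ 2 - 2 * d * (-t) + t ^ 2 = (d + t) ^ 2 := by ring
    rw [h1, h2, sqrt_sq_eq_abs, sqrt_sq (by positivity)]
    rcases lt_or_gt_of_ne hne with h | h
    · rw [abs_of_pos (by linarith), max_eq_left h.le]
      ring
    · rw [abs_of_neg (by linarith), max_eq_right h.le]
      field_simp
      ring
  rw [← ofReal_integral_eq_lintegral_ofReal
    ((intervalIntegrable_iff_integrableOn_Ioc_of_le (by linarith)).1 h_int)
    (Filter.Eventually.of_forall fun z => by positivity),
    ← intervalIntegral.integral_of_le (by linarith), hval]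

theorem lintegral_newton_axis {ρ : ℝ → ℝ} (hρ : Measurable ρ) (h0 : ∀ t, 0 ≤ ρ t) {d : ℝ}
    (hd : 0 < d) :
    ∫⁻ y : E3, ENNReal.ofReal (ρ ‖y‖ / ‖EuclideanSpace.single 0 d - y‖) =
      ENNReal.ofReal (4 * π) * ∫⁻ t in Set.Ioi 0, ENNReal.ofReal (t ^ 2 * ρ t / max d t) := by
  have hk : ∀ y : E3, ‖EuclideanSpace.single 0 d - y‖ =
      √(d ^ 2 - 2 * d * y 0 + ‖y‖ ^ 2) := fun y => by
    have h := norm_sub_sq_real (EuclideanSpace.single 0 d : E3) y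
    rw [EuclideanSpace.inner_single_left, PiLp.norm_single, Real.norm_eq_abs,
      sq_abs, conj_trivial] at h
    rw [← sqrt_sq (norm_nonneg (EuclideanSpace.single 0 d - y)), h, mul_assoc]
  have hG : Measurable fun w : ℝ × ℝ =>
      ENNReal.ofReal (ρ w.2 / √(d ^ 2 - 2 * d * w.1 + w.2 ^ 2)) := by fun_prop
  simp_rw [hk]
  rw [lintegral_axial hG]
  have hswap : ∫⁻ z, ∫⁻ t in Set.Ioi |z|,
      ENNReal.ofReal t * ENNReal.ofReal (ρ t / √(d ^ 2 - 2 * d * z + t ^ 2)) =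
      ∫⁻ t, ∫⁻ z, {w : ℝ × ℝ | |w.1| < w.2}.indicator (fun w => ENNReal.ofReal w.2 *
        ENNReal.ofReal (ρ w.2 / √(d ^ 2 - 2 * d * w.1 + w.2 ^ 2))) (z, t) := by
    rw [lintegral_lintegral_swap]
    · refine lintegral_congr fun z => ?_
      rw [← lintegral_indicator measurableSet_Ioi]
      rfl
    · refine (Measurable.indicator (by fun_prop) ?_).aemeasurable.comp_measurable measurable_swap
      exact measurableSet_lt (by fun_prop) (by fun_prop)
  have hinner : ∀ t : ℝ, t ≠ d → ∫⁻ z, {w : ℝ × ℝ | |w.1| < w.2}.indicator (fun w =>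
      ENNReal.ofReal w.2 * ENNReal.ofReal (ρ w.2 / √(d ^ 2 - 2 * d * w.1 + w.2 ^ 2))) (z, t) =
      (Set.Ioi 0).indicator (fun t => ENNReal.ofReal (2 * (t ^ 2 * ρ t / max d t))) t := by
    intro t hne
    by_cases ht : 0 < t
    · rw [Set.indicator_of_mem (show t ∈ Set.Ioi 0 from ht)]
      have h1 : ∀ z, {w : ℝ × ℝ | |w.1| < w.2}.indicator (fun w => ENNReal.ofReal w.2 *
          ENNReal.ofReal (ρ w.2 / √(d ^ 2 - 2 * d * w.1 + w.2 ^ 2))) (z, t) =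
          (Set.Ioo (-t) t).indicator (fun z => ENNReal.ofReal (t * ρ t) *
            ENNReal.ofReal (1 / √(d ^ 2 - 2 * d * z + t ^ 2))) z := fun z => by
        by_cases hz : |z| < t
        · rw [Set.indicator_of_mem (show (z, t) ∈ {w : ℝ × ℝ | |w.1| < w.2} from hz),
            Set.indicator_of_mem (show z ∈ Set.Ioo (-t) t from abs_lt.1 hz),
            ← ENNReal.ofReal_mul ht.le, ← ENNReal.ofReal_mul (mul_nonneg ht.le (h0 t))]
          congr 1
          ring
        · rw [Set.indicator_of_notMem (show (z, t) ∉ {w : ℝ × ℝ | |w.1| < w.2} from hz),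
            Set.indicator_of_notMem (show z ∉ Set.Ioo (-t) t from fun h => hz (abs_lt.2 h))]
      simp_rw [h1]
      rw [lintegral_indicator measurableSet_Ioo, lintegral_const_mul' _ _ ENNReal.ofReal_ne_top,
        setLIntegral_congr Ioo_ae_eq_Ioc, lintegral_shell_kernel hd ht hne,
        ← ENNReal.ofReal_mul (mul_nonneg ht.le (h0 t))]
      congr 1
      ring
    · rw [Set.indicator_of_notMem (by simpa using ht)]
      have h1 : ∀ z, {w : ℝ × ℝ | |w.1| < w.2}.indicator (fun w => ENNReal.ofReal w.2 *
          ENNReal.ofReal (ρ w.2 / √(d ^ 2 - 2 * d * w.1 + w.2 ^ 2))) (z, t) = 0 := fun z =>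
        Set.indicator_of_notMem (show (z, t) ∉ {w : ℝ × ℝ | |w.1| < w.2} from
          fun h => ht ((abs_nonneg z).trans_lt h)) _
      simp_rw [h1, lintegral_zero]
  rw [hswap]
  have hae : ∀ᵐ t : ℝ, t ≠ d := by simp [ae_iff]
  rw [lintegral_congr_ae (hae.mono fun t ht => hinner t ht), lintegral_indicator measurableSet_Ioi]
  simp_rw [ENNReal.ofReal_mul (zero_le_two (α := ℝ))]
  rw [lintegral_const_mul' _ _ ENNReal.ofReal_ne_top, ← mul_assoc,
    ← ENNReal.ofReal_mul (by positivity)]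
  congr 1
  rw [← ENNReal.ofReal_mul (by positivity)]
  congr 1
  ring

theorem lintegral_newton {ρ : ℝ → ℝ} (hρ : Measurable ρ) (h0 : ∀ t, 0 ≤ ρ t) {x : E3}
    (hx : x ≠ 0) :
    ∫⁻ y : E3, ENNReal.ofReal (ρ ‖y‖ / ‖x - y‖) =
      ENNReal.ofReal (4 * π) * ∫⁻ t in Set.Ioi 0, ENNReal.ofReal (t ^ 2 * ρ t / max ‖x‖ t) := by
  have hd : 0 < ‖x‖ := norm_pos_iff.2 hx
  rw [← lintegral_newton_axis hρ h0 hd]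
  by_cases hne : x = EuclideanSpace.single 0 ‖x‖
  · conv_lhs => rw [hne]
  · obtain ⟨e, -, hm⟩ := mirror_eq_of_norm_eq (y := EuclideanSpace.single 0 ‖x‖) (by simp) hne
    have h := (mirror e).measurePreserving.lintegral_comp_emb
      (mirror e).toMeasurableEquiv.measurableEmbedding
      (fun y => ENNReal.ofReal (ρ ‖y‖ / ‖(EuclideanSpace.single 0 ‖x‖ : E3) - y‖))
    rw [← h]
    refine lintegral_congr fun y => ?_
    rw [← hm, ← map_sub, LinearIsometryEquiv.norm_map, LinearIsometryEquiv.norm_map]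

/-- The potential at distance `r` of the radial charge density `ρ`. -/
def newtonPotential (ρ : ℝ → ℝ) (r : ℝ) : ℝ := 4 * π * ∫ t in Set.Ioi 0, t ^ 2 * ρ t / max r t

/-- Newton's theorem. -/
theorem integral_newton {ρ : ℝ → ℝ} (hρ : Measurable ρ) (h0 : ∀ t, 0 ≤ ρ t) {x : E3}
    (hx : x ≠ 0) : ∫ y : E3, ρ ‖y‖ / ‖x - y‖ = newtonPotential ρ ‖x‖ := by
  rw [newtonPotential, integral_eq_lintegral_of_nonneg_ae
    (Filter.Eventually.of_forall fun y => div_nonneg (h0 _) (norm_nonneg _))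
    (Measurable.aestronglyMeasurable (by fun_prop)), lintegral_newton hρ h0 hx,
    integral_eq_lintegral_of_nonneg_ae
    (Filter.Eventually.of_forall fun t => div_nonneg (mul_nonneg (sq_nonneg _) (h0 _))
      (le_max_of_le_left (norm_nonneg x))) (Measurable.aestronglyMeasurable (by fun_prop)),
    ENNReal.toReal_mul, ENNReal.toReal_ofReal (by positivity)]

theorem integral_radial (f : ℝ → ℝ) :
    ∫ x : E3, f ‖x‖ = 4 * π * ∫ t in Set.Ioi 0, t ^ 2 * f t := by
  rw [integral_fun_norm_addHaar]
  simp only [finrank_euclideanSpace_fin, smul_eq_mul, Measure.real,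
    EuclideanSpace.volume_ball_fin_three, nsmul_eq_mul]
  rw [ENNReal.toReal_mul, ENNReal.toReal_ofReal (by positivity)]
  simp
  ring

theorem integrable_radial {f : ℝ → ℝ} :
    Integrable (fun x : E3 => f ‖x‖) ↔ IntegrableOn (fun t => t ^ 2 * f t) (Set.Ioi 0) := by
  rw [integrable_fun_norm_addHaar]
  simp

theorem coulomb_add_sq {f φ : E3 → ℝ} (hf : CoulombAdmissible f) (hφ : CoulombAdmissible φ)
    (t : ℝ) :
    coulomb (fun x => (f x + t * φ x) ^ 2) (fun x => (f x + t * φ x) ^ 2) =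
      coulomb (fun x => f x * f x) (fun x => f x * f x) +
      4 * t * coulomb (fun x => f x * f x) (fun x => f x * φ x) +
      2 * t ^ 2 * coulomb (fun x => f x * f x) (fun x => φ x * φ x) +
      4 * t ^ 2 * coulomb (fun x => f x * φ x) (fun x => f x * φ x) +
      4 * t ^ 3 * coulomb (fun x => f x * φ x) (fun x => φ x * φ x) +
      t ^ 4 * coulomb (fun x => φ x * φ x) (fun x => φ x * φ x) := by
  have hff := hf.mul hf
  have hfp := hf.mul hφ
  have hpp := hφ.mul hφ
  have e : (fun x => (f x + t * φ x) ^ 2) =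
      fun x => f x * f x + (2 * t * (f x * φ x) + t ^ 2 * (φ x * φ x)) := by
    funext x; ring
  have h1 := hfp.const_mul (2 * t)
  have h2 := hpp.const_mul (t ^ 2)
  rw [e, coulomb_add_left hff (h1.add h2) (hff.add (h1.add h2)),
    coulomb_add_left h1 h2 (hff.add (h1.add h2))]
  simp only [coulomb_add_right hff (h1.add h2) hff, coulomb_add_right h1 h2 hff,
    coulomb_add_right hff (h1.add h2) h1, coulomb_add_right h1 h2 h1,
    coulomb_add_right hff (h1.add h2) h2, coulomb_add_right h1 h2 h2]
  simp only [coulomb_const_mul_left, coulomb_const_mul_right]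
  rw [coulomb_comm (p := fun x => f x * φ x) (q := fun x => f x * f x),
    coulomb_comm (p := fun x => φ x * φ x) (q := fun x => f x * f x),
    coulomb_comm (p := fun x => φ x * φ x) (q := fun x => f x * φ x)]
  ring

theorem integral_add_sq {f φ : E3 → ℝ} (hf : CoulombAdmissible f) (hφ : CoulombAdmissible φ)
    (t : ℝ) :
    ∫ x, (f x + t * φ x) ^ 2 =
      (∫ x, f x * f x) + 2 * t * (∫ x, f x * φ x) + t ^ 2 * ∫ x, φ x * φ x := by
  have hff := hf.mul hf
  have hfp := hf.mul hφ
  have hpp := hφ.mul hφ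
  have e : (fun x => (f x + t * φ x) ^ 2) =
      fun x => f x * f x + 2 * t * (f x * φ x) + t ^ 2 * (φ x * φ x) := by
    funext x; ring
  have h1 := hfp.const_mul (2 * t)
  have h2 := hpp.const_mul (t ^ 2)
  rw [e, integral_add (hff.add h1).integrable h2.integrable, integral_add hff.integrable
    h1.integrable, integral_const_mul, integral_const_mul]

/-- The first variation of a scaling-invariant Coulomb energy inequality that is saturated. -/
theorem first_variation {f φ : E3 → ℝ} (hf : CoulombAdmissible f) (hφ : CoulombAdmissible φ)
    {E T β b : ℝ} (hm : ∫ x, f x * f x = 1)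
    (hE : E = T - coulomb (fun x => f x * f x) (fun x => f x * f x))
    (h : ∀ t : ℝ, E * (∫ x, (f x + t * φ x) ^ 2) ^ 2 ≤
      (∫ x, (f x + t * φ x) ^ 2) * (T + 2 * t * β + t ^ 2 * b) -
        coulomb (fun x => (f x + t * φ x) ^ 2) (fun x => (f x + t * φ x) ^ 2)) :
    β = (2 * E - T) * (∫ x, f x * φ x) +
      2 * coulomb (fun x => f x * f x) (fun x => f x * φ x) := by
  simp only [coulomb_add_sq hf hφ, integral_add_sq hf hφ, hm] at h
  set a := ∫ x, f x * φ x
  set c := ∫ x, φ x * φ x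
  set D0 := coulomb (fun x => f x * f x) (fun x => f x * f x)
  set D1 := coulomb (fun x => f x * f x) (fun x => f x * φ x)
  set D2 := coulomb (fun x => f x * f x) (fun x => φ x * φ x)
  set D3 := coulomb (fun x => f x * φ x) (fun x => f x * φ x)
  set D4 := coulomb (fun x => f x * φ x) (fun x => φ x * φ x)
  set D5 := coulomb (fun x => φ x * φ x) (fun x => φ x * φ x)
  let L := 2 * a * T + 2 * β - 4 * D1 - 4 * E * a
  let c2 := b + 4 * a * β + c * T - 2 * D2 - 4 * D3 - E * (2 * c + 4 * a ^ 2)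
  let c3 := 2 * a * b + 2 * c * β - 4 * D4 - 4 * E * a * c
  let c4 := c * b - D5 - E * c ^ 2
  have hpos : ∀ t : ℝ, 0 ≤ L * t + c2 * t ^ 2 + c3 * t ^ 3 + c4 * t ^ 4 := fun t => by
    have h1 := h t
    rw [← sub_nonneg] at h1
    refine h1.trans_eq ?_
    simp only [L, c2, c3, c4]
    have : D0 = T - E := by linarith
    rw [this]
    ring
  have hd : HasDerivAt (fun t : ℝ => L * t + c2 * t ^ 2 + c3 * t ^ 3 + c4 * t ^ 4) L 0 := by
    have h1 := ((((hasDerivAt_id' (0 : ℝ)).const_mul L).add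
      (((hasDerivAt_id' (0 : ℝ)).pow 2).const_mul c2)).add
      (((hasDerivAt_id' (0 : ℝ)).pow 3).const_mul c3)).add
      (((hasDerivAt_id' (0 : ℝ)).pow 4).const_mul c4)
    refine h1.congr_deriv ?_
    norm_num
  have hmin : IsLocalMin (fun t : ℝ => L * t + c2 * t ^ 2 + c3 * t ^ 3 + c4 * t ^ 4) 0 :=
    Filter.Eventually.of_forall fun t => by simpa using hpos t
  have hL := hmin.hasDerivAt_eq_zero hd
  simp only [L] at hL
  linarith

theorem norm_fderiv_radial {u : E3 → ℝ} {U : ℝ → ℝ} (hU : Differentiable ℝ U)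
    (hu : ∀ x, u x = U ‖x‖) {x : E3} (hx : x ≠ 0) : ‖fderiv ℝ u x‖ = |deriv U ‖x‖| := by
  have hn : DifferentiableAt ℝ (fun y : E3 => ‖y‖) x :=
    (contDiffAt_norm ℝ hx (n := 1)).differentiableAt (by simp)
  have h := (hU ‖x‖).hasDerivAt.comp_hasFDerivAt x hn.hasFDerivAt
  have he : u = U ∘ fun y : E3 => ‖y‖ := funext hu
  rw [he, h.fderiv, norm_smul, norm_fderiv_norm hn, mul_one, Real.norm_eq_abs]

theorem integral_norm_fderiv_radial {u : E3 → ℝ} {U : ℝ → ℝ} (hU : Differentiable ℝ U)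
    (hu : ∀ x, u x = U ‖x‖) :
    ∫ x, ‖fderiv ℝ u x‖ ^ 2 = 4 * π * ∫ r in Set.Ioi 0, r ^ 2 * deriv U r ^ 2 := by
  rw [← integral_radial fun r => deriv U r ^ 2]
  refine integral_congr_ae ?_
  filter_upwards [compl_mem_ae_iff.2 (measure_singleton (0 : E3))] with x hx
  rw [norm_fderiv_radial hU hu hx, sq_abs]

theorem contDiff_radial_of_tsupport {P : ℝ → ℝ} (hP : ContDiff ℝ ∞ P)
    (hs : tsupport P ⊆ Set.Ioi 0) : ContDiff ℝ ∞ fun x : E3 => P ‖x‖ := by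
  rw [contDiff_iff_contDiffAt]
  intro x
  by_cases hx : x = 0
  · have h0 : (0 : ℝ) ∉ tsupport P := fun h => (lt_irrefl (0 : ℝ)) (hs h)
    have h1 : ∀ᶠ r in nhds (0 : ℝ), P r = 0 := notMem_tsupport_iff_eventuallyEq.1 h0
    have h2 : Filter.Tendsto (fun y : E3 => ‖y‖) (nhds x) (nhds 0) := by
      rw [hx]; simpa using (continuous_norm (E := E3)).tendsto 0
    exact contDiffAt_const.congr_of_eventuallyEq (h2.eventually h1)
  · exact hP.contDiffAt.comp x (contDiffAt_norm ℝ hx)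

theorem hasCompactSupport_radial {P : ℝ → ℝ} (hc : HasCompactSupport P) :
    HasCompactSupport fun x : E3 => P ‖x‖ := by
  obtain ⟨R, hR⟩ := hc.isCompact.isBounded.subset_closedBall (0 : ℝ)
  refine HasCompactSupport.intro (isCompact_closedBall (0 : E3) R) fun x hx => ?_
  by_contra h
  have := hR (subset_tsupport _ h)
  apply hx
  simpa using this

/-- The modulus of `ψ` along the first coordinate axis. -/
def profile (ψ : SchwartzMap E3 ℂ) (r : ℝ) : ℝ := ‖ψ (EuclideanSpace.single 0 r)‖

theorem isometry_axis : Isometry fun r : ℝ => (EuclideanSpace.single 0 r : E3) :=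
  Isometry.of_dist_eq fun a b => by simp

theorem contDiff_axis {n : WithTop ℕ∞} :
    ContDiff ℝ n fun r : ℝ => (EuclideanSpace.single 0 r : E3) := by
  have : (fun r : ℝ => (EuclideanSpace.single 0 r : E3)) =
      fun r : ℝ => r • (EuclideanSpace.single 0 1 : E3) := by
    funext r
    ext i
    fin_cases i <;> simp
  rw [this]
  fun_prop

section profile

variable (ψ : SchwartzMap E3 ℂ)

theorem continuous_profile : Continuous (profile ψ) :=
  (ψ.continuous.comp isometry_axis.continuous).norm

theorem profile_nonneg (r : ℝ) : 0 ≤ profile ψ r := norm_nonneg _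

variable {ψ}

theorem norm_eq_profile (hrad : ∀ x y : E3, ‖x‖ = ‖y‖ → ‖ψ x‖ = ‖ψ y‖) (x : E3) :
    ‖ψ x‖ = profile ψ ‖x‖ := hrad _ _ (by simp)

theorem profile_neg (hrad : ∀ x y : E3, ‖x‖ = ‖y‖ → ‖ψ x‖ = ‖ψ y‖) (r : ℝ) :
    profile ψ (-r) = profile ψ r := hrad _ _ (by simp)

end profile

namespace IsPekarMinimizer

variable {ψ : SchwartzMap E3 ℂ}

theorem weak_eq_aux (hψ : IsPekarMinimizer ψ) (hrad : ∀ x y : E3, ‖x‖ = ‖y‖ → ‖ψ x‖ = ‖ψ y‖)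
    {P : ℝ → ℝ} (hP : ContDiff ℝ ∞ P) (hPc : HasCompactSupport P) (hPs : tsupport P ⊆ Set.Ioi 0) :
    4 * π * -∫ r, deriv (fun s => s ^ 2 * deriv P s) r * profile ψ r =
      (2 * pekarF ψ - ∫ x, ‖fderiv ℝ ψ x‖ ^ 2) * (∫ x : E3, ‖ψ x‖ * P ‖x‖) +
      2 * coulomb (fun x => ‖ψ x‖ * ‖ψ x‖) (fun x => ‖ψ x‖ * P ‖x‖) := by
  have hf := coulombAdmissible_norm ψ
  have hφs := contDiff_radial_of_tsupport hP hPs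
  have hφc := hasCompactSupport_radial hPc
  have hφ := coulombAdmissible_of_hasCompactSupport hφs.continuous hφc
  set T := ∫ x, ‖fderiv ℝ ψ x‖ ^ 2 with hT
  set w : ℝ → ℝ := deriv fun s => s ^ 2 * deriv P s with hw
  have hP' : ContDiff ℝ ∞ (deriv P) := (contDiff_infty_iff_deriv.1 hP).2
  have hQ : ContDiff ℝ ∞ fun s => s ^ 2 * deriv P s := (contDiff_id.pow 2).mul hP'
  have hQc : HasCompactSupport fun s => s ^ 2 * deriv P s := hPc.deriv.mul_left
  have hwc : Continuous w := (contDiff_infty_iff_deriv.1 hQ).2.continuous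
  have hws : HasCompactSupport w := hQc.deriv
  refine first_variation hf hφ (b := 4 * π * ∫ r in Set.Ioi 0, r ^ 2 * deriv P r ^ 2) ?_ ?_ ?_
  · simpa only [sq] using hψ.norm_eq
  · have h := pekarF_eq_sub_coulomb ψ
    rw [← hT] at h
    simpa only [sq] using h
  intro t
  let ε : ℕ → ℝ := fun n => 1 / ((n : ℝ) + 1)
  have hε : ∀ n, 0 < ε n := fun n => by positivity
  have hε0 : Filter.Tendsto ε Filter.atTop (nhds 0) := tendsto_one_div_add_atTop_nhds_zero_nat
  let Φ : ℕ → ℝ → ℝ := fun n r => truncNorm (ε n) ψ (EuclideanSpace.single 0 r)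
  have hfs : ∀ n, ContDiff ℝ ∞ (truncNorm (ε n) ψ) := fun n =>
    contDiff_truncNorm (hε n) (ψ.smooth _)
  have hfc : ∀ n, HasCompactSupport (truncNorm (ε n) ψ) := fun n =>
    ψ.hasCompactSupport_truncNorm (hε n)
  have hΦ : ∀ n, ContDiff ℝ ∞ (Φ n) := fun n => (hfs n).comp contDiff_axis
  have hΦc : ∀ n, HasCompactSupport (Φ n) := fun n =>
    (hfc n).comp_isClosedEmbedding isometry_axis.isClosedEmbedding
  have hfΦ : ∀ n x, truncNorm (ε n) ψ x = Φ n ‖x‖ := fun n x => by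
    simp only [Φ, truncNorm]
    rw [hrad x (EuclideanSpace.single 0 ‖x‖) (by simp)]
  have hlimΦ : ∀ r, Filter.Tendsto (fun n => Φ n r) Filter.atTop (nhds (profile ψ r)) := fun r => by
    rw [tendsto_iff_dist_tendsto_zero]
    refine squeeze_zero (fun n => dist_nonneg) (fun n => ?_) (by simpa using hε0.const_mul 2)
    rw [Real.dist_eq]
    exact abs_truncNorm_sub_le (hε n) _
  have hlim : ∀ x, Filter.Tendsto (fun n => truncNorm (ε n) ψ x) Filter.atTop (nhds ‖ψ x‖) :=
    fun x => by
      simp_rw [hfΦ, norm_eq_profile hrad]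
      exact hlimΦ _
  have hτ : Filter.Tendsto (fun n => ∫ r, w r * Φ n r) Filter.atTop
      (nhds (∫ r, w r * profile ψ r)) := by
    refine tendsto_integral_of_dominated_convergence (fun r => |w r| * profile ψ r)
      (fun n => (hwc.mul (hΦ n).continuous).aestronglyMeasurable) ?_ ?_ ?_
    · exact (hwc.abs.mul (continuous_profile ψ)).integrable_of_hasCompactSupport
        (HasCompactSupport.mul_right hws.abs)
    · refine fun n => Filter.Eventually.of_forall fun r => ?_
      rw [norm_mul, Real.norm_eq_abs, Real.norm_eq_abs, abs_of_nonneg (truncNorm_nonneg (hε n) _)]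
      exact mul_le_mul_of_nonneg_left (truncNorm_le (hε n) _) (abs_nonneg _)
    · exact Filter.Eventually.of_forall fun r => (hlimΦ r).const_mul _
  refine hψ.le_of_tendsto (u := fun n x => truncNorm (ε n) ψ x + t * P ‖x‖)
    (G := fun x => ‖ψ x‖ + |t| * |P ‖x‖|)
    (τ := fun n => T + 2 * t * (4 * π * -∫ r, w r * Φ n r) +
      t ^ 2 * (4 * π * ∫ r in Set.Ioi 0, r ^ 2 * deriv P r ^ 2))
    (fun n => (hfs n).add (contDiff_const.mul hφs)) (fun n => (hfc n).add hφc.mul_left)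
    (hf.add (hφ.abs.const_mul _)) (fun n x => ?_) (fun x => (hlim x).add_const _) (fun n => ?_)
    (((hτ.neg.const_mul _).const_mul _).const_add _ |>.add_const _)
  · refine (abs_add_le _ _).trans ?_
    rw [abs_of_nonneg (truncNorm_nonneg (hε n) _), abs_mul]
    exact add_le_add_left (truncNorm_le (hε n) _) _
  · have hd1 : Differentiable ℝ (Φ n) := (hΦ n).differentiable (by simp)
    have hd2 : Differentiable ℝ P := hP.differentiable (by simp)
    have hΦ' : Continuous (deriv (Φ n)) := (hΦ n).continuous_deriv (by simp)
    have hder : ∀ r, deriv (fun s => Φ n s + t * P s) r = deriv (Φ n) r + t * deriv P r := fun r =>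
      ((hd1 r).hasDerivAt.add ((hd2 r).hasDerivAt.const_mul t)).deriv
    rw [integral_norm_fderiv_radial (U := fun s => Φ n s + t * P s)
      (hd1.add (hd2.const_mul t)) fun x => by rw [hfΦ]]
    simp_rw [hder]
    have hle := integral_norm_fderiv_truncNorm_le ψ (hε n)
    rw [integral_norm_fderiv_radial hd1 (hfΦ n)] at hle
    have i1 : IntegrableOn (fun r => r ^ 2 * deriv (Φ n) r ^ 2) (Set.Ioi 0) :=
      (Continuous.integrable_of_hasCompactSupport (by fun_prop)
        (((hΦc n).deriv.comp_left (g := fun s : ℝ => s ^ 2) (by simp)).mul_left)).integrableOn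
    have i2 : Integrable (fun r => r ^ 2 * deriv P r * deriv (Φ n) r) :=
      (Continuous.integrable_of_hasCompactSupport (hQ.continuous.mul hΦ') ((hΦc n).deriv.mul_left))
    have hP'c := hP'.continuous
    have i3 : IntegrableOn (fun r => r ^ 2 * deriv P r ^ 2) (Set.Ioi 0) :=
      (Continuous.integrable_of_hasCompactSupport (by fun_prop)
        ((hPc.deriv.comp_left (g := fun s : ℝ => s ^ 2) (by simp)).mul_left)).integrableOn
    have hexp : ∀ r, r ^ 2 * (deriv (Φ n) r + t * deriv P r) ^ 2 = r ^ 2 * deriv (Φ n) r ^ 2 +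
        2 * t * (r ^ 2 * deriv P r * deriv (Φ n) r) + t ^ 2 * (r ^ 2 * deriv P r ^ 2) :=
      fun r => by ring
    simp_rw [hexp]
    have j2 := i2.integrableOn (s := Set.Ioi 0) |>.const_mul (2 * t)
    have j3 := i3.const_mul (t ^ 2)
    have j12 : IntegrableOn (fun r => r ^ 2 * deriv (Φ n) r ^ 2 +
        2 * t * (r ^ 2 * deriv P r * deriv (Φ n) r)) (Set.Ioi 0) := i1.add j2
    rw [integral_add j12 j3, integral_add i1 j2, integral_const_mul, integral_const_mul]
    have hibp : ∫ r in Set.Ioi 0, r ^ 2 * deriv P r * deriv (Φ n) r = -∫ r, w r * Φ n r := by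
      rw [setIntegral_eq_integral_of_forall_compl_eq_zero]
      · refine integral_mul_deriv_eq_deriv_mul_of_integrable
          (fun r _ => (hQ.differentiable (by simp) r).hasDerivAt) (fun r _ => (hd1 r).hasDerivAt) i2
          ?_ ?_
        · exact (hwc.mul (hΦ n).continuous).integrable_of_hasCompactSupport hws.mul_right
        · exact (hQ.continuous.mul (hΦ n).continuous).integrable_of_hasCompactSupport hQc.mul_right
      · intro r hr
        have h1 : r ∉ tsupport P := fun h => hr (hPs h)
        have h2 : deriv P r = 0 := by
          by_contra h
          exact h1 (support_deriv_subset h)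
        rw [h2]; ring
    rw [hibp]
    have := mul_le_mul_of_nonneg_left (sub_nonneg.2 hle) (zero_le_one (α := ℝ))
    linarith

end IsPekarMinimizer

theorem contDiff_div_id {χ : ℝ → ℝ} (hχ : ContDiff ℝ ∞ χ) (hs : tsupport χ ⊆ Set.Ioi 0) :
    ContDiff ℝ ∞ fun r => χ r / r := by
  rw [contDiff_iff_contDiffAt]
  intro r
  by_cases hr : r ∈ tsupport χ
  · exact hχ.contDiffAt.div contDiffAt_id (ne_of_gt (hs hr))
  · have h1 : ∀ᶠ s in nhds r, χ s = 0 := notMem_tsupport_iff_eventuallyEq.1 hr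
    refine (contDiffAt_const (c := (0 : ℝ))).congr_of_eventuallyEq ?_
    filter_upwards [h1] with s hs
    rw [hs, zero_div]

theorem tsupport_div_id_subset (χ : ℝ → ℝ) : tsupport (fun r => χ r / r) ⊆ tsupport χ :=
  closure_mono fun r hr h => hr (by simp only [h, zero_div])

theorem IsPekarMinimizer.weak_eq {ψ : SchwartzMap E3 ℂ} (hψ : IsPekarMinimizer ψ)
    (hrad : ∀ x y : E3, ‖x‖ = ‖y‖ → ‖ψ x‖ = ‖ψ y‖) {χ : ℝ → ℝ} (hχ : ContDiff ℝ ∞ χ)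
    (hχc : HasCompactSupport χ) (hχs : tsupport χ ⊆ Set.Ioi 0) :
    -∫ r, deriv (deriv χ) r * (r * profile ψ r) =
      (2 * pekarF ψ - ∫ x, ‖fderiv ℝ ψ x‖ ^ 2) *
        (∫ r in Set.Ioi 0, r * profile ψ r * χ r) +
      2 * ∫ r in Set.Ioi 0,
        r * profile ψ r * χ r * newtonPotential (fun t => profile ψ t ^ 2) r := by
  have hP := contDiff_div_id hχ hχs
  have hPs := (tsupport_div_id_subset χ).trans hχs
  have hPc : HasCompactSupport fun r => χ r / r := by
    refine hχc.mono fun r hr h => hr ?_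
    simp only [h, zero_div]
  have hmain := hψ.weak_eq_aux hrad hP hPc hPs
  have h0 : ∀ᶠ s in nhds (0 : ℝ), χ s = 0 :=
    notMem_tsupport_iff_eventuallyEq.1 fun h => (lt_irrefl (0 : ℝ)) (hχs h)
  have hχd : Differentiable ℝ χ := hχ.differentiable (by simp)
  have hχ' : ContDiff ℝ ∞ (deriv χ) := (contDiff_infty_iff_deriv.1 hχ).2
  have e1 : (fun s => s ^ 2 * deriv (fun r => χ r / r) s) = fun s => s * deriv χ s - χ s := by
    funext s
    by_cases hs : s = 0
    · subst hs
      simp [h0.self_of_nhds]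
    · have := ((hχd s).hasDerivAt.fun_div (hasDerivAt_id' s) hs).deriv
      rw [this]
      field_simp
  have e2 : ∀ s, deriv (fun s => s ^ 2 * deriv (fun r => χ r / r) s) s =
      s * deriv (deriv χ) s := fun s => by
    rw [e1]
    have := (((hasDerivAt_id' s).mul ((hχ'.differentiable (by simp) s).hasDerivAt)).sub
      (hχd s).hasDerivAt).deriv
    refine this.trans ?_
    ring
  have hfφ : CoulombAdmissible fun x : E3 => ‖ψ x‖ * (χ ‖x‖ / ‖x‖) :=
    (coulombAdmissible_norm ψ).mul (coulombAdmissible_of_hasCompactSupport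
      (contDiff_radial_of_tsupport hP hPs).continuous (hasCompactSupport_radial hPc))
  have e3 : ∫ x : E3, ‖ψ x‖ * (χ ‖x‖ / ‖x‖) =
      4 * π * ∫ r in Set.Ioi 0, r * profile ψ r * χ r := by
    simp_rw [norm_eq_profile hrad]
    rw [integral_radial fun r => profile ψ r * (χ r / r)]
    congr 1
    refine setIntegral_congr_fun measurableSet_Ioi fun r hr => ?_
    have : r ≠ 0 := ne_of_gt hr
    field_simp
  have e4 : coulomb (fun x => ‖ψ x‖ * ‖ψ x‖) (fun x => ‖ψ x‖ * (χ ‖x‖ / ‖x‖)) =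
      4 * π * ∫ r in Set.Ioi 0, r * profile ψ r * χ r *
        newtonPotential (fun t => profile ψ t ^ 2) r := by
    rw [coulomb_comm, coulomb_eq_integral hfφ
      ((coulombAdmissible_norm ψ).mul (coulombAdmissible_norm ψ))]
    have : ∫ x : E3, ‖ψ x‖ * (χ ‖x‖ / ‖x‖) * ∫ y, ‖ψ y‖ * ‖ψ y‖ / ‖x - y‖ =
        ∫ x : E3, (fun r => profile ψ r * (χ r / r) *
          newtonPotential (fun t => profile ψ t ^ 2) r) ‖x‖ := by
      refine integral_congr_ae ?_
      filter_upwards [compl_mem_ae_iff.2 (measure_singleton (0 : E3))] with x hx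
      rw [← integral_newton (ρ := fun t => profile ψ t ^ 2)
        (((continuous_profile ψ).pow 2).measurable) (fun t => sq_nonneg _) hx]
      simp only [norm_eq_profile hrad, sq]
    rw [this, integral_radial fun r => profile ψ r * (χ r / r) *
      newtonPotential (fun t => profile ψ t ^ 2) r]
    congr 1
    refine setIntegral_congr_fun measurableSet_Ioi fun r hr => ?_
    have : r ≠ 0 := ne_of_gt hr
    field_simp
  rw [e3, e4] at hmain
  simp_rw [e2] at hmain
  have e5 : ∫ r, deriv (deriv χ) r * (r * profile ψ r) =
      ∫ r, r * deriv (deriv χ) r * profile ψ r :=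
    integral_congr_ae (Filter.Eventually.of_forall fun r => by ring)
  rw [e5]
  have hpi : 4 * π ≠ 0 := by positivity
  refine mul_left_cancel₀ hpi ?_
  linarith

/-- `2 (v 0 - v r)` for the radial Newton potential `v` of the density `F ^ 2`. -/
def fieldDrop (F : ℝ → ℝ) (r : ℝ) : ℝ :=
  8 * π * (r ^ 2 * ∫ s in (0 : ℝ)..1, (s - s ^ 2) * F (r * s) ^ 2)

theorem continuous_fieldDrop {F : ℝ → ℝ} (hF : Continuous F) : Continuous (fieldDrop F) := by
  unfold fieldDrop
  have := intervalIntegral.continuous_parametric_intervalIntegral_of_continuous' (μ := volume)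
    (f := fun r s => (s - s ^ 2) * F (r * s) ^ 2) (by fun_prop) 0 1
  fun_prop

theorem fieldDrop_eq {F : ℝ → ℝ} {r : ℝ} (hr : r ≠ 0) :
    fieldDrop F r = 8 * π * ∫ t in (0 : ℝ)..r, (t - t ^ 2 / r) * F t ^ 2 := by
  unfold fieldDrop
  congr 1
  have h := intervalIntegral.mul_integral_comp_mul_left (a := 0) (b := 1)
    (f := fun t => (t - t ^ 2 / r) * F t ^ 2) r
  rw [mul_zero, mul_one] at h
  rw [← h, sq, mul_assoc, ← intervalIntegral.integral_const_mul]
  congr 1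
  refine intervalIntegral.integral_congr fun s _ => ?_
  field_simp

theorem two_mul_newtonPotential {F : ℝ → ℝ} (hF : Continuous F)
    (h_int : IntegrableOn (fun t => t ^ 2 * F t ^ 2) (Set.Ioi 0)) {r : ℝ} (hr : 0 < r) :
    2 * newtonPotential (fun t => F t ^ 2) r =
      8 * π * (∫ t in Set.Ioi 0, t * F t ^ 2) - fieldDrop F r := by
  have h1 : IntegrableOn (fun t => t * F t ^ 2) (Set.Ioi r) := by
    refine Integrable.mono' ((h_int.mono_set (Set.Ioi_subset_Ioi hr.le)).const_mul r⁻¹)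
      (by fun_prop) ?_
    filter_upwards [ae_restrict_mem measurableSet_Ioi] with t ht
    have ht0 : 0 < t := hr.trans ht
    rw [Real.norm_of_nonneg (by positivity)]
    have : r⁻¹ * (t ^ 2 * F t ^ 2) - t * F t ^ 2 = (t - r) * (t * F t ^ 2) / r := by
      field_simp
    have h2 : 0 ≤ (t - r) * (t * F t ^ 2) / r := by
      have : 0 ≤ t - r := sub_nonneg.2 (le_of_lt ht)
      positivity
    linarith
  have hU : Set.Ioi (0 : ℝ) = Set.Ioc 0 r ∪ Set.Ioi r := (Set.Ioc_union_Ioi_eq_Ioi hr.le).symm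
  have hdj : Disjoint (Set.Ioc (0 : ℝ) r) (Set.Ioi r) := Set.Ioc_disjoint_Ioi le_rfl
  have h2 : IntegrableOn (fun t => t * F t ^ 2) (Set.Ioc 0 r) :=
    (Continuous.integrableOn_Icc (by fun_prop)).mono_set Set.Ioc_subset_Icc_self
  have h3 : IntegrableOn (fun t => t ^ 2 / r * F t ^ 2) (Set.Ioc 0 r) :=
    (Continuous.integrableOn_Icc (by fun_prop)).mono_set Set.Ioc_subset_Icc_self
  have e1 : Set.EqOn (fun t => t ^ 2 * F t ^ 2 / max r t) (fun t => t ^ 2 / r * F t ^ 2)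
      (Set.Ioc 0 r) := fun t ht => by
    simp only [max_eq_left ht.2]; ring
  have e2 : Set.EqOn (fun t => t ^ 2 * F t ^ 2 / max r t) (fun t => t * F t ^ 2)
      (Set.Ioi r) := fun t ht => by
    have : t ≠ 0 := ne_of_gt (hr.trans ht)
    simp only [max_eq_right (le_of_lt (Set.mem_Ioi.1 ht))]
    field_simp
  have e3 : ∫ t in (0 : ℝ)..r, (t - t ^ 2 / r) * F t ^ 2 =
      (∫ t in Set.Ioc 0 r, t * F t ^ 2) - ∫ t in Set.Ioc 0 r, t ^ 2 / r * F t ^ 2 := by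
    rw [intervalIntegral.integral_of_le hr.le, ← integral_sub h2 h3]
    simp only [sub_mul]
  unfold newtonPotential
  rw [fieldDrop_eq hr.ne', e3, hU, setIntegral_union hdj measurableSet_Ioi h2 h1,
    setIntegral_union hdj measurableSet_Ioi (h3.congr_fun e1.symm measurableSet_Ioc)
      (h1.congr_fun e2.symm measurableSet_Ioi), setIntegral_congr_fun measurableSet_Ioc e1,
    setIntegral_congr_fun measurableSet_Ioi e2]
  ring

open scoped Convolution

/-- A continuous function with vanishing second distributional derivative on the half line is
affine there. -/
theorem affine_of_integral_deriv2_mul_eq_zero {h : ℝ → ℝ} (hh : Continuous h)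
    (H : ∀ χ : ℝ → ℝ, ContDiff ℝ ∞ χ → HasCompactSupport χ → tsupport χ ⊆ Set.Ioi 0 →
      ∫ r, deriv (deriv χ) r * h r = 0) {x : ℝ} (hx : 0 < x) :
    h x = h 1 + (h 2 - h 1) * (x - 1) := by
  let φ : ℕ → ContDiffBump (0 : ℝ) := fun n =>
    ⟨1 / (2 * ((n : ℝ) + 1)), 1 / ((n : ℝ) + 1), by positivity, by
      apply one_div_lt_one_div_of_lt <;> linarith [(n.cast_nonneg : (0 : ℝ) ≤ n)]⟩
  have hr : Filter.Tendsto (fun n => (φ n).rOut) Filter.atTop (nhds 0) :=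
    tendsto_one_div_add_atTop_nhds_zero_nat
  let u : ℕ → ℝ → ℝ := fun n =>
    (φ n).normed volume ⋆[ContinuousLinearMap.lsmul ℝ ℝ, volume] h
  have hu : ∀ y, Filter.Tendsto (fun n => u n y) Filter.atTop (nhds (h y)) := fun y =>
    ContDiffBump.convolution_tendsto_right_of_continuous hr hh y
  have key : ∀ n y, (φ n).rOut < y → (φ n).rOut < 1 →
      u n y = u n 1 + (u n 2 - u n 1) * (y - 1) := by
    intro n y hy h1
    set p := (φ n).normed volume with hp
    have hps : ContDiff ℝ ∞ p := (φ n).contDiff_normed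
    have hpc : HasCompactSupport p := (φ n).hasCompactSupport_normed
    have hps' : ContDiff ℝ ∞ (deriv p) := (contDiff_infty_iff_deriv.1 hps).2
    have hd1 : ∀ z, HasDerivAt (u n)
        ((deriv p ⋆[ContinuousLinearMap.lsmul ℝ ℝ, volume] h) z) z := fun z =>
      hpc.hasDerivAt_convolution_left _ (hps.of_le (by simp)) hh.locallyIntegrable z
    have hd2 : ∀ z, HasDerivAt (deriv p ⋆[ContinuousLinearMap.lsmul ℝ ℝ, volume] h)
        ((deriv (deriv p) ⋆[ContinuousLinearMap.lsmul ℝ ℝ, volume] h) z) z := fun z =>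
      hpc.deriv.hasDerivAt_convolution_left _ (hps'.of_le (by simp)) hh.locallyIntegrable z
    have hz : ∀ z, (φ n).rOut < z →
        (deriv (deriv p) ⋆[ContinuousLinearMap.lsmul ℝ ℝ, volume] h) z = 0 := fun z hz => by
      have hd : deriv (deriv fun s => p (z - s)) = fun s => deriv (deriv p) (z - s) := by
        have e1 : deriv (fun s => p (z - s)) = fun s => -deriv p (z - s) := by
          funext s; rw [deriv_comp_const_sub]
        rw [e1]
        funext s
        rw [deriv.fun_neg, deriv_comp_const_sub, neg_neg]
      have hsup : ∀ s, s ∉ Metric.closedBall z (φ n).rOut → p (z - s) = 0 := fun s hs => by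
        have : z - s ∉ Metric.ball (0 : ℝ) (φ n).rOut := by
          simp only [Metric.mem_closedBall, Metric.mem_ball, Real.dist_eq, sub_zero] at hs ⊢
          rw [abs_sub_comm] at hs
          linarith
        rw [← (φ n).support_normed_eq (μ := volume)] at this
        exact Function.notMem_support.1 this
      have h3 := H (fun s => p (z - s)) (hps.comp (contDiff_const.sub contDiff_id))
        (HasCompactSupport.intro (isCompact_closedBall z (φ n).rOut) hsup) (by
          refine (closure_minimal (t := Metric.closedBall z (φ n).rOut) (fun s hs => ?_)
            Metric.isClosed_closedBall).trans fun s hs => ?_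
          · by_contra h
            exact hs (hsup s h)
          · rw [Metric.mem_closedBall, Real.dist_eq, abs_le] at hs
            exact Set.mem_Ioi.2 (by linarith [hs.1]))
      rw [hd] at h3
      rw [convolution_eq_swap]
      exact h3
    have hconn : IsPreconnected (Set.Ioi (φ n).rOut) := isPreconnected_Ioi
    have hc1 : ∀ z ∈ Set.Ioi (φ n).rOut,
        (deriv p ⋆[ContinuousLinearMap.lsmul ℝ ℝ, volume] h) z =
        (deriv p ⋆[ContinuousLinearMap.lsmul ℝ ℝ, volume] h) 1 := fun z hz' =>
      isOpen_Ioi.is_const_of_deriv_eq_zero hconn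
        (fun w _ => (hd2 w).differentiableAt.differentiableWithinAt)
        (fun w hw => (hd2 w).deriv.trans (hz w hw)) hz' h1
    set c := (deriv p ⋆[ContinuousLinearMap.lsmul ℝ ℝ, volume] h) 1
    have hd3 : ∀ z, HasDerivAt (fun s => u n s - c * s)
        ((deriv p ⋆[ContinuousLinearMap.lsmul ℝ ℝ, volume] h) z - c) z := fun z => by
      simpa using (hd1 z).fun_sub ((hasDerivAt_id' z).const_mul c)
    have hc2 : ∀ z ∈ Set.Ioi (φ n).rOut, u n z - c * z = u n 1 - c * 1 := fun z hz' =>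
      isOpen_Ioi.is_const_of_deriv_eq_zero hconn (f := fun s => u n s - c * s)
        (fun w _ => (hd3 w).differentiableAt.differentiableWithinAt)
        (fun w hw => (hd3 w).deriv.trans (by rw [hc1 w hw]; simp)) hz' h1
    have a1 := hc2 y hy
    have a2 := hc2 2 (by rw [Set.mem_Ioi]; linarith)
    have a3 : c = u n 2 - u n 1 := by linarith
    rw [← a3]
    linarith
  refine tendsto_nhds_unique_of_eventuallyEq (hu x)
    ((hu 1).add (((hu 2).sub (hu 1)).mul_const (x - 1))) ?_
  filter_upwards [hr.eventually (gt_mem_nhds hx), hr.eventually (gt_mem_nhds one_pos)] with n h1 h2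
  exact key n x h1 h2

theorem integral_deriv2_mul_primitive {χ q : ℝ → ℝ} (hχ : ContDiff ℝ ∞ χ)
    (hχc : HasCompactSupport χ) {Q1 Q2 : ℝ → ℝ} (hq : Continuous q)
    (h1 : ∀ r, HasDerivAt Q1 (q r) r) (h2 : ∀ r, HasDerivAt Q2 (Q1 r) r) :
    ∫ r, deriv (deriv χ) r * Q2 r = ∫ r, χ r * q r := by
  have c1 : Continuous Q1 := continuous_iff_continuousAt.2 fun r => (h1 r).continuousAt
  have c2 : Continuous Q2 := continuous_iff_continuousAt.2 fun r => (h2 r).continuousAt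
  have hχ' : ContDiff ℝ ∞ (deriv χ) := (contDiff_infty_iff_deriv.1 hχ).2
  have hχ'' : Continuous (deriv (deriv χ)) := hχ'.continuous_deriv (by simp)
  have e1 := integral_mul_deriv_eq_deriv_mul_of_integrable (u := deriv χ) (v := Q2)
    (fun r _ => (hχ'.differentiable (by simp) r).hasDerivAt) (fun r _ => h2 r)
    ((hχ'.continuous.mul c1).integrable_of_hasCompactSupport hχc.deriv.mul_right)
    ((hχ''.mul c2).integrable_of_hasCompactSupport hχc.deriv.deriv.mul_right)
    ((hχ'.continuous.mul c2).integrable_of_hasCompactSupport hχc.deriv.mul_right)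
  have e2 := integral_mul_deriv_eq_deriv_mul_of_integrable (u := χ) (v := Q1)
    (fun r _ => (hχ.differentiable (by simp) r).hasDerivAt) (fun r _ => h1 r)
    ((hχ.continuous.mul hq).integrable_of_hasCompactSupport hχc.mul_right)
    ((hχ'.continuous.mul c1).integrable_of_hasCompactSupport hχc.deriv.mul_right)
    ((hχ.continuous.mul c1).integrable_of_hasCompactSupport hχc.mul_right)
  linarith

/-- The radial profile equation satisfied by the modulus of a minimizer. -/
structure PekarProfile (F : ℝ → ℝ) (κ m : ℝ) : Prop where
  continuous : Continuous F
  nonneg : ∀ r, 0 ≤ F r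
  decay : ∃ C, ∀ r, (1 + r ^ 2) * F r ≤ C
  mass : 4 * π * ∫ r in Set.Ioi 0, (r * F r) ^ 2 = m
  hasDerivAt : ∀ r, HasDerivAt (fun s => s * F s) (deriv (fun s => s * F s) r) r
  hasDerivAt_deriv : ∀ r, HasDerivAt (deriv fun s => s * F s)
    ((fieldDrop F r - κ) * (r * F r)) r

theorem fieldDrop_neg {F : ℝ → ℝ} (hF : ∀ r, F (-r) = F r) (r : ℝ) :
    fieldDrop F (-r) = fieldDrop F r := by
  unfold fieldDrop
  simp only [neg_mul, hF, even_two.neg_pow]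

theorem eq_linear_add_primitive {F κ' : ℝ → ℝ} (hF : Continuous F) (hκ : Continuous κ')
    (hFn : ∀ r, F (-r) = F r) (hκn : ∀ r, κ' (-r) = κ' r)
    (H : ∀ χ : ℝ → ℝ, ContDiff ℝ ∞ χ → HasCompactSupport χ → tsupport χ ⊆ Set.Ioi 0 →
      ∫ r, deriv (deriv χ) r * (r * F r) = ∫ r, χ r * (κ' r * (r * F r))) :
    (∀ r, HasDerivAt (fun s => s * F s) (deriv (fun s => s * F s) r) r) ∧
    ∀ r, HasDerivAt (deriv fun s => s * F s) (κ' r * (r * F r)) r := by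
  set q : ℝ → ℝ := fun r => κ' r * (r * F r) with hq
  have hqc : Continuous q := by fun_prop
  have hqn : ∀ r, q (-r) = -q r := fun r => by simp only [hq, hFn, hκn]; ring
  let Q1 : ℝ → ℝ := fun r => ∫ s in (0 : ℝ)..r, q s
  have h1 : ∀ r, HasDerivAt Q1 (q r) r := fun r => hqc.integral_hasStrictDerivAt 0 r |>.hasDerivAt
  have c1 : Continuous Q1 := continuous_iff_continuousAt.2 fun r => (h1 r).continuousAt
  let Q2 : ℝ → ℝ := fun r => ∫ s in (0 : ℝ)..r, Q1 s
  have h2 : ∀ r, HasDerivAt Q2 (Q1 r) r := fun r => c1.integral_hasStrictDerivAt 0 r |>.hasDerivAt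
  have c2 : Continuous Q2 := continuous_iff_continuousAt.2 fun r => (h2 r).continuousAt
  have hQ1n : ∀ r, Q1 (-r) = Q1 r := fun r => by
    have := intervalIntegral.integral_comp_neg (a := 0) (b := r) q
    simp only [hqn, neg_zero, intervalIntegral.integral_neg] at this
    rw [intervalIntegral.integral_symm 0 (-r)] at this
    simp only [Q1]
    linarith
  have hQ2n : ∀ r, Q2 (-r) = -Q2 r := fun r => by
    have := intervalIntegral.integral_comp_neg (a := 0) (b := r) Q1
    simp only [hQ1n, neg_zero] at this
    rw [intervalIntegral.integral_symm 0 (-r)] at this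
    simp only [Q2]
    linarith
  set h : ℝ → ℝ := fun r => r * F r - Q2 r with hh
  have hc : Continuous h := by fun_prop
  have haff := fun x hx => affine_of_integral_deriv2_mul_eq_zero hc (fun χ a b c => by
    have e1 := H χ a b c
    have e2 := integral_deriv2_mul_primitive a b hqc h1 h2
    have hχ'' : Continuous (deriv (deriv χ)) :=
      (contDiff_infty_iff_deriv.1 a).2.continuous_deriv (by simp)
    have i1 : Integrable fun r => deriv (deriv χ) r * (r * F r) :=
      (hχ''.mul (by fun_prop)).integrable_of_hasCompactSupport b.deriv.deriv.mul_right
    have i2 : Integrable fun r => deriv (deriv χ) r * Q2 r :=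
      (hχ''.mul (by fun_prop)).integrable_of_hasCompactSupport b.deriv.deriv.mul_right
    simp only [hh, mul_sub]
    rw [integral_sub i1 i2, e1, e2, sub_self]) (x := x) hx
  have h0 : h 0 = 0 := by simp [hh, Q2]
  have hlin : ∀ x, 0 < x → h x = h 1 * x := by
    have hlim : Filter.Tendsto h (nhdsWithin 0 (Set.Ioi 0)) (nhds 0) := by
      have := hc.tendsto 0
      rw [h0] at this
      exact this.mono_left nhdsWithin_le_nhds
    have hlim2 : Filter.Tendsto (fun x : ℝ => h 1 + (h 2 - h 1) * (x - 1))
        (nhdsWithin 0 (Set.Ioi 0)) (nhds (h 1 + (h 2 - h 1) * (0 - 1))) :=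
      ((by fun_prop : Continuous fun x : ℝ => h 1 + (h 2 - h 1) * (x - 1)).tendsto 0).mono_left
        nhdsWithin_le_nhds
    have e := tendsto_nhds_unique_of_eventuallyEq hlim hlim2
      (Filter.eventually_of_mem self_mem_nhdsWithin fun x hx => haff x hx)
    intro x hx
    rw [haff x hx]
    linear_combination (x - 1) * e
  have hlin' : ∀ x, h x = h 1 * x := fun x => by
    rcases lt_trichotomy x 0 with hx | hx | hx
    · have e := hlin (-x) (neg_pos.2 hx)
      simp only [hh, hFn, hQ2n] at e ⊢
      linarith
    · rw [hx, h0, mul_zero]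
    · exact hlin x hx
  have hg : (fun s => s * F s) = fun s => h 1 * s + Q2 s := by
    funext s
    have := hlin' s
    simp only [hh] at this ⊢
    linarith
  have hd : ∀ r, HasDerivAt (fun s => s * F s) (h 1 + Q1 r) r := fun r => by
    rw [hg]
    simpa using ((hasDerivAt_id' r).const_mul (h 1)).fun_add (h2 r)
  have hd' : deriv (fun s => s * F s) = fun r => h 1 + Q1 r := funext fun r => (hd r).deriv
  refine ⟨fun r => by rw [hd']; exact hd r, fun r => ?_⟩
  rw [hd']
  exact (h1 r).const_add _

theorem IsPekarMinimizer.exists_pekarProfile {ψ : SchwartzMap E3 ℂ} (hψ : IsPekarMinimizer ψ)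
    (hrad : ∀ x y : E3, ‖x‖ = ‖y‖ → ‖ψ x‖ = ‖ψ y‖) : ∃ κ, PekarProfile (profile ψ) κ 1 := by
  set F := profile ψ with hFdef
  have hF : Continuous F := continuous_profile ψ
  have hmass : 4 * π * ∫ r in Set.Ioi 0, (r * F r) ^ 2 = 1 := by
    have := hψ.norm_eq
    simp only [norm_eq_profile hrad] at this
    rw [integral_radial fun r => profile ψ r ^ 2] at this
    simpa only [mul_pow] using this
  have h_int : IntegrableOn (fun t => t ^ 2 * F t ^ 2) (Set.Ioi 0) := by
    rw [← integrable_radial (f := fun t => F t ^ 2)]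
    simpa only [norm_eq_profile hrad] using (coulombAdmissible_norm_sq ψ).integrable
  set κ := 8 * π * (∫ t in Set.Ioi 0, t * F t ^ 2) +
    (2 * pekarF ψ - ∫ x, ‖fderiv ℝ ψ x‖ ^ 2) with hκ
  have hW := continuous_fieldDrop hF
  obtain ⟨hd, hdd⟩ := eq_linear_add_primitive (κ' := fun r => fieldDrop F r - κ) hF
    (by fun_prop) (profile_neg hrad) (fun r => by rw [fieldDrop_neg (profile_neg hrad)])
    fun χ a b c => by
      have e := hψ.weak_eq hrad a b c
      have hz : ∀ r, r ∉ Set.Ioi (0 : ℝ) → χ r * ((fieldDrop F r - κ) * (r * F r)) = 0 :=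
        fun r hr => by
          rw [image_eq_zero_of_notMem_tsupport fun h => hr (c h), zero_mul]
      rw [← setIntegral_eq_integral_of_forall_compl_eq_zero hz]
      have i1 : Integrable fun r => r * F r * χ r :=
        (Continuous.mul (by fun_prop) a.continuous).integrable_of_hasCompactSupport b.mul_left
      have i2 : Integrable fun r => r * F r * χ r * fieldDrop F r :=
        ((Continuous.mul (by fun_prop) a.continuous).mul hW).integrable_of_hasCompactSupport
          b.mul_left.mul_right
      have e2 : 2 * ∫ r in Set.Ioi 0, r * F r * χ r * newtonPotential (fun t => F t ^ 2) r =
          8 * π * (∫ t in Set.Ioi 0, t * F t ^ 2) * (∫ r in Set.Ioi 0, r * F r * χ r) -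
            ∫ r in Set.Ioi 0, r * F r * χ r * fieldDrop F r := by
        rw [← integral_const_mul, ← integral_const_mul,
          ← integral_sub (i1.integrableOn.const_mul _) i2.integrableOn]
        refine setIntegral_congr_fun measurableSet_Ioi fun r hr => ?_
        have := two_mul_newtonPotential hF h_int hr
        linear_combination (r * F r * χ r) * this
      have e3 : ∫ r in Set.Ioi 0, χ r * ((fieldDrop F r - κ) * (r * F r)) =
          (∫ r in Set.Ioi 0, r * F r * χ r * fieldDrop F r) -
            κ * ∫ r in Set.Ioi 0, r * F r * χ r := by
        rw [← integral_const_mul, ← integral_sub i2.integrableOn (i1.integrableOn.const_mul _)]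
        refine setIntegral_congr_fun measurableSet_Ioi fun r hr => ?_
        ring
      rw [e3, hκ]
      linarith
  obtain ⟨C, -, hC⟩ := ψ.decay 0 0
  obtain ⟨D, -, hD⟩ := ψ.decay 2 0
  refine ⟨κ, hF, profile_nonneg ψ, ⟨C + D, fun r => ?_⟩, hmass, hd, hdd⟩
  have h1 := hC (EuclideanSpace.single 0 r)
  have h2 := hD (EuclideanSpace.single 0 r)
  simp only [pow_zero, one_mul, norm_iteratedFDeriv_zero, PiLp.norm_single,
    Real.norm_eq_abs, sq_abs] at h1 h2
  have : (1 + r ^ 2) * F r = F r + r ^ 2 * F r := by ring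
  rw [this]
  exact add_le_add h1 h2

theorem fieldDrop_mono {F₁ F₂ : ℝ → ℝ} (h1 : Continuous F₁) (h2 : Continuous F₂)
    (hn : ∀ r, 0 ≤ F₂ r) {r : ℝ} (hr : 0 ≤ r) (hle : ∀ t, 0 ≤ t → t ≤ r → F₂ t ≤ F₁ t) :
    fieldDrop F₂ r ≤ fieldDrop F₁ r := by
  unfold fieldDrop
  have : ∫ s in (0 : ℝ)..1, (s - s ^ 2) * F₂ (r * s) ^ 2 ≤
      ∫ s in (0 : ℝ)..1, (s - s ^ 2) * F₁ (r * s) ^ 2 := by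
    refine intervalIntegral.integral_mono_on zero_le_one
      (Continuous.intervalIntegrable (by fun_prop) _ _)
      (Continuous.intervalIntegrable (by fun_prop) _ _) fun s hs => ?_
    have : F₂ (r * s) ≤ F₁ (r * s) := hle _ (mul_nonneg hr hs.1) (by nlinarith [hs.2])
    have hs2 : 0 ≤ s - s ^ 2 := by nlinarith [hs.1, hs.2]
    have := pow_le_pow_left₀ (hn (r * s)) this 2
    gcongr
  gcongr

theorem fieldDrop_lt {F₁ F₂ : ℝ → ℝ} (h1 : Continuous F₁) (h2 : Continuous F₂)
    (hn : ∀ r, 0 ≤ F₂ r) {r : ℝ} (hr : 0 < r) (hlt : ∀ t, 0 ≤ t → F₂ t < F₁ t) :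
    fieldDrop F₂ r < fieldDrop F₁ r := by
  unfold fieldDrop
  have : ∫ s in (0 : ℝ)..1, (s - s ^ 2) * F₂ (r * s) ^ 2 <
      ∫ s in (0 : ℝ)..1, (s - s ^ 2) * F₁ (r * s) ^ 2 := by
    refine intervalIntegral.integral_lt_integral_of_continuousOn_of_le_of_exists_lt zero_lt_one
      (by fun_prop) (by fun_prop) (fun s hs => ?_) ⟨1 / 2, by constructor <;> norm_num, ?_⟩
    · have := (hlt (r * s) (mul_nonneg hr.le hs.1.le)).le
      have hs2 : 0 ≤ s - s ^ 2 := by nlinarith [hs.1, hs.2]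
      have := pow_le_pow_left₀ (hn (r * s)) this 2
      gcongr
    · have := hlt (r * (1 / 2)) (by positivity)
      have := pow_lt_pow_left₀ this (hn _) two_ne_zero
      have h4 : (0 : ℝ) < 1 / 2 - (1 / 2) ^ 2 := by norm_num
      gcongr
  gcongr

theorem fieldDrop_nonneg (F : ℝ → ℝ) (r : ℝ) : 0 ≤ fieldDrop F r := by
  have : 0 ≤ ∫ s in (0 : ℝ)..1, (s - s ^ 2) * F (r * s) ^ 2 :=
    intervalIntegral.integral_nonneg zero_le_one fun s hs =>
      mul_nonneg (by nlinarith [hs.1, hs.2]) (sq_nonneg _)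
  unfold fieldDrop
  positivity

theorem fieldDrop_le {F : ℝ → ℝ} (hF : Continuous F) (hn : ∀ r, 0 ≤ F r) {C : ℝ}
    (hC : ∀ r, (1 + r ^ 2) * F r ≤ C) (r : ℝ) : fieldDrop F r ≤ 8 * π * C ^ 2 := by
  have hC0 : 0 ≤ C := (mul_nonneg (by positivity) (hn 0)).trans (hC 0)
  unfold fieldDrop
  have h1 : ∀ s ∈ Set.Icc (0 : ℝ) 1, (s - s ^ 2) * (r ^ 2 * F (r * s) ^ 2) ≤
      C ^ 2 * (r ^ 2 * s / (1 + r ^ 2 * s ^ 2) ^ 2) := fun s hs => by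
    have e1 : F (r * s) ≤ C / (1 + r ^ 2 * s ^ 2) := by
      rw [le_div_iff₀ (by positivity), mul_comm]
      have := hC (r * s)
      rwa [mul_pow] at this
    have e2 := pow_le_pow_left₀ (hn (r * s)) e1 2
    have hs2 : 0 ≤ s - s ^ 2 := by nlinarith [hs.1, hs.2]
    calc (s - s ^ 2) * (r ^ 2 * F (r * s) ^ 2)
        ≤ s * (r ^ 2 * (C / (1 + r ^ 2 * s ^ 2)) ^ 2) := by
          have := hs.1
          gcongr
          nlinarith
      _ = _ := by rw [div_pow]; ring
  have hcont : Continuous fun s : ℝ => r ^ 2 * s / (1 + r ^ 2 * s ^ 2) ^ 2 :=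
    Continuous.div (by fun_prop) (by fun_prop) fun s => by positivity
  have h2 := intervalIntegral.integral_mono_on (μ := volume) zero_le_one
    (Continuous.intervalIntegrable (by fun_prop) _ _)
    ((hcont.const_mul (C ^ 2)).intervalIntegrable _ _) h1
  have h3 : ∫ s in (0 : ℝ)..1, r ^ 2 * s / (1 + r ^ 2 * s ^ 2) ^ 2 =
      -(1 / (2 * (1 + r ^ 2 * 1 ^ 2))) - -(1 / (2 * (1 + r ^ 2 * 0 ^ 2))) := by
    refine intervalIntegral.integral_eq_sub_of_hasDerivAt
      (f := fun s => -(1 / (2 * (1 + r ^ 2 * s ^ 2)))) (fun s _ => ?_)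
      (hcont.intervalIntegrable _ _)
    have hne : 2 * (1 + r ^ 2 * s ^ 2) ≠ 0 := by positivity
    have := ((((((hasDerivAt_id' s).fun_pow 2).const_mul (r ^ 2)).const_add 1).const_mul 2).fun_inv
      hne).neg
    simp only [one_div]
    refine this.congr_deriv ?_
    field_simp
    push_cast
    ring
  rw [intervalIntegral.integral_const_mul, h3] at h2
  have h4 : ∫ s in (0 : ℝ)..1, (s - s ^ 2) * (r ^ 2 * F (r * s) ^ 2) =
      r ^ 2 * ∫ s in (0 : ℝ)..1, (s - s ^ 2) * F (r * s) ^ 2 := by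
    rw [← intervalIntegral.integral_const_mul]
    congr 1
    funext s
    ring
  rw [h4] at h2
  have h5 : 0 ≤ 1 / (2 * (1 + r ^ 2 * 1 ^ 2)) := by positivity
  have h6 : C ^ 2 * (-(1 / (2 * (1 + r ^ 2 * 1 ^ 2))) - -(1 / (2 * (1 + r ^ 2 * 0 ^ 2)))) ≤
      C ^ 2 * 1 := by
    gcongr
    have e0 : 1 / (2 * (1 + r ^ 2 * 0 ^ 2)) = (1 : ℝ) / 2 := by norm_num
    rw [e0]
    linarith
  have := h2.trans h6
  rw [mul_one] at this
  gcongr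

namespace PekarProfile

variable {F : ℝ → ℝ} {κ m : ℝ}

theorem exists_abs_le (h : PekarProfile F κ m) :
    ∃ M, ∀ r, |r * F r| ≤ M ∧ |r| * |r * F r| ≤ M ∧ F r ≤ M ∧ |deriv (fun s => s * F s) r| ≤ M ∧
      |fieldDrop F r - κ| ≤ M := by
  obtain ⟨C, hC⟩ := h.decay
  have hC0 : 0 ≤ C := (mul_nonneg (by positivity) (h.nonneg 0)).trans (hC 0)
  have hg : ∀ r, |r * F r| ≤ C := fun r => by
    rw [abs_mul, abs_of_nonneg (h.nonneg r)]
    refine le_trans ?_ (hC r)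
    have := h.nonneg r
    gcongr
    nlinarith [sq_nonneg (|r| - 1), sq_abs r]
  have hg2 : ∀ r, |r| * |r * F r| ≤ C := fun r => by
    rw [abs_mul, abs_of_nonneg (h.nonneg r), ← mul_assoc, abs_mul_abs_self]
    refine le_trans ?_ (hC r)
    have := h.nonneg r
    gcongr
    nlinarith
  have hF : ∀ r, F r ≤ C := fun r => le_trans (by nlinarith [h.nonneg r, sq_nonneg r]) (hC r)
  set K := 8 * π * C ^ 2 + |κ| with hK
  have hK0 : 0 ≤ K := by positivity
  have hV : ∀ r, |fieldDrop F r - κ| ≤ K := fun r => by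
    refine (abs_sub _ _).trans ?_
    rw [abs_of_nonneg (fieldDrop_nonneg F r)]
    have := fieldDrop_le h.continuous h.nonneg hC r
    linarith
  have hdd : ∀ r, |(fieldDrop F r - κ) * (r * F r)| ≤ K * C := fun r => by
    rw [abs_mul]
    exact mul_le_mul (hV r) (hg r) (abs_nonneg _) hK0
  have hd : ∀ r, |deriv (fun s => s * F s) r| ≤ 2 * C + K * C := fun r => by
    obtain ⟨ξ, hξ, e⟩ := exists_hasDerivAt_eq_slope (fun s => s * F s) _ (lt_add_one r)
      (fun x _ => (h.hasDerivAt x).continuousAt.continuousWithinAt) fun x _ => h.hasDerivAt x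
    have e2 := Convex.norm_image_sub_le_of_norm_hasDerivWithin_le (s := Set.univ) (x := ξ) (y := r)
      (fun x _ => (h.hasDerivAt_deriv x).hasDerivWithinAt) (fun x _ => hdd x) convex_univ
      trivial trivial
    have e3 : ‖r - ξ‖ ≤ 1 := by
      rw [Real.norm_eq_abs, abs_le]
      constructor <;> linarith [hξ.1, hξ.2]
    have e4 : |deriv (fun s => s * F s) r - deriv (fun s => s * F s) ξ| ≤ K * C :=
      e2.trans (mul_le_of_le_one_right (by positivity) e3)
    have e5 : |deriv (fun s => s * F s) ξ| ≤ 2 * C := by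
      rw [e]
      have : r + 1 - r = 1 := by ring
      rw [this, div_one]
      refine (abs_sub _ _).trans ?_
      linarith [hg (r + 1), hg r]
    have := abs_sub_abs_le_abs_sub (deriv (fun s => s * F s) r) (deriv (fun s => s * F s) ξ)
    linarith
  have hKC : 0 ≤ K * C := by positivity
  refine ⟨2 * C + K * C + K, fun r => ⟨?_, ?_, ?_, ?_, ?_⟩⟩
  · linarith [hg r]
  · linarith [hg2 r]
  · linarith [hF r]
  · linarith [hd r]
  · linarith [hV r]

theorem deriv_zero (h : PekarProfile F κ m) : deriv (fun s => s * F s) 0 = F 0 := by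
  have h1 : HasDerivAt (fun s => s * F s) (F 0) 0 := by
    rw [hasDerivAt_iff_tendsto_slope]
    refine (h.continuous.tendsto 0 |>.mono_left nhdsWithin_le_nhds).congr' ?_
    filter_upwards [self_mem_nhdsWithin] with r hr
    have : r ≠ 0 := hr
    simp [slope_def_field]
    field_simp
  exact h1.deriv

theorem pos (h : PekarProfile F κ m) (hm : 0 < m) {r : ℝ} (hr : 0 ≤ r) : 0 < F r := by
  by_contra hcon
  have hF0 : F r = 0 := le_antisymm (not_lt.1 hcon) (h.nonneg r)
  have hd0 : deriv (fun s => s * F s) r = 0 := by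
    rcases hr.eq_or_lt with h0 | hpos
    · subst h0
      rw [h.deriv_zero, hF0]
    · refine IsLocalMin.hasDerivAt_eq_zero (f := fun s => s * F s) ?_ (h.hasDerivAt r)
      filter_upwards [lt_mem_nhds hpos] with s hs
      simp only [hF0, mul_zero]
      exact mul_nonneg hs.le (h.nonneg s)
  obtain ⟨M, hM⟩ := h.exists_abs_le
  have hM0 : 0 ≤ M := (abs_nonneg _).trans (hM 0).1
  have hz : (fun t => (t * F t, deriv (fun s => s * F s) t)) = fun _ => ((0 : ℝ), (0 : ℝ)) := by
    refine ODE_solution_unique_univ (t₀ := r) (s := fun _ => Set.univ)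
      (v := fun t (p : ℝ × ℝ) => (p.2, (fieldDrop F t - κ) * p.1)) (K := Real.toNNReal (1 + M))
      (fun t => ?_) (fun t => ⟨(h.hasDerivAt t).prodMk (h.hasDerivAt_deriv t), trivial⟩)
      (fun t => ⟨(hasDerivAt_const t ((0 : ℝ), (0 : ℝ))).congr_deriv (by simp [Prod.ext_iff]),
        trivial⟩) ?_
    · refine LipschitzOnWith.of_dist_le_mul fun p _ q _ => ?_
      rw [Real.coe_toNNReal _ (by positivity), Prod.dist_eq, Real.dist_eq, Real.dist_eq,
        ← mul_sub, abs_mul]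
      have e1 : |p.1 - q.1| ≤ dist p q := by
        rw [Prod.dist_eq]; exact le_max_left _ _
      have e2 : |p.2 - q.2| ≤ dist p q := by
        rw [Prod.dist_eq]; exact le_max_right _ _
      refine max_le ?_ ?_
      · nlinarith [dist_nonneg (x := p) (y := q)]
      · have := mul_le_mul (hM t).2.2.2.2 e1 (abs_nonneg _) hM0
        nlinarith [dist_nonneg (x := p) (y := q)]
    · simp [hF0, hd0]
  have hz' : ∀ t, t * F t = 0 := fun t => congrArg Prod.fst (congrFun hz t)
  have := h.mass
  simp only [hz'] at this
  simp at this
  exact hm.ne this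

theorem kappa_pos (h : PekarProfile F κ m) (hm : 0 < m) : 0 < κ := by
  by_contra hcon
  obtain ⟨M, hM⟩ := h.exists_abs_le
  have hF0 := h.pos hm le_rfl
  have h1 : MonotoneOn (deriv fun s => s * F s) (Set.Ici 0) := by
    refine monotoneOn_of_hasDerivWithinAt_nonneg (convex_Ici 0)
      (fun x _ => (h.hasDerivAt_deriv x).continuousAt.continuousWithinAt)
      (fun x _ => (h.hasDerivAt_deriv x).hasDerivWithinAt) fun x hx => ?_
    rw [interior_Ici] at hx
    have := fieldDrop_nonneg F x
    have h2 := h.nonneg x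
    have h3 : 0 ≤ fieldDrop F x - κ := by linarith
    have h4 : 0 ≤ x := le_of_lt hx
    positivity
  have h2 : MonotoneOn (fun s => s * F s - F 0 * s) (Set.Ici 0) := by
    have hd : ∀ x, HasDerivAt (fun s => s * F s - F 0 * s)
        (deriv (fun s => s * F s) x - F 0) x := fun x => by
      simpa using (h.hasDerivAt x).fun_sub ((hasDerivAt_id' x).const_mul (F 0))
    refine monotoneOn_of_hasDerivWithinAt_nonneg (convex_Ici 0)
      (fun x _ => (hd x).continuousAt.continuousWithinAt)
      (fun x _ => (hd x).hasDerivWithinAt) fun x hx => ?_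
    rw [interior_Ici] at hx
    have := h1 (Set.self_mem_Ici) (le_of_lt hx : (0:ℝ) ≤ x) (le_of_lt hx)
    rw [h.deriv_zero] at this
    linarith
  have hR : 0 ≤ (|M| + 1) / F 0 := by positivity
  have h3 := h2 Set.self_mem_Ici hR hR
  have h4 := (le_abs_self _).trans (hM ((|M| + 1) / F 0)).1
  have h5 : F 0 * ((|M| + 1) / F 0) = |M| + 1 := by field_simp
  simp only at h3
  rw [h5] at h3
  linarith [le_abs_self M]

theorem scale (h : PekarProfile F κ m) {l : ℝ} (hl : 0 < l) :
    PekarProfile (fun r => l ^ 2 * F (l * r)) (l ^ 2 * κ) (l * m) := by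
  have hfd : ∀ r, fieldDrop (fun r => l ^ 2 * F (l * r)) r = l ^ 2 * fieldDrop F (l * r) :=
    fun r => by
      unfold fieldDrop
      have : ∫ s in (0 : ℝ)..1, (s - s ^ 2) * (l ^ 2 * F (l * (r * s))) ^ 2 =
          l ^ 4 * ∫ s in (0 : ℝ)..1, (s - s ^ 2) * F (l * r * s) ^ 2 := by
        rw [← intervalIntegral.integral_const_mul]
        congr 1
        funext s
        rw [← mul_assoc l r s]
        ring
      rw [this]
      ring
  have hlin : ∀ r, HasDerivAt (fun s => l * s) l r := fun r => by
    simpa using (hasDerivAt_id' r).const_mul l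
  have hd : ∀ r, HasDerivAt (fun s => s * (l ^ 2 * F (l * s)))
      (l ^ 2 * deriv (fun s => s * F s) (l * r)) r := fun r => by
    have e1 := ((h.hasDerivAt (l * r)).comp r (hlin r)).const_mul l
    have e2 : (fun s => s * (l ^ 2 * F (l * s))) =
        fun s => l * ((fun s => s * F s) ∘ fun s => l * s) s := by
      funext s
      simp only [Function.comp]
      ring
    rw [e2]
    exact e1.congr_deriv (by ring)
  have hd' : deriv (fun s => s * (l ^ 2 * F (l * s))) =
      fun r => l ^ 2 * deriv (fun s => s * F s) (l * r) := funext fun r => (hd r).deriv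
  refine ⟨by have := h.continuous; fun_prop, fun r => mul_nonneg (sq_nonneg _) (h.nonneg _), ?_, ?_,
    fun r => by rw [hd']; exact hd r, fun r => ?_⟩
  · obtain ⟨C, hC⟩ := h.decay
    refine ⟨(1 + l ^ 2) * C, fun r => ?_⟩
    have h1 := hC (l * r)
    have h2 := h.nonneg (l * r)
    have h3 : (1 + r ^ 2) * (l ^ 2 * F (l * r)) ≤
        (1 + l ^ 2) * ((1 + (l * r) ^ 2) * F (l * r)) := by
      have : (1 + r ^ 2) * l ^ 2 ≤ (1 + l ^ 2) * (1 + (l * r) ^ 2) := by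
        have := sq_nonneg (l ^ 2 * r)
        nlinarith
      calc _ = (1 + r ^ 2) * l ^ 2 * F (l * r) := by ring
        _ ≤ (1 + l ^ 2) * (1 + (l * r) ^ 2) * F (l * r) := by gcongr
        _ = _ := by ring
    refine h3.trans ?_
    gcongr
  · have e := integral_comp_mul_left_Ioi (fun r => (r * F r) ^ 2) 0 hl
    have e2 : (fun r => (r * (l ^ 2 * F (l * r))) ^ 2) =
        fun r => l ^ 2 * (l * r * F (l * r)) ^ 2 := by
      funext r; ring
    rw [e2, integral_const_mul, e, mul_zero, ← h.mass, smul_eq_mul]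
    field_simp
  · rw [hd', hfd]
    refine (((h.hasDerivAt_deriv (l * r)).comp r (hlin r)).const_mul (l ^ 2)).congr_deriv ?_
    ring

end PekarProfile

namespace PekarProfile

variable {F₁ F₂ : ℝ → ℝ} {κ m₁ m₂ : ℝ}

/-- The Wronskian of `r F₁(r)` and `r F₂(r)`. -/
def wronskian (F₁ F₂ : ℝ → ℝ) (r : ℝ) : ℝ :=
  deriv (fun s => s * F₁ s) r * (r * F₂ r) - r * F₁ r * deriv (fun s => s * F₂ s) r

theorem hasDerivAt_wronskian (h1 : PekarProfile F₁ κ m₁) (h2 : PekarProfile F₂ κ m₂) (r : ℝ) :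
    HasDerivAt (wronskian F₁ F₂)
      ((fieldDrop F₁ r - fieldDrop F₂ r) * (r * F₁ r * (r * F₂ r))) r := by
  refine (((h1.hasDerivAt_deriv r).mul (h2.hasDerivAt r)).sub
    ((h1.hasDerivAt r).mul (h2.hasDerivAt_deriv r))).congr_deriv ?_
  ring

theorem wronskian_zero : wronskian F₁ F₂ 0 = 0 := by simp [wronskian]

theorem wronskian_monotoneOn (h1 : PekarProfile F₁ κ m₁) (h2 : PekarProfile F₂ κ m₂) {R : ℝ}
    (hle : ∀ t, 0 ≤ t → t ≤ R → F₂ t ≤ F₁ t) : MonotoneOn (wronskian F₁ F₂) (Set.Icc 0 R) := by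
  refine monotoneOn_of_hasDerivWithinAt_nonneg (convex_Icc 0 R)
    (fun x _ => (h1.hasDerivAt_wronskian h2 x).continuousAt.continuousWithinAt)
    (fun x _ => (h1.hasDerivAt_wronskian h2 x).hasDerivWithinAt) fun x hx => ?_
  rw [interior_Icc] at hx
  have e := fieldDrop_mono h1.continuous h2.continuous h2.nonneg hx.1.le
    fun t ht htx => hle t ht (htx.trans hx.2.le)
  have := h1.nonneg x
  have := h2.nonneg x
  have := hx.1
  have e' := sub_nonneg.2 e
  positivity

theorem div_zero_le (h1 : PekarProfile F₁ κ m₁) (h2 : PekarProfile F₂ κ m₂) (hm₂ : 0 < m₂) {R : ℝ}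
    (hR : 0 ≤ R) (hle : ∀ t, 0 ≤ t → t ≤ R → F₂ t ≤ F₁ t) :
    F₁ 0 / F₂ 0 ≤ F₁ R / F₂ R := by
  have hmono : MonotoneOn (fun r => F₁ r / F₂ r) (Set.Icc 0 R) := by
    refine monotoneOn_of_hasDerivWithinAt_nonneg (f' := fun r => wronskian F₁ F₂ r / (r * F₂ r) ^ 2)
      (convex_Icc 0 R) (h1.continuous.continuousOn.div h2.continuous.continuousOn
        fun x hx => (h2.pos hm₂ hx.1).ne') (fun x hx => ?_) fun x hx => ?_
    · rw [interior_Icc] at hx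
      have hne : x * F₂ x ≠ 0 := (mul_pos hx.1 (h2.pos hm₂ hx.1.le)).ne'
      refine HasDerivAt.hasDerivWithinAt ?_
      refine ((h1.hasDerivAt x).fun_div (h2.hasDerivAt x) hne).congr_of_eventuallyEq ?_
      filter_upwards [lt_mem_nhds hx.1] with s hs
      rw [mul_div_mul_left _ _ hs.ne']
    · rw [interior_Icc] at hx
      have := h1.wronskian_monotoneOn h2 hle ⟨le_rfl, hR⟩ ⟨hx.1.le, hx.2.le⟩ hx.1.le
      rw [wronskian_zero] at this
      positivity
  exact hmono ⟨le_rfl, hR⟩ ⟨hR, le_rfl⟩ hR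

theorem lt_of_zero_lt (h1 : PekarProfile F₁ κ m₁) (h2 : PekarProfile F₂ κ m₂) (hm₂ : 0 < m₂)
    (h0 : F₂ 0 < F₁ 0) {t : ℝ} (ht : 0 ≤ t) : F₂ t < F₁ t := by
  by_contra hcon
  set A := {r : ℝ | 0 ≤ r ∧ F₁ r ≤ F₂ r}
  have hcl : IsClosed A := (isClosed_le continuous_const continuous_id).inter
    (isClosed_le h1.continuous h2.continuous)
  have hbd : BddBelow A := ⟨0, fun r hr => hr.1⟩
  have hmem : sInf A ∈ A := hcl.csInf_mem ⟨t, ht, not_lt.1 hcon⟩ hbd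
  have hlt : ∀ s, 0 ≤ s → s < sInf A → F₂ s < F₁ s := fun s hs hsA => by
    by_contra hc
    exact (csInf_le hbd ⟨hs, not_lt.1 hc⟩).not_gt hsA
  have hle : ∀ s, 0 ≤ s → s ≤ sInf A → F₂ s ≤ F₁ s := by
    intro s hs hsA
    have hpos : 0 < sInf A := lt_of_le_of_ne hmem.1 fun hc => by
      have := hmem.2
      rw [← hc] at this
      exact this.not_gt h0
    have hsub : Set.Icc 0 (sInf A) ⊆ {r | F₂ r ≤ F₁ r} := by
      rw [← closure_Ico hpos.ne]
      exact closure_minimal (fun r hr => (hlt r hr.1 hr.2).le)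
        (isClosed_le h2.continuous h1.continuous)
    exact hsub ⟨hs, hsA⟩
  have h := h1.div_zero_le h2 hm₂ hmem.1 hle
  have e1 : 1 < F₁ 0 / F₂ 0 := (one_lt_div (h2.pos hm₂ le_rfl)).2 h0
  have e2 : F₁ (sInf A) / F₂ (sInf A) ≤ 1 := (div_le_one (h2.pos hm₂ hmem.1)).2 hmem.2
  linarith

theorem zero_le_zero (h1 : PekarProfile F₁ κ m₁) (h2 : PekarProfile F₂ κ m₂) (hm₂ : 0 < m₂) :
    F₁ 0 ≤ F₂ 0 := by
  by_contra h0
  have hlt : ∀ t, 0 ≤ t → F₂ t < F₁ t := fun t ht => h1.lt_of_zero_lt h2 hm₂ (not_le.1 h0) ht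
  have hstrict : StrictMonoOn (wronskian F₁ F₂) (Set.Ici 0) := by
    refine strictMonoOn_of_hasDerivWithinAt_pos (convex_Ici 0)
      (fun x _ => (h1.hasDerivAt_wronskian h2 x).continuousAt.continuousWithinAt)
      (fun x _ => (h1.hasDerivAt_wronskian h2 x).hasDerivWithinAt) fun x hx => ?_
    rw [interior_Ici] at hx
    have hx0 : 0 < x := hx
    have e := sub_pos.2 (fieldDrop_lt h1.continuous h2.continuous h2.nonneg hx0 hlt)
    have e2 := h2.pos hm₂ hx0.le
    have e1 := e2.trans (hlt x hx0.le)
    positivity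
  have hw : 0 < wronskian F₁ F₂ 1 := by
    rw [← wronskian_zero (F₁ := F₁) (F₂ := F₂)]
    exact hstrict Set.self_mem_Ici (Set.mem_Ici.2 zero_le_one) zero_lt_one
  obtain ⟨M, hM⟩ := h1.exists_abs_le
  obtain ⟨N, hN⟩ := h2.exists_abs_le
  have hM0 : 0 ≤ M := (abs_nonneg _).trans (hM 0).1
  have hN0 : 0 ≤ N := (abs_nonneg _).trans (hN 0).1
  set R := 1 + 2 * (M * N) / wronskian F₁ F₂ 1 with hRdef
  have hR1 : 1 ≤ R := by
    have : 0 ≤ 2 * (M * N) / wronskian F₁ F₂ 1 := by positivity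
    linarith
  have hR0 : 0 ≤ R := by linarith
  have e1 : wronskian F₁ F₂ 1 ≤ wronskian F₁ F₂ R :=
    hstrict.monotoneOn (Set.mem_Ici.2 zero_le_one) (Set.mem_Ici.2 hR0) hR1
  have e2 : R * wronskian F₁ F₂ R ≤ 2 * (M * N) := by
    have a1 : |deriv (fun s => s * F₁ s) R * (R * |R * F₂ R|)| ≤ M * N := by
      rw [abs_mul]
      have := (hN R).2.1
      rw [abs_of_nonneg hR0] at this
      refine mul_le_mul (hM R).2.2.2.1 ?_ (abs_nonneg _) hM0
      rwa [abs_of_nonneg (by positivity)]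
    have a2 : |R * |R * F₁ R| * deriv (fun s => s * F₂ s) R| ≤ M * N := by
      rw [abs_mul]
      have := (hM R).2.1
      rw [abs_of_nonneg hR0] at this
      refine mul_le_mul ?_ (hN R).2.2.2.1 (abs_nonneg _) hM0
      rwa [abs_of_nonneg (by positivity)]
    rw [abs_of_nonneg (mul_nonneg hR0 (h2.nonneg R))] at a1
    rw [abs_of_nonneg (mul_nonneg hR0 (h1.nonneg R))] at a2
    have := (abs_le.1 a1).2
    have := (abs_le.1 a2).1
    unfold wronskian
    linarith
  have e3 : R * wronskian F₁ F₂ 1 = wronskian F₁ F₂ 1 + 2 * (M * N) := by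
    rw [hRdef]; field_simp
  have e4 := mul_le_mul_of_nonneg_left e1 hR0
  linarith

theorem abs_fieldDrop_sub_le (h1 : Continuous F₁) (h2 : Continuous F₂) (hn1 : ∀ r, 0 ≤ F₁ r)
    (hn2 : ∀ r, 0 ≤ F₂ r) {M : ℝ} (hM : ∀ r, F₁ r + F₂ r ≤ M) {r : ℝ} (hr : 0 ≤ r) :
    |fieldDrop F₁ r - fieldDrop F₂ r| ≤ 8 * π * M * ∫ t in (0 : ℝ)..r, |t * F₁ t - t * F₂ t| := by
  rcases hr.eq_or_lt with rfl | hpos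
  · simp [fieldDrop]
  have hc : ∀ {F : ℝ → ℝ}, Continuous F →
      IntervalIntegrable (fun t => (t - t ^ 2 / r) * F t ^ 2) volume 0 r := fun {F} hF =>
    Continuous.intervalIntegrable (by fun_prop) _ _
  rw [fieldDrop_eq hpos.ne', fieldDrop_eq hpos.ne', ← mul_sub,
    ← intervalIntegral.integral_sub (hc h1) (hc h2), abs_mul,
    abs_of_pos (by positivity : 0 < 8 * π), mul_assoc (8 * π) M,
    ← intervalIntegral.integral_const_mul]
  refine mul_le_mul_of_nonneg_left ?_ (by positivity)
  refine (intervalIntegral.abs_integral_le_integral_abs hr).trans ?_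
  refine intervalIntegral.integral_mono_on hr
    (Continuous.intervalIntegrable (by fun_prop) _ _)
    (Continuous.intervalIntegrable (by fun_prop) _ _) fun t ht => ?_
  have e : (t - t ^ 2 / r) * F₁ t ^ 2 - (t - t ^ 2 / r) * F₂ t ^ 2 =
      (1 - t / r) * ((F₁ t + F₂ t) * (t * F₁ t - t * F₂ t)) := by
    field_simp; ring
  have hq : 0 ≤ t / r := div_nonneg ht.1 hr
  have hq1 : t / r ≤ 1 := (div_le_one hpos).2 ht.2
  have := hn1 t
  have := hn2 t
  rw [e, abs_mul, abs_mul, abs_of_nonneg (by linarith : 0 ≤ 1 - t / r),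
    abs_of_nonneg (by positivity : 0 ≤ F₁ t + F₂ t)]
  have hp : 0 ≤ (F₁ t + F₂ t) * |t * F₁ t - t * F₂ t| := by positivity
  refine (mul_le_of_le_one_left hp (by linarith)).trans ?_
  exact mul_le_mul_of_nonneg_right (hM t) (abs_nonneg _)

theorem eq_of_zero_eq (h1 : PekarProfile F₁ κ m₁) (h2 : PekarProfile F₂ κ m₂)
    (h0 : F₁ 0 = F₂ 0) {r : ℝ} (hr : 0 ≤ r) : F₁ r = F₂ r := by
  obtain ⟨M, hM⟩ := h1.exists_abs_le
  obtain ⟨N, hN⟩ := h2.exists_abs_le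
  have hM0 : 0 ≤ M := (abs_nonneg _).trans (hM 0).1
  have hN0 : 0 ≤ N := (abs_nonneg _).trans (hN 0).1
  have hc1 := h1.continuous
  have hc2 := h2.continuous
  set I : ℝ → ℝ := fun r => ∫ t in (0 : ℝ)..r, |t * F₁ t - t * F₂ t| with hI
  have hId : ∀ t, HasDerivAt I |t * F₁ t - t * F₂ t| t := fun t =>
    have hc : Continuous fun t => |t * F₁ t - t * F₂ t| := by fun_prop
    intervalIntegral.integral_hasDerivAt_right (hc.intervalIntegrable _ _)
      (hc.stronglyMeasurableAtFilter _ _) hc.continuousAt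
  have hd : ∀ t, HasDerivAt (fun t => ((t * F₁ t - t * F₂ t,
      deriv (fun s => s * F₁ s) t - deriv (fun s => s * F₂ s) t), I t))
      ((deriv (fun s => s * F₁ s) t - deriv (fun s => s * F₂ s) t,
        (fieldDrop F₁ t - κ) * (t * F₁ t) - (fieldDrop F₂ t - κ) * (t * F₂ t)),
        |t * F₁ t - t * F₂ t|) t := fun t =>
    (((h1.hasDerivAt t).fun_sub (h2.hasDerivAt t)).prodMk
      ((h1.hasDerivAt_deriv t).fun_sub (h2.hasDerivAt_deriv t))).prodMk (hId t)
  set K := 1 + M + 8 * π * (M + N) * N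
  have hK0 : 0 ≤ 8 * π * (M + N) * N := by positivity
  have key := eq_zero_of_abs_deriv_le_mul_abs_self_of_eq_zero_right (K := K) (a := 0) (b := r + 1)
    (fun t _ => (hd t).continuousAt.continuousWithinAt) (fun t _ => (hd t).hasDerivWithinAt)
    (by simp [h1.deriv_zero, h2.deriv_zero, h0, hI]) ?_
  · rcases hr.eq_or_lt with rfl | hpos
    · exact h0
    have := congrArg (fun p => p.1.1) (key r ⟨hr, by linarith⟩)
    simp only [Prod.fst_zero] at this
    have h3 : r * (F₁ r - F₂ r) = 0 := by rw [mul_sub]; exact this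
    have := (mul_eq_zero.1 h3).resolve_left hpos.ne'
    linarith
  · intro t ht
    set p : (ℝ × ℝ) × ℝ := ((t * F₁ t - t * F₂ t,
      deriv (fun s => s * F₁ s) t - deriv (fun s => s * F₂ s) t), I t) with hp
    have b1 : |t * F₁ t - t * F₂ t| ≤ ‖p‖ := (norm_fst_le p.1).trans (norm_fst_le p)
    have b2 : |deriv (fun s => s * F₁ s) t - deriv (fun s => s * F₂ s) t| ≤ ‖p‖ :=
      (norm_snd_le p.1).trans (norm_fst_le p)
    have b3 : I t ≤ ‖p‖ := (le_abs_self _).trans (norm_snd_le p)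
    have hp0 := norm_nonneg p
    have c1 : ‖p‖ ≤ K * ‖p‖ := le_mul_of_one_le_left hp0 (by linarith)
    refine max_le (max_le (b2.trans c1) ?_) ?_
    · have e : (fieldDrop F₁ t - κ) * (t * F₁ t) - (fieldDrop F₂ t - κ) * (t * F₂ t) =
          (fieldDrop F₁ t - κ) * (t * F₁ t - t * F₂ t) +
            (fieldDrop F₁ t - fieldDrop F₂ t) * (t * F₂ t) := by ring
      have f1 : |(fieldDrop F₁ t - κ) * (t * F₁ t - t * F₂ t)| ≤ M * ‖p‖ := by
        rw [abs_mul]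
        exact mul_le_mul (hM t).2.2.2.2 b1 (abs_nonneg _) hM0
      have f2 : |(fieldDrop F₁ t - fieldDrop F₂ t) * (t * F₂ t)| ≤
          8 * π * (M + N) * ‖p‖ * N := by
        rw [abs_mul]
        refine mul_le_mul ?_ (hN t).1 (abs_nonneg _) (by positivity)
        refine (abs_fieldDrop_sub_le hc1 hc2 h1.nonneg h2.nonneg (M := M + N)
          (fun r => add_le_add (hM r).2.2.1 (hN r).2.2.1) ht.1).trans ?_
        exact mul_le_mul_of_nonneg_left b3 (by positivity)
      show |(fieldDrop F₁ t - κ) * (t * F₁ t) - (fieldDrop F₂ t - κ) * (t * F₂ t)| ≤ _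
      rw [e]
      refine (abs_add_le _ _).trans ?_
      calc _ ≤ M * ‖p‖ + 8 * π * (M + N) * ‖p‖ * N := add_le_add f1 f2
        _ ≤ K * ‖p‖ := by simp only [K]; linarith
    · show ‖|t * F₁ t - t * F₂ t|‖ ≤ _
      rw [norm_abs_eq_norm]
      exact b1.trans c1

theorem eq_of_mass_one {κ₁ κ₂ : ℝ} (h1 : PekarProfile F₁ κ₁ 1) (h2 : PekarProfile F₂ κ₂ 1) {r : ℝ}
    (hr : 0 ≤ r) : F₁ r = F₂ r := by
  have k1 := h1.kappa_pos one_pos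
  have k2 := h2.kappa_pos one_pos
  set l := √(κ₁ / κ₂) with hl
  have hl0 : 0 < l := by positivity
  have hs := h2.scale hl0
  have hlk : l ^ 2 * κ₂ = κ₁ := by
    rw [hl, Real.sq_sqrt (by positivity)]; field_simp
  rw [hlk, mul_one] at hs
  have heq : ∀ r, 0 ≤ r → F₁ r = l ^ 2 * F₂ (l * r) := fun r hr =>
    h1.eq_of_zero_eq hs (le_antisymm (h1.zero_le_zero hs hl0) (hs.zero_le_zero h1 one_pos)) hr
  have hl1 : l = 1 := by
    rw [← hs.mass, ← h1.mass]
    congr 1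
    refine setIntegral_congr_fun measurableSet_Ioi fun r hr => ?_
    have hr0 : (0 : ℝ) ≤ r := le_of_lt hr
    simp only [heq r hr0]
  have := heq r hr
  rwa [hl1, one_pow, one_mul, one_mul] at this

end PekarProfile

theorem norm_fderiv_norm_le {X F : Type*} [NormedAddCommGroup X] [NormedSpace ℝ X]
    [NormedAddCommGroup F] [InnerProductSpace ℝ F] {b : X → F} {x : X}
    (hb : DifferentiableAt ℝ b x) (hx : b x ≠ 0) :
    ‖fderiv ℝ (fun y => ‖b y‖) x‖ ≤ ‖fderiv ℝ b x‖ := by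
  have hn : DifferentiableAt ℝ (fun y : F => ‖y‖) (b x) :=
    (contDiffAt_norm ℝ hx (n := 1)).differentiableAt (by simp)
  have h : HasFDerivAt (fun y => ‖b y‖) _ x := hn.hasFDerivAt.comp x hb.hasFDerivAt
  have h4 : ‖fderiv ℝ (fun y : F => ‖y‖) (b x)‖ ≤ 1 := by
    have := norm_fderiv_le_of_lipschitz ℝ (x₀ := b x) (lipschitzWith_one_norm (E := F))
    simpa using this
  rw [h.fderiv]
  exact (ContinuousLinearMap.opNorm_comp_le _ _).trans (mul_le_of_le_one_left (norm_nonneg _) h4)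

namespace IsPekarMinimizer

variable {ψ : SchwartzMap E3 ℂ}

theorem norm_pos (hψ : IsPekarMinimizer ψ) (hrad : ∀ x y : E3, ‖x‖ = ‖y‖ → ‖ψ x‖ = ‖ψ y‖)
    (x : E3) : 0 < ‖ψ x‖ := by
  obtain ⟨κ, h⟩ := hψ.exists_pekarProfile hrad
  rw [norm_eq_profile hrad]
  exact h.pos one_pos (norm_nonneg x)

/-- Diamagnetic equality: a nonvanishing minimizer has the gradient energy of its modulus. -/
theorem norm_fderiv_norm_eq (hψ : IsPekarMinimizer ψ) (h0 : ∀ x, ψ x ≠ 0) (x : E3) :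
    ‖fderiv ℝ (fun y => ‖ψ y‖) x‖ = ‖fderiv ℝ ψ x‖ := by
  have hψs : ContDiff ℝ ∞ ψ := ψ.smooth _
  have hf : ContDiff ℝ ∞ fun y => ‖ψ y‖ := hψs.norm ℝ h0
  have hle : ∀ y, ‖fderiv ℝ (fun y => ‖ψ y‖) y‖ ≤ ‖fderiv ℝ ψ y‖ := fun y =>
    norm_fderiv_norm_le (hψs.differentiable (by simp) y) (h0 y)
  have hsq : ∀ y, ‖fderiv ℝ (fun y => ‖ψ y‖) y‖ ^ 2 ≤ ‖fderiv ℝ ψ y‖ ^ 2 := fun y =>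
    pow_le_pow_left₀ (norm_nonneg _) (hle y) 2
  have hc1 : Continuous (fderiv ℝ fun y => ‖ψ y‖) := hf.continuous_fderiv (by simp)
  have hc2 : Continuous (fderiv ℝ ψ) := hψs.continuous_fderiv (by simp)
  have hi2 := integrable_norm_fderiv_sq ψ
  have hi1 : Integrable fun y => ‖fderiv ℝ (fun y => ‖ψ y‖) y‖ ^ 2 :=
    hi2.mono' (by fun_prop) (Filter.Eventually.of_forall fun y => by
      rw [Real.norm_eq_abs, abs_of_nonneg (sq_nonneg _)]; exact hsq y)
  have hε : ∀ n : ℕ, 0 < 1 / ((n : ℝ) + 1) := fun n => by positivity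
  have hε0 : Filter.Tendsto (fun n : ℕ => 1 / ((n : ℝ) + 1)) Filter.atTop (nhds 0) :=
    tendsto_one_div_add_atTop_nhds_zero_nat
  have hle2 : (∫ y, ‖fderiv ℝ ψ y‖ ^ 2) ≤ ∫ y, ‖fderiv ℝ (fun y => ‖ψ y‖) y‖ ^ 2 := by
    have := hψ.le_of_tendsto (u := fun n => truncNorm (1 / ((n : ℝ) + 1)) ψ)
      (h := fun x => ‖ψ x‖) (G := fun x => ‖ψ x‖)
      (τ := fun _ => ∫ y, ‖fderiv ℝ (fun y => ‖ψ y‖) y‖ ^ 2)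
      (fun n => contDiff_truncNorm (hε n) hψs) (fun n => ψ.hasCompactSupport_truncNorm (hε n))
      (coulombAdmissible_norm ψ)
      (fun n x => by
        rw [abs_of_nonneg (truncNorm_nonneg (hε n) _)]; exact truncNorm_le (hε n) _)
      (fun x => ?_) (fun n => ?_) tendsto_const_nhds
    · rw [hψ.norm_eq, pekarF_eq_sub_coulomb] at this
      linarith
    · refine tendsto_iff_dist_tendsto_zero.2 (squeeze_zero (fun _ => dist_nonneg) (fun n => ?_)
        (by rw [← mul_zero (2 : ℝ)]; exact hε0.const_mul 2))
      rw [Real.dist_eq]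
      exact abs_truncNorm_sub_le (hε n) _
    · have e : truncNorm (1 / ((n : ℝ) + 1)) ψ = truncNorm (1 / ((n : ℝ) + 1)) fun y => ‖ψ y‖ := by
        funext y
        simp only [truncNorm, norm_norm]
      rw [e]
      refine integral_mono_of_nonneg (Filter.Eventually.of_forall fun y => by positivity) hi1
        (Filter.Eventually.of_forall fun y => ?_)
      exact pow_le_pow_left₀ (norm_nonneg _) (norm_fderiv_truncNorm_le (hε n) hf y) 2
  have hzero : (∫ y, ‖fderiv ℝ ψ y‖ ^ 2 - ‖fderiv ℝ (fun y => ‖ψ y‖) y‖ ^ 2) = 0 := by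
    rw [integral_sub hi2 hi1]
    linarith [integral_mono hi1 hi2 hsq]
  have hae := (integral_eq_zero_iff_of_nonneg (fun y => sub_nonneg.2 (hsq y)) (hi2.sub hi1)).1 hzero
  have hev := (Continuous.ae_eq_iff_eq volume
    ((hc2.norm.pow 2).sub (hc1.norm.pow 2)) continuous_zero).1 hae
  have := congrFun hev x
  simp only [Pi.sub_apply, Pi.pow_apply, Pi.zero_apply] at this
  refine (pow_left_inj₀ (norm_nonneg _) (norm_nonneg _) two_ne_zero).1 ?_
  linarith

theorem exists_phase (hψ : IsPekarMinimizer ψ) (hrad : ∀ x y : E3, ‖x‖ = ‖y‖ → ‖ψ x‖ = ‖ψ y‖) :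
    ∃ w : ℂ, ‖w‖ = 1 ∧ ∀ x, ψ x = profile ψ ‖x‖ * w := by
  have hpos := hψ.norm_pos hrad
  have h0 : ∀ x, ψ x ≠ 0 := fun x => norm_pos_iff.1 (hpos x)
  have hψs : ContDiff ℝ ∞ ψ := ψ.smooth _
  have hf : ContDiff ℝ ∞ fun y => ‖ψ y‖ := hψs.norm ℝ h0
  have hU : Differentiable ℝ (profile ψ) :=
    (hf.comp contDiff_axis).differentiable (by simp)
  have hp0 : profile ψ 0 ≠ 0 := by
    have := (hpos 0).ne'
    rwa [norm_eq_profile hrad, norm_zero] at this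
  refine ⟨ψ 0 / profile ψ 0, ?_, fun x => ?_⟩
  · rw [norm_div, norm_eq_profile hrad, norm_zero, Complex.norm_real, Real.norm_eq_abs,
      abs_of_nonneg (profile_nonneg _ _), div_self hp0]
  rcases eq_or_ne x 0 with rfl | hx
  · rw [norm_zero, mul_div_cancel₀]
    exact_mod_cast hp0
  set n : E3 := ‖x‖⁻¹ • x with hn
  have hn1 : ‖n‖ = 1 := norm_smul_inv_norm (𝕜 := ℝ) hx
  have hnr : ∀ r : ℝ, 0 ≤ r → ‖r • n‖ = r := fun r hr => by
    rw [norm_smul, hn1, mul_one, Real.norm_eq_abs, abs_of_nonneg hr]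
  have hpU : ∀ r : ℝ, ‖ψ (r • n)‖ = profile ψ r := fun r => by
    refine hrad _ _ ?_
    rw [norm_smul, hn1, mul_one]
    simp
  have hUpos : ∀ r, 0 < profile ψ r := fun r => hpU r ▸ hpos _
  set p : ℝ → ℂ := fun r => ψ (r • n) with hp
  have hray : ∀ r : ℝ, HasDerivAt (fun r : ℝ => r • n) n r := fun r => by
    simpa using (hasDerivAt_id' r).smul_const n
  have hpd : ∀ r, HasDerivAt p (fderiv ℝ ψ (r • n) n) r := fun r =>
    ((hψs.differentiable (by simp) (r • n)).hasFDerivAt).comp_hasDerivAt r (hray r)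
  have hbound' : ∀ r, 0 < r → ‖fderiv ℝ ψ (r • n) n‖ ≤ |deriv (profile ψ) r| := fun r hr => by
    have e := norm_fderiv_radial hU (norm_eq_profile hrad) (x := r • n)
      (norm_pos_iff.1 (by rw [hnr r hr.le]; exact hr))
    rw [hψ.norm_fderiv_norm_eq h0, hnr r hr.le] at e
    rw [← e]
    simpa [hn1] using (fderiv ℝ ψ (r • n)).le_opNorm n
  have hbound : ∀ r, 0 ≤ r → ‖fderiv ℝ ψ (r • n) n‖ ≤ |deriv (profile ψ) r| := fun r hr => by
    have hcl : IsClosed {r : ℝ | ‖fderiv ℝ ψ (r • n) n‖ ≤ |deriv (profile ψ) r|} := by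
      have hc1 : Continuous (fderiv ℝ ψ) := hψs.continuous_fderiv (by simp)
      have hc2 : Continuous (deriv (profile ψ)) :=
        (hf.comp contDiff_axis).continuous_deriv (by simp)
      exact isClosed_le (by fun_prop) hc2.abs
    have hsub := closure_minimal (fun r (hr : r ∈ Set.Ioi (0 : ℝ)) => hbound' r hr) hcl
    rw [closure_Ioi] at hsub
    exact hsub hr
  have hquot : ∀ r, HasDerivAt (fun r => p r / (profile ψ r : ℂ))
      ((fderiv ℝ ψ (r • n) n * profile ψ r - p r * (deriv (profile ψ) r : ℝ)) /
        profile ψ r ^ 2) r :=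
    fun r => (hpd r).fun_div (hU r).hasDerivAt.ofReal_comp
      (Complex.ofReal_ne_zero.2 (hUpos r).ne')
  have hinner : ∀ r, inner ℝ (p r) (fderiv ℝ ψ (r • n) n) = profile ψ r * deriv (profile ψ) r := by
    intro r
    have h1 := (hpd r).norm_sq
    have h2 : HasDerivAt (fun r => ‖p r‖ ^ 2) (2 * profile ψ r * deriv (profile ψ) r) r := by
      simp only [hp, hpU]
      simpa using (hU r).hasDerivAt.fun_pow 2
    linarith [h1.unique h2]
  have hzero : ∀ r, 0 ≤ r →
      fderiv ℝ ψ (r • n) n * profile ψ r - p r * (deriv (profile ψ) r : ℝ) = 0 := by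
    intro r hr
    rw [← norm_eq_zero, ← sq_eq_zero_iff]
    refine le_antisymm ?_ (sq_nonneg _)
    have e1 : fderiv ℝ ψ (r • n) n * profile ψ r = profile ψ r • fderiv ℝ ψ (r • n) n := by
      rw [Complex.real_smul, mul_comm]
    have e2 : p r * (deriv (profile ψ) r : ℝ) = deriv (profile ψ) r • p r := by
      rw [Complex.real_smul, mul_comm]
    rw [e1, e2, norm_sub_sq_real, inner_smul_left, inner_smul_right, real_inner_comm, hinner,
      norm_smul, norm_smul, mul_pow, mul_pow, Real.norm_eq_abs, Real.norm_eq_abs, sq_abs, sq_abs,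
      hp, hpU]
    have := pow_le_pow_left₀ (norm_nonneg _) (hbound r hr) 2
    rw [sq_abs] at this
    simp only [conj_trivial]
    nlinarith [mul_le_mul_of_nonneg_left this (sq_nonneg (profile ψ r))]
  have hconst := constant_of_has_deriv_right_zero (f := fun r => p r / (profile ψ r : ℂ)) (a := 0)
    (b := ‖x‖) (fun r _ => (hquot r).continuousAt.continuousWithinAt) ?_ ‖x‖ ⟨norm_nonneg x, le_rfl⟩
  · have hxn : ‖x‖ • n = x := by rw [hn, smul_inv_smul₀ (norm_ne_zero_iff.2 hx)]
    simp only [hp, hxn, zero_smul] at hconst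
    rw [← hconst, mul_div_cancel₀]
    exact Complex.ofReal_ne_zero.2 (hUpos _).ne'
  · intro r hr
    simpa [hzero r hr.1] using (hquot r).hasDerivWithinAt

end IsPekarMinimizer

theorem exists_exp_eq_of_norm_eq_one {z : ℂ} (hz : ‖z‖ = 1) :
    ∃ θ ∈ Set.Ico (0 : ℝ) (2 * π), Complex.exp (Complex.I * θ) = z := by
  refine ⟨toIcoMod two_pi_pos 0 z.arg, by simpa using toIcoMod_mem_Ico' two_pi_pos z.arg, ?_⟩
  have h := Complex.norm_mul_exp_arg_mul_I z
  rw [hz, Complex.ofReal_one, one_mul] at h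
  rw [toIcoMod, zsmul_eq_mul, Complex.ofReal_sub, mul_sub, mul_comm Complex.I (z.arg : ℂ)]
  push_cast
  rw [show Complex.I * ((toIcoDiv two_pi_pos 0 z.arg : ℂ) * (2 * π)) =
    (toIcoDiv two_pi_pos 0 z.arg : ℂ) * (2 * π * Complex.I) by ring,
    Complex.exp_periodic.sub_int_mul_eq, h]

/-- Uniqueness of the Pekar minimizer up to translations and phase. -/
theorem pekar_minimizer_unique (ψ₁ ψ₂ : SchwartzMap E3 ℂ)
    (h₁ : (∫ x : E3, ‖ψ₁ x‖ ^ 2) = 1) (h₂ : (∫ x : E3, ‖ψ₂ x‖ ^ 2) = 1)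
    (hmin₁ : ∀ ψ : SchwartzMap E3 ℂ, (∫ x : E3, ‖ψ x‖ ^ 2) = 1 →
      pekarF ψ₁ ≤ pekarF ψ)
    (hmin₂ : ∀ ψ : SchwartzMap E3 ℂ, (∫ x : E3, ‖ψ x‖ ^ 2) = 1 →
      pekarF ψ₂ ≤ pekarF ψ) :
    ∃ θ ∈ Set.Ico (0 : ℝ) (2 * π), ∃ y : E3,
      ∀ x : E3, ψ₂ x = Complex.exp (Complex.I * θ) * ψ₁ (x - y) := by
  have hψ₁ : IsPekarMinimizer ψ₁ := ⟨h₁, hmin₁⟩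
  have hψ₂ : IsPekarMinimizer ψ₂ := ⟨h₂, hmin₂⟩
  obtain ⟨a₁, hrad₁⟩ := hψ₁.exists_radial
  obtain ⟨a₂, hrad₂⟩ := hψ₂.exists_radial
  obtain ⟨κ₁, hF₁⟩ := (hψ₁.comp_sub a₁).exists_pekarProfile hrad₁
  obtain ⟨κ₂, hF₂⟩ := (hψ₂.comp_sub a₂).exists_pekarProfile hrad₂
  obtain ⟨w₁, hw₁, e₁⟩ := (hψ₁.comp_sub a₁).exists_phase hrad₁
  obtain ⟨w₂, hw₂, e₂⟩ := (hψ₂.comp_sub a₂).exists_phase hrad₂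
  obtain ⟨θ, hθ, hexp⟩ := exists_exp_eq_of_norm_eq_one (z := w₂ / w₁)
    (by rw [norm_div, hw₁, hw₂, div_one])
  have hw₁0 : w₁ ≠ 0 := norm_ne_zero_iff.1 (by rw [hw₁]; exact one_ne_zero)
  refine ⟨θ, hθ, a₁ - a₂, fun x => ?_⟩
  have e₁' := e₁ (x + a₂)
  have e₂' := e₂ (x + a₂)
  rw [SchwartzMap.compSubConstCLM_apply] at e₁' e₂'
  rw [add_sub_cancel_right] at e₂'
  rw [e₂', hexp, show x - (a₁ - a₂) = x + a₂ - a₁ by abel, e₁',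
    hF₁.eq_of_mass_one hF₂ (norm_nonneg _)]
  field_simp

end
end

section
/- For all x, y ∈ ℝ³ with x ≠ y, one has ∫_{ℝ³} (1/|x−z|²) (1/|y−z|²) dz = π³ / |x−y|. -/
open MeasureTheory Real

noncomputable section

open Set Filter Topology in
/-- The fundamental theorem of calculus on `(0, ∞)` for a nonnegative derivative. -/
theorem lintegral_Ioi_of_hasDerivAt_of_nonneg {g g' : ℝ → ℝ} {l : ℝ}
    (hderiv : ∀ x ∈ Ici (0 : ℝ), HasDerivAt g (g' x) x) (hpos : ∀ x ∈ Ioi (0 : ℝ), 0 ≤ g' x)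
    (hg : Tendsto g atTop (𝓝 l)) :
    ∫⁻ x in Ioi (0 : ℝ), ENNReal.ofReal (g' x) = ENNReal.ofReal (l - g 0) := by
  rw [← integral_Ioi_of_hasDerivAt_of_nonneg' hderiv hpos hg,
    ofReal_integral_eq_lintegral_ofReal (integrableOn_Ioi_deriv_of_nonneg' hderiv hpos hg)]
  exact (ae_restrict_iff' measurableSet_Ioi).2 (.of_forall hpos)

open Set Filter Topology in
theorem lintegral_Ioi_two_mul_div_add_sq_mul_sq {a b : ℝ} (ha : 0 < a) (hb : 0 < b) :
    ∫⁻ w in Ioi (0 : ℝ), ENNReal.ofReal (2 * w / (a + w ^ 2 * b) ^ 2) =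
      ENNReal.ofReal (1 / a * (1 / b)) := by
  have hderiv (w : ℝ) : HasDerivAt (fun w : ℝ ↦ -(b * (a + w ^ 2 * b))⁻¹)
      (2 * w / (a + w ^ 2 * b) ^ 2) w := by
    have hne : a + w ^ 2 * b ≠ 0 := by positivity
    have h := ((((hasDerivAt_pow 2 w).mul_const b).const_add a).const_mul b).inv
      (mul_ne_zero hb.ne' hne)
    refine h.neg.congr_deriv ?_
    push_cast
    field_simp
  have hlim : Tendsto (fun w : ℝ ↦ -(b * (a + w ^ 2 * b))⁻¹) atTop (𝓝 0) := by
    rw [← neg_zero]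
    refine (tendsto_inv_atTop_zero.comp (Tendsto.const_mul_atTop hb ?_)).neg
    exact tendsto_atTop_add_const_left _ _ ((tendsto_pow_atTop two_ne_zero).atTop_mul_const hb)
  rw [lintegral_Ioi_of_hasDerivAt_of_nonneg (fun w _ ↦ hderiv w)
    (fun w (hw : 0 < w) ↦ by positivity) hlim]
  congr 1
  field_simp
  simp

open Set Filter Topology in
theorem tendsto_arctan_div_sub_atTop {m : ℝ} (hm : 0 < m) :
    Tendsto (fun r : ℝ ↦ arctan (r / m) / (2 * m) - r / (2 * (r ^ 2 + m ^ 2))) atTop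
      (𝓝 (π / (4 * m))) := by
  have h₁ : Tendsto (fun r : ℝ ↦ arctan (r / m) / (2 * m)) atTop (𝓝 (π / 2 / (2 * m))) :=
    ((tendsto_arctan_atTop.mono_right nhdsWithin_le_nhds).comp
      (tendsto_id.atTop_div_const hm)).div_const _
  have h₂ : Tendsto (fun r : ℝ ↦ r / (2 * (r ^ 2 + m ^ 2))) atTop (𝓝 0) := by
    refine tendsto_of_tendsto_of_tendsto_of_le_of_le' tendsto_const_nhds tendsto_inv_atTop_zero
      ?_ ?_
    · filter_upwards [eventually_gt_atTop 0] with r hr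
      positivity
    · filter_upwards [eventually_gt_atTop 0] with r hr
      rw [inv_eq_one_div, div_le_div_iff₀ (by positivity) hr]
      nlinarith [sq_nonneg m, sq_nonneg r]
  convert h₁.sub h₂ using 2
  ring

theorem hasDerivAt_arctan_div_sub {m : ℝ} (hm : 0 < m) (r : ℝ) :
    HasDerivAt (fun r : ℝ ↦ arctan (r / m) / (2 * m) - r / (2 * (r ^ 2 + m ^ 2)))
      (r ^ 2 * (1 / (r ^ 2 + m ^ 2) ^ 2)) r := by
  have hne : r ^ 2 + m ^ 2 ≠ 0 := by positivity
  have h₁ := ((hasDerivAt_id r).div_const m).arctan.div_const (2 * m)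
  have h₂ := (hasDerivAt_id r).div
    (((hasDerivAt_pow 2 r).add_const (m ^ 2)).const_mul 2) (mul_ne_zero two_ne_zero hne)
  refine (h₁.sub h₂).congr_deriv ?_
  have : 1 + (r / m) ^ 2 ≠ 0 := by positivity
  have : m ^ 2 + r ^ 2 ≠ 0 := by positivity
  simp only [id]
  field_simp
  ring

theorem lintegral_one_div_norm_sq_add_sq_sq {m : ℝ} (hm : 0 < m) :
    ∫⁻ z : E3, ENNReal.ofReal (1 / (‖z‖ ^ 2 + m ^ 2) ^ 2) = ENNReal.ofReal (π ^ 2 / m) := by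
  have hdim : Module.finrank ℝ E3 = 3 := by simp
  have hderiv (r : ℝ) (_ : r ∈ Set.Ici (0 : ℝ)) := hasDerivAt_arctan_div_sub hm r
  have hpos (r : ℝ) (_ : r ∈ Set.Ioi (0 : ℝ)) : 0 ≤ r ^ 2 * (1 / (r ^ 2 + m ^ 2) ^ 2) := by
    positivity
  have hlim := tendsto_arctan_div_sub_atTop hm
  rw [← ofReal_integral_eq_lintegral_ofReal]
  · have h := integral_fun_norm_addHaar (volume : Measure E3)
      (fun r : ℝ ↦ 1 / (r ^ 2 + m ^ 2) ^ 2)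
    simp only [hdim, smul_eq_mul, nsmul_eq_mul, Nat.add_one_sub_one] at h
    rw [h, integral_Ioi_of_hasDerivAt_of_nonneg' hderiv hpos hlim, measureReal_def,
      EuclideanSpace.volume_ball_fin_three]
    congr 1
    have : (0 : ℝ) ≤ π * 4 / 3 := by positivity
    simp [this]
    field_simp
  · refine (integrable_fun_norm_addHaar (volume : Measure E3)
      (f := fun r : ℝ ↦ 1 / (r ^ 2 + m ^ 2) ^ 2)).2 ?_
    simp only [hdim, smul_eq_mul, Nat.add_one_sub_one]
    exact integrableOn_Ioi_deriv_of_nonneg' hderiv hpos hlim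
  · exact .of_forall fun z ↦ by positivity

/-- Completing the square. -/
theorem norm_sub_sq_add_sq_mul_norm_sub_sq (x y z : E3) (w : ℝ) :
    ‖x - z‖ ^ 2 + w ^ 2 * ‖y - z‖ ^ 2 =
      (1 + w ^ 2) * (‖z - (1 + w ^ 2)⁻¹ • (x + w ^ 2 • y)‖ ^ 2 +
        (w * ‖x - y‖ / (1 + w ^ 2)) ^ 2) := by
  have : 1 + w ^ 2 ≠ 0 := by positivity
  simp only [div_pow, mul_pow, EuclideanSpace.real_norm_sq_eq, Fin.sum_univ_three,
    PiLp.sub_apply, PiLp.add_apply, PiLp.smul_apply, smul_eq_mul]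
  field_simp
  ring

theorem lintegral_two_mul_div_norm_sub_sq_add {x y : E3} (hxy : x ≠ y) {w : ℝ} (hw : 0 < w) :
    ∫⁻ z : E3, ENNReal.ofReal (2 * w / (‖x - z‖ ^ 2 + w ^ 2 * ‖y - z‖ ^ 2) ^ 2) =
      ENNReal.ofReal (2 * π ^ 2 / ‖x - y‖ * (1 / (1 + w ^ 2))) := by
  have hd : 0 < ‖x - y‖ := norm_pos_iff.2 (sub_ne_zero.2 hxy)
  have hw' : 0 < 1 + w ^ 2 := by positivity
  have hm : 0 < w * ‖x - y‖ / (1 + w ^ 2) := by positivity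
  set m := w * ‖x - y‖ / (1 + w ^ 2) with hmdef
  set c := (1 + w ^ 2)⁻¹ • (x + w ^ 2 • y) with hc
  have key (z : E3) : ENNReal.ofReal (2 * w / (‖x - z‖ ^ 2 + w ^ 2 * ‖y - z‖ ^ 2) ^ 2) =
      ENNReal.ofReal (2 * w / (1 + w ^ 2) ^ 2) *
        ENNReal.ofReal (1 / (‖z - c‖ ^ 2 + m ^ 2) ^ 2) := by
    rw [← ENNReal.ofReal_mul (by positivity), norm_sub_sq_add_sq_mul_norm_sub_sq]
    congr 1
    rw [mul_pow, div_mul_div_comm, mul_one]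
  simp_rw [key]
  rw [lintegral_const_mul' _ _ ENNReal.ofReal_ne_top,
    lintegral_sub_right_eq_self (fun z : E3 ↦ ENNReal.ofReal (1 / (‖z‖ ^ 2 + m ^ 2) ^ 2)) c,
    lintegral_one_div_norm_sq_add_sq_sq hm, ← ENNReal.ofReal_mul (by positivity)]
  congr 1
  rw [hmdef]
  field_simp

/-- The Coulomb convolution identity
`∫ |x−z|⁻² |y−z|⁻² dz = π³ / |x−y|`. -/
theorem coulomb_convolution_identity (x y : E3) (hxy : x ≠ y) :
    (∫ z : E3, (1 / ‖x - z‖ ^ 2) * (1 / ‖y - z‖ ^ 2)) = π ^ 3 / ‖x - y‖ := by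
  have hd : 0 < ‖x - y‖ := norm_pos_iff.2 (sub_ne_zero.2 hxy)
  have hae : ∀ᵐ z : E3, ENNReal.ofReal (1 / ‖x - z‖ ^ 2 * (1 / ‖y - z‖ ^ 2)) =
      ∫⁻ w in Set.Ioi (0 : ℝ),
        ENNReal.ofReal (2 * w / (‖x - z‖ ^ 2 + w ^ 2 * ‖y - z‖ ^ 2) ^ 2) := by
    filter_upwards [Measure.ae_ne volume x, Measure.ae_ne volume y] with z hx hy
    have hx' : 0 < ‖x - z‖ := norm_pos_iff.2 (sub_ne_zero.2 hx.symm)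
    have hy' : 0 < ‖y - z‖ := norm_pos_iff.2 (sub_ne_zero.2 hy.symm)
    rw [lintegral_Ioi_two_mul_div_add_sq_mul_sq (by positivity) (by positivity)]
  rw [integral_eq_lintegral_of_nonneg_ae (.of_forall fun z ↦ by positivity)
    (by fun_prop : Measurable _).aestronglyMeasurable, lintegral_congr_ae hae,
    lintegral_lintegral_swap (by fun_prop),
    setLIntegral_congr_fun measurableSet_Ioi
      (fun w hw ↦ lintegral_two_mul_div_norm_sub_sq_add hxy hw)]
  have hderiv (w : ℝ) (_ : w ∈ Set.Ici (0 : ℝ)) :=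
    (hasDerivAt_arctan w).const_mul (2 * π ^ 2 / ‖x - y‖)
  rw [lintegral_Ioi_of_hasDerivAt_of_nonneg hderiv (fun w _ ↦ by positivity)
    ((tendsto_arctan_atTop.mono_right nhdsWithin_le_nhds).const_mul _),
    ENNReal.toReal_ofReal (by simp; positivity)]
  simp
  field_simp

end
end
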